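/- arXiv:2105.11557 — 3 statements merged into one kernel-verified Lean document; each statement's English description precedes it below -/
import Mathlib

section
/- Let Γ be a countable group, let F ⊆ Γ be a finite subset, and let Γ act freely on a standard Borel space X by a Borel action. Let J ⊆ Free(2^Γ) be a β-measurable set that is independent in the Schreier graph G(Free(2^Γ), F). Then for every real α with 0 < α < β(J) there exist integers k ≥ 1 and ℓ ≥ 1 and Borel G(X, F)-independent sets I_1, …, I_ℓ ⊆ X such that every point of X belongs to at least k of the sets I_1, …, I_ℓ and such that ℓ·α ≤ k. (In other words, the Borel fractional chromatic number of G(X, F) is at most 1/α_β(G(Free(2^Γ), F)).) -/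
open MeasureTheory

/-- The Bernoulli shift action of a group `Γ` on `2^Γ = (Γ → Bool)`,
given by `(γ · x) δ = x (δ * γ)`. -/
def bernoulliShift {Γ : Type*} [Group Γ] (γ : Γ) (x : Γ → Bool) : Γ → Bool :=
  fun δ => x (δ * γ)

/-- The free part `Free(2^Γ)` of the Bernoulli shift: points with trivial stabilizer. -/
def freePart (Γ : Type*) [Group Γ] : Set (Γ → Bool) :=
  {x | ∀ γ : Γ, γ ≠ 1 → bernoulliShift γ x ≠ x}

/-- `β` is the product of countably many copies of the uniform measure on `{0,1}`:
it gives each cylinder determined by finitely many coordinates its natural measure. -/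
def IsBernoulliMeasure {Γ : Type*} [Group Γ] (β : Measure (Γ → Bool)) : Prop :=
  ∀ (D : Finset Γ) (φ : Γ → Bool),
    β {x | ∀ δ ∈ D, x δ = φ δ} = (1 / 2 : ENNReal) ^ D.card

/-- Adjacency in the Schreier graph of the free part of the Bernoulli shift with
respect to a finite set `F`: distinct free points `x, y` with `y = σ · x` for some
`σ ∈ F ∪ F⁻¹`. -/
def schreierAdj {Γ : Type*} [Group Γ] (F : Finset Γ) (x y : Γ → Bool) : Prop :=
  x ∈ freePart Γ ∧ y ∈ freePart Γ ∧ x ≠ y ∧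
    ∃ σ : Γ, (σ ∈ F ∨ σ⁻¹ ∈ F) ∧ y = bernoulliShift σ x

/-- A set of vertices is independent w.r.t. an adjacency relation if no two of its
elements are adjacent. -/
def IndepIn {V : Type*} (Adj : V → V → Prop) (I : Set V) : Prop :=
  ∀ x ∈ I, ∀ y ∈ I, ¬ Adj x y

/-- Adjacency in the Schreier graph of a (left) action of `Γ` on `X` with respect to a
finite set `F`: distinct points `x, y` with `y = σ • x` for some `σ ∈ F ∪ F⁻¹`. -/
def schreierActionAdj {Γ X : Type*} [Group Γ] [MulAction Γ X] (F : Finset Γ)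
    (x y : X) : Prop :=
  x ≠ y ∧ ∃ σ : Γ, (σ ∈ F ∨ σ⁻¹ ∈ F) ∧ y = σ • x

/-- Countable Borel proper colouring. -/
lemma exists_nat_coloring {Γ : Type*} [Group Γ]
    {X : Type*} [MeasurableSpace X] [StandardBorelSpace X] [MulAction Γ X]
    (hmeas : ∀ γ : Γ, Measurable fun x : X => γ • x)
    (hfree : ∀ γ : Γ, γ ≠ 1 → ∀ x : X, γ • x ≠ x)
    (S : Finset Γ) (hS : (1 : Γ) ∉ S) :
    ∃ c : X → ℕ, Measurable c ∧ ∀ s ∈ S, ∀ x, c (s • x) ≠ c x := by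
  classical
  obtain ⟨e, he, hinj⟩ := MeasurableSpace.measurable_injection_nat_bool_of_countablySeparated X
  obtain ⟨L, hL⟩ := exists_surjective_nat (List Bool)
  -- A code is a finite list of bits
  let A : List Bool → Set X := fun l => {x | ∀ i : Fin l.length, e x i = l.get i}
  have hAm : ∀ l, MeasurableSet (A l) := by
    intro l
    have : A l = ⋂ i : Fin l.length, (fun x => e x i) ⁻¹' {l.get i} := by
      ext x; simp [A]
    rw [this]
    exact MeasurableSet.iInter fun i =>
      ((measurable_pi_apply _).comp he) (MeasurableSet.singleton _)
  let Q : X → ℕ → Prop := fun x n => x ∈ A (L n) ∧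
    ∀ s ∈ S, s • x ∉ A (L n)
  have hQ : ∀ x, ∃ n, Q x n := by
    intro x
    have h1 : ∀ s ∈ S, ∃ i, e (s • x) i ≠ e x i := by
      intro s hs
      by_contra! h
      exact hfree s (fun h' => hS (h' ▸ hs)) x (hinj (funext h))
    choose! g hg using h1
    obtain ⟨N, hN⟩ : ∃ N, ∀ s ∈ S, g s < N :=
      ⟨S.sup g + 1, fun s hs => Nat.lt_succ_of_le (Finset.le_sup hs)⟩
    obtain ⟨n, hn⟩ := hL (List.ofFn fun i : Fin N => e x i)
    refine ⟨n, ?_, ?_⟩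
    · rw [hn]; simp [A]
    · intro s hs h
      rw [hn] at h
      simp only [A, Set.mem_ofPred_eq] at h
      have hlt : g s < N := hN s hs
      have := h ⟨g s, by simpa using hlt⟩
      simp at this
      exact hg s hs this
  refine ⟨fun x => Nat.find (hQ x), ?_, ?_⟩
  · refine measurable_find hQ ?_
    intro n
    have : {x | Q x n} = A (L n) ∩
        ⋂ s ∈ S, (fun x => s • x) ⁻¹' (A (L n))ᶜ := by
      ext x; simp [Q]
    rw [this]
    exact (hAm _).inter (Finset.measurableSet_biInter S fun s _ => hmeas s (hAm _).compl)
  · intro s hs x h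
    have h1 := Nat.find_spec (hQ x)
    have h2 := Nat.find_spec (hQ (s • x))
    simp only at h
    rw [h] at h2
    exact h1.2 s hs h2.1

/-- least natural number outside a finset -/
lemma exists_fresh (T : Finset ℕ) : ∃ n, n ∉ T ∧ n ≤ T.card := by
  by_contra! h
  have : Finset.range (T.card + 1) ⊆ T := by
    intro n hn
    by_contra h'
    have := h n h'
    simp at hn
    omega
  have := Finset.card_le_card this
  simp at this

/-- Greedy colouring, stage by stage. -/
noncomputable def greedy {Γ X : Type*} [Group Γ] [MulAction Γ X] (S : Finset Γ) (c : X → ℕ)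
    (fr : (S → ℕ) → ℕ) : ℕ → X → ℕ
  | 0 => fun _ => 0
  | n + 1 => fun x => if c x = n then fr (fun s => greedy S c fr n (s.1 • x))
      else greedy S c fr n x

lemma exists_fin_coloring {Γ : Type*} [Group Γ]
    {X : Type*} [MeasurableSpace X] [StandardBorelSpace X] [MulAction Γ X]
    (hmeas : ∀ γ : Γ, Measurable fun x : X => γ • x)
    (hfree : ∀ γ : Γ, γ ≠ 1 → ∀ x : X, γ • x ≠ x)
    (S : Finset Γ) (hS : (1 : Γ) ∉ S) (hinv : ∀ s ∈ S, s⁻¹ ∈ S) :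
    ∃ c : X → ℕ, Measurable c ∧ (∀ x, c x ≤ S.card) ∧ ∀ s ∈ S, ∀ x, c (s • x) ≠ c x := by
  classical
  obtain ⟨c, hc, hcol⟩ := exists_nat_coloring hmeas hfree S hS
  have hf : ∀ t : S → ℕ, ∃ n, (∀ s, t s ≠ n) ∧ n ≤ S.card := by
    intro t
    obtain ⟨n, h1, h2⟩ := exists_fresh (Finset.univ.image t)
    refine ⟨n, by simpa using h1, h2.trans (Finset.card_image_le.trans (by simp))⟩
  choose fr hfr1 hfr2 using hf
  have hm : ∀ n, Measurable (greedy (X := X) S c fr n) := by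
    intro n
    induction n with
    | zero => exact measurable_const
    | succ n ih =>
      refine Measurable.ite (hc (MeasurableSet.singleton n)) ?_ ih
      exact (measurable_of_countable fr).comp
        (measurable_pi_lambda _ fun s => ih.comp (hmeas s.1))
  have hle : ∀ n x, greedy S c fr n x ≤ S.card := by
    intro n
    induction n with
    | zero => intro x; simp [greedy]
    | succ n ih => intro x; simp only [greedy]; split_ifs; exacts [hfr2 _, ih x]
  have hst : ∀ x n, c x < n → greedy S c fr n x = greedy S c fr (c x + 1) x := by
    intro x n hn
    induction n, hn using Nat.le_induction with
    | base => rfl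
    | succ n hn ih =>
      rw [← ih, greedy]
      exact if_neg (by have := Nat.lt_of_succ_le hn; omega)
  have key : ∀ s ∈ S, ∀ x, c (s • x) < c x →
      greedy S c fr (c (s • x) + 1) (s • x) ≠ greedy S c fr (c x + 1) x := by
    intro s hs x hlt
    rw [← hst _ _ hlt]
    have h0 : greedy S c fr (c x + 1) x = fr (fun s => greedy S c fr (c x) (s.1 • x)) := by
      rw [greedy]; exact if_pos rfl
    rw [h0]
    exact hfr1 (fun s => greedy S c fr (c x) (s.1 • x)) ⟨s, hs⟩
  refine ⟨fun x => greedy S c fr (c x + 1) x, ?_, fun x => hle _ _, ?_⟩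
  · have : Measurable fun p : ℕ × X => greedy S c fr (p.1 + 1) p.2 :=
      measurable_from_prod_countable_right fun n => hm (n + 1)
    exact this.comp (hc.prodMk measurable_id)
  · intro s hs x
    rcases lt_or_gt_of_ne (hcol s hs x) with h | h
    · exact key s hs x h
    · have := key s⁻¹ (hinv s hs) (s • x) (by simpa using h)
      simp only [inv_smul_smul] at this
      exact this.symm

/-- counting extensions of patterns along an injection -/
lemma card_extensions {D : Type*} [Fintype D] (m : ℕ) (ι : D → Fin m)
    (hι : Function.Injective ι) (P : Set (D → Bool)) :
    Nat.card P * 2 ^ (m - Fintype.card D) ≤ Nat.card {f : Fin m → Bool // f ∘ ι ∈ P} := by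
  classical
  have hcard : Nat.card ({j // j ∉ Set.range ι} → Bool) = 2 ^ (m - Fintype.card D) := by
    rw [Nat.card_eq_fintype_card, Fintype.card_fun, Fintype.card_bool,
      Fintype.card_subtype_compl]
    congr 2
    · simp
    · exact (Fintype.card_congr (Equiv.ofInjective ι hι)).symm
  rw [← hcard, ← Nat.card_prod]
  let Φ : P × ({j // j ∉ Set.range ι} → Bool) → {f : Fin m → Bool // f ∘ ι ∈ P} := fun q =>
    ⟨Function.extend ι q.1.1 (fun j => if h : j ∉ Set.range ι then q.2 ⟨j, h⟩ else false), by
      rw [Function.extend_comp hι]; exact q.1.2⟩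
  refine Nat.card_le_card_of_injective Φ ?_
  rintro ⟨⟨p, hp⟩, g⟩ ⟨⟨p', hp'⟩, g'⟩ h
  have h0 := congrArg Subtype.val h
  simp only [Φ] at h0
  have h1 : p = p' := by
    have := congrArg (· ∘ ι) h0
    simpa only [Function.extend_comp hι] using this
  have h2 : g = g' := by
    ext ⟨j, hj⟩
    have := congrFun h0 j
    rw [Function.extend_apply' _ _ _ hj, Function.extend_apply' _ _ _ hj,
      dif_pos hj, dif_pos hj] at this
    rw [this]
  subst h1 h2; rfl

/-- compactness: separating pairs in `K` by finitely many coordinates -/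
lemma exists_finite_sep {Γ : Type*} [Group Γ] (K : Set (Γ → Bool)) (hK : IsCompact K) (σ : Γ)
    (h : ∀ y ∈ K, bernoulliShift σ y ∉ K) :
    ∃ E : Finset Γ, ∀ y ∈ K, ∀ z ∈ K, ∃ δ ∈ E, z δ ≠ y (δ * σ) := by
  have hKK := hK.prod hK
  obtain ⟨E, hE⟩ := hKK.elim_finite_subcover
    (fun δ : Γ => {q : (Γ → Bool) × (Γ → Bool) | q.2 δ ≠ q.1 (δ * σ)})
    (fun δ => isOpen_ne_fun (by fun_prop) (by fun_prop)) (by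
      rintro ⟨y, z⟩ ⟨hy, hz⟩
      simp only [Set.mem_iUnion, Set.mem_ofPred_eq]
      by_contra! h'
      apply h y hy
      have : bernoulliShift σ y = z := funext fun δ => (h' δ).symm
      rwa [this])
  refine ⟨E, fun y hy z hz => ?_⟩
  have := hE (Set.mk_mem_prod hy hz)
  simpa using this

lemma measure_le_patterns {Γ : Type*} [Group Γ] (β : Measure (Γ → Bool))
    (hβ : IsBernoulliMeasure β) (D : Finset Γ) (P : Set (D → Bool)) :
    (β {x | (fun δ : D => x δ.1) ∈ P}).toReal ≤ Nat.card P * (1 / 2 : ℝ) ^ D.card := by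
  classical
  have h1 : {x : Γ → Bool | (fun δ : D => x δ.1) ∈ P} ⊆
      ⋃ p : P, {x | ∀ δ ∈ D, x δ = (if h : δ ∈ D then p.1 ⟨δ, h⟩ else false)} := by
    intro x hx
    simp only [Set.mem_iUnion]
    refine ⟨⟨_, hx⟩, fun δ hδ => by simp [hδ]⟩
  have h2 : β {x | (fun δ : D => x δ.1) ∈ P} ≤ Nat.card P * (1 / 2 : ENNReal) ^ D.card := by
    refine (measure_mono h1).trans ((measure_iUnion_le _).trans ?_)
    rw [tsum_fintype]
    simp only [hβ D]
    simp
  have h3 := ENNReal.toReal_mono (by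
    refine ENNReal.mul_ne_top (by simp) (by simp)) h2
  simpa using h3

lemma exists_compact_sub {Γ : Type*} [Countable Γ]
    (β : Measure (Γ → Bool)) [IsProbabilityMeasure β]
    (J : Set (Γ → Bool)) (hJmeas : NullMeasurableSet J β)
    (α : ℝ) (hα0 : 0 < α) (hα : α < (β J).toReal) :
    ∃ K ⊆ J, IsCompact K ∧ α < (β K).toReal := by
  obtain ⟨t, htJ, htm, hte⟩ := hJmeas.exists_measurable_subset_ae_eq
  rw [← measure_congr hte] at hα
  have : ENNReal.ofReal α < β t := by
    rwa [ENNReal.ofReal_lt_iff_lt_toReal hα0.le (measure_ne_top _ _)]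
  obtain ⟨K, hKt, hK, hlt⟩ := htm.exists_lt_isCompact this
  refine ⟨K, hKt.trans htJ, hK, ?_⟩
  rwa [ENNReal.ofReal_lt_iff_lt_toReal hα0.le (measure_ne_top _ _)] at hlt

/-- If `Γ` acts freely on a standard Borel space `X` by a Borel action,
`J` is a `β`-measurable independent set in the Schreier graph of the free part of the
shift, and `0 < α < β(J)`, then there is a Borel `k`-fold `ℓ`-coloring of `G(X, F)` with
`ℓ · α ≤ k`; i.e. `χ*_B(G(X,F)) ≤ 1/α_β(G(Free(2^Γ), F))`. -/
theorem borel_fractional_chromatic_le_inv_independence_number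
    {Γ : Type*} [Group Γ] [Countable Γ]
    (β : Measure (Γ → Bool)) [IsProbabilityMeasure β] (hβ : IsBernoulliMeasure β)
    (F : Finset Γ)
    {X : Type*} [MeasurableSpace X] [StandardBorelSpace X] [MulAction Γ X]
    (hmeas : ∀ γ : Γ, Measurable fun x : X => γ • x)
    (hfree : ∀ γ : Γ, γ ≠ 1 → ∀ x : X, γ • x ≠ x)
    (J : Set (Γ → Bool)) (hJmeas : NullMeasurableSet J β) (hJfree : J ⊆ freePart Γ)
    (hJind : IndepIn (schreierAdj F) J)
    (α : ℝ) (hα0 : 0 < α) (hα : α < (β J).toReal) :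
    ∃ (k ℓ : ℕ) (I : Fin ℓ → Set X),
      1 ≤ k ∧ 1 ≤ ℓ ∧
      (∀ i, MeasurableSet (I i) ∧ IndepIn (schreierActionAdj F) (I i)) ∧
      (∀ x : X, k ≤ Nat.card {i : Fin ℓ // x ∈ I i}) ∧
      (ℓ : ℝ) * α ≤ (k : ℝ) := by

  classical
  obtain ⟨K, hKJ, hK, hαK⟩ := exists_compact_sub β J hJmeas α hα0 hα
  have hKσ : ∀ σ : Γ, σ ≠ 1 → (σ ∈ F ∨ σ⁻¹ ∈ F) → ∀ y ∈ K, bernoulliShift σ y ∉ K := by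
    intro σ h1 hσ y hy hy'
    exact hJind y (hKJ hy) _ (hKJ hy') ⟨hJfree (hKJ hy), hJfree (hKJ hy'),
      (hJfree (hKJ hy) σ h1).symm, σ, hσ, rfl⟩
  have hE : ∀ σ : Γ, ∃ E : Finset Γ, σ ≠ 1 → (σ ∈ F ∨ σ⁻¹ ∈ F) →
      ∀ y ∈ K, ∀ z ∈ K, ∃ δ ∈ E, z δ ≠ y (δ * σ) := by
    intro σ
    by_cases h : σ ≠ 1 ∧ (σ ∈ F ∨ σ⁻¹ ∈ F)
    · obtain ⟨E, hE⟩ := exists_finite_sep K hK σ (hKσ σ h.1 h.2)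
      exact ⟨E, fun _ _ => hE⟩
    · exact ⟨∅, fun h1 h2 => absurd ⟨h1, h2⟩ h⟩
  choose E hE using hE
  let F' : Finset Γ := F ∪ F.image (·⁻¹)
  have hF' : ∀ σ, (σ ∈ F ∨ σ⁻¹ ∈ F) → σ ∈ F' := by
    intro σ hσ
    rcases hσ with h | h
    · exact Finset.mem_union_left _ h
    · exact Finset.mem_union_right _ (Finset.mem_image.2 ⟨_, h, inv_inv σ⟩)
  let D : Finset Γ := F'.biUnion fun σ => E σ ∪ (E σ).image (· * σ)
  let P : Set (D → Bool) := {p | ∃ y ∈ K, p = fun δ => y δ.1}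
  have hP : α < Nat.card P * (1 / 2 : ℝ) ^ D.card := by
    refine hαK.trans_le (le_trans ?_ (measure_le_patterns β hβ D P))
    exact ENNReal.toReal_mono (measure_ne_top _ _) (measure_mono fun y hy => ⟨y, hy, rfl⟩)
  let S : Finset Γ := ((D ×ˢ D).image fun q => q.1 * q.2⁻¹).erase 1
  have hSinv : ∀ s ∈ S, s⁻¹ ∈ S := by
    intro s hs
    simp only [S, Finset.mem_erase, Finset.mem_image, Finset.mem_product, Prod.exists] at hs ⊢
    obtain ⟨h1, a, b, ⟨ha, hb⟩, rfl⟩ := hs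
    exact ⟨fun h => h1 (by rw [mul_inv_rev, inv_inv] at h; rw [← mul_inv_eq_one.1 h]; simp), b, a, ⟨hb, ha⟩, by group⟩
  obtain ⟨c, hc, hcle, hcol⟩ := exists_fin_coloring hmeas hfree S (by simp [S]) hSinv
  let m := S.card + 1 + D.card
  have hcm : ∀ x, c x < m := fun x => by have := hcle x; omega
  let c' : X → Fin m := fun x => ⟨c x, hcm x⟩
  have hc' : Measurable c' := by
    refine measurable_to_countable' fun i => ?_
    have : c' ⁻¹' {i} = c ⁻¹' {i.1} := by ext x; simp [c', Fin.ext_iff]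
    rw [this]; exact hc (MeasurableSet.singleton _)
  have hinj : ∀ x : X, Function.Injective fun δ : D => c' (δ.1 • x) := by
    intro x a b hab
    by_contra hne
    have hab' : c (a.1 • x) = c (b.1 • x) := congrArg Fin.val hab
    have hs : a.1 * b.1⁻¹ ∈ S := by
      simp only [S, Finset.mem_erase, Finset.mem_image, Finset.mem_product, Prod.exists]
      exact ⟨fun h => hne (Subtype.ext (mul_inv_eq_one.1 h)), a, b, ⟨a.2, b.2⟩, rfl⟩
    apply hcol _ hs (b.1 • x)
    rw [smul_smul, inv_mul_cancel_right, hab']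
  let I : (Fin m → Bool) → Set X := fun f => {x | f ∘ (fun δ : D => c' (δ.1 • x)) ∈ P}
  let e : Fin (2 ^ m) ≃ (Fin m → Bool) := (Fintype.equivFinOfCardEq (by simp)).symm
  have hk : (1 : ℕ) ≤ Nat.card P := by
    by_contra! h
    have : Nat.card P = 0 := by omega
    rw [this] at hP
    simp at hP; linarith
  refine ⟨Nat.card P * 2 ^ (m - D.card), 2 ^ m, fun i => I (e i), ?_, Nat.one_le_two_pow,
    fun i => ⟨?_, ?_⟩, fun x => ?_, ?_⟩
  · exact Nat.mul_pos hk (by positivity)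
  · have hmm : Measurable fun x : X => (e i) ∘ (fun δ : D => c' (δ.1 • x)) :=
      measurable_pi_lambda _ fun δ =>
        (measurable_of_countable (e i)).comp (hc'.comp (hmeas δ.1))
    exact hmm (Set.toFinite P).measurableSet
  · rintro x ⟨y, hy, hyx⟩ x' ⟨z, hz, hzx⟩ ⟨hne, σ, hσ, rfl⟩
    have hσ1 : σ ≠ 1 := by
      rintro rfl
      simp at hne
    obtain ⟨δ, hδ, hd⟩ := hE σ hσ1 hσ y hy z hz
    have hD1 : δ ∈ D := Finset.mem_biUnion.2 ⟨σ, hF' σ hσ, Finset.mem_union_left _ hδ⟩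
    have hD2 : δ * σ ∈ D := Finset.mem_biUnion.2 ⟨σ, hF' σ hσ,
      Finset.mem_union_right _ (Finset.mem_image_of_mem _ hδ)⟩
    have e1 := congrFun hyx ⟨_, hD2⟩
    have e2 := congrFun hzx ⟨_, hD1⟩
    simp only [Function.comp_apply, smul_smul] at e1 e2
    exact hd (e2.symm.trans e1)
  · have h1 := card_extensions m _ (hinj x) P
    rw [Fintype.card_coe] at h1
    refine h1.trans (le_of_eq ?_)
    exact (Nat.card_congr (e.subtypeEquiv fun i => Iff.rfl)).symm
  · have hDm : D.card ≤ m := by omega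
    have h2 : (2 : ℝ) ^ m = 2 ^ (m - D.card) * 2 ^ D.card := by
      rw [← pow_add, Nat.sub_add_cancel hDm]
    push_cast
    have h3 : (2 : ℝ) ^ D.card * (1 / 2) ^ D.card = 1 := by
      rw [← mul_pow]; norm_num
    calc (2 : ℝ) ^ m * α ≤ 2 ^ m * (Nat.card P * (1 / 2 : ℝ) ^ D.card) := by gcongr
      _ = Nat.card P * 2 ^ (m - D.card) * ((2 : ℝ) ^ D.card * (1 / 2) ^ D.card) := by
        rw [h2]; ring
      _ = _ := by rw [h3, mul_one]
end

section
/- Let Γ be a countable group, let F ⊆ Γ be a finite subset, and let G := G(Free(2^Γ), F) be the Schreier graph of the free part of the Bernoulli shift with respect to F. Suppose that there exist β-measurable G-independent sets J_1, …, J_m whose union is Free(2^Γ). Then inf{ ℓ/k : k ≥ 1 and there exist Borel G-independent sets I_1, …, I_ℓ such that every point of Free(2^Γ) belongs to at least k of them } ≤ m. (That is, the Borel fractional chromatic number of G is at most its β-measurable chromatic number.) -/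
open MeasureTheory

set_option linter.unusedSectionVars false

namespace BFC

variable {Γ : Type*} [Group Γ]

lemma sh_sh (δ γ : Γ) (x : Γ → Bool) :
    bernoulliShift δ (bernoulliShift γ x) = bernoulliShift (δ * γ) x := by
  funext η; simp [bernoulliShift, mul_assoc]

lemma sh_one (x : Γ → Bool) : bernoulliShift 1 x = x := by
  funext η; simp [bernoulliShift]

lemma sh_inv (γ : Γ) (x : Γ → Bool) :
    bernoulliShift γ⁻¹ (bernoulliShift γ x) = x := by
  rw [sh_sh]; simp [sh_one]

lemma sh_meas (γ : Γ) : Measurable (bernoulliShift (Γ := Γ) γ) := by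
  unfold bernoulliShift
  exact measurable_pi_lambda _ fun δ => measurable_pi_apply _

lemma free_sh {x : Γ → Bool} (hx : x ∈ freePart Γ) (γ : Γ) :
    bernoulliShift γ x ∈ freePart Γ := by
  intro δ hδ h
  have h2 : bernoulliShift (γ⁻¹ * δ * γ) x = x := by
    have := congrArg (bernoulliShift γ⁻¹) h
    rw [sh_sh, sh_sh, sh_sh] at this
    simpa [sh_one, mul_assoc] using this
  refine hx _ ?_ h2
  intro h3
  apply hδ
  have : δ = γ * (γ⁻¹ * δ * γ) * γ⁻¹ := by group
  rw [this, h3]; simp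

lemma free_inj {x : Γ → Bool} (hx : x ∈ freePart Γ) {δ γ : Γ}
    (h : bernoulliShift δ x = bernoulliShift γ x) : δ = γ := by
  by_contra hne
  refine hx (γ⁻¹ * δ) ?_ ?_
  · intro h3
    exact hne (inv_mul_eq_one.mp h3).symm
  · rw [← sh_sh, h, sh_inv]

lemma fix_meas [Countable Γ] (γ : Γ) :
    MeasurableSet {x : Γ → Bool | bernoulliShift γ x = x} :=
  measurableSet_eq_fun (sh_meas γ) measurable_id

lemma free_meas [Countable Γ] : MeasurableSet (freePart Γ) := by
  have : freePart Γ = ⋂ γ : Γ, ⋂ _ : γ ≠ 1, {x : Γ → Bool | bernoulliShift γ x = x}ᶜ := by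
    ext x; simp [freePart]
  rw [this]
  exact MeasurableSet.iInter fun γ => MeasurableSet.iInter fun _ => (fix_meas γ).compl

lemma cyl_meas (D : Finset Γ) (φ : Γ → Bool) :
    MeasurableSet {x : Γ → Bool | ∀ δ ∈ D, x δ = φ δ} := by
  have : {x : Γ → Bool | ∀ δ ∈ D, x δ = φ δ} = ⋂ δ ∈ D, (fun x => x δ) ⁻¹' {φ δ} := by
    ext x; simp
  rw [this]
  exact Finset.measurableSet_biInter _ fun δ _ => measurable_pi_apply δ (measurableSet_singleton _)

open Classical in
lemma cyl_measure {β : Measure (Γ → Bool)} (hβ : IsBernoulliMeasure β) (D : Finset Γ)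
    (S : Set (D → Bool)) :
    β (cylinder (α := fun _ => Bool) D S) = (Nat.card S : ENNReal) * (1 / 2) ^ D.card := by
  have h1 : cylinder (α := fun _ => Bool) D S = ⋃ φ ∈ S.toFinset,
      {x : Γ → Bool | ∀ δ ∈ D, x δ = (fun γ => if h : γ ∈ D then φ ⟨γ, h⟩ else false) δ} := by
    ext x
    simp only [mem_cylinder, Set.mem_toFinset, Set.mem_iUnion, Set.mem_ofPred_eq, exists_prop]
    constructor
    · intro h
      refine ⟨_, h, ?_⟩
      intro δ hδ
      simp [hδ]
    · rintro ⟨φ, hφ, h⟩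
      convert hφ using 1
      funext ⟨δ, hδ⟩
      simpa [hδ] using h δ hδ
  rw [h1, measure_biUnion_finset]
  · rw [Finset.sum_congr rfl (fun φ _ => hβ D _)]
    simp [Set.toFinset_card, Nat.card_eq_fintype_card]
  · intro φ _ ψ _ hne
    refine Set.disjoint_left.mpr ?_
    intro x hx hy
    apply hne
    funext ⟨δ, hδ⟩
    have h1 := hx δ hδ
    have h2 := hy δ hδ
    simp only [hδ, dif_pos] at h1 h2
    rw [← h1, ← h2]
  · intro φ _
    exact cyl_meas _ _

lemma bern_ext {β ν : Measure (Γ → Bool)} [IsFiniteMeasure β]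
    (hβ : IsBernoulliMeasure β) (hν : IsBernoulliMeasure ν) : β = ν := by
  refine ext_of_generate_finite (measurableCylinders fun _ : Γ => Bool)
    generateFrom_measurableCylinders.symm isPiSystem_measurableCylinders ?_ ?_
  · intro t ht
    obtain ⟨D, S, -, rfl⟩ := (mem_measurableCylinders t).mp ht
    rw [cyl_measure hβ, cyl_measure hν]
  · have h1 := hβ ∅ (fun _ => false)
    have h2 := hν ∅ (fun _ => false)
    simpa using h1.trans h2.symm

open Classical in
lemma bern_inv {β : Measure (Γ → Bool)} [IsFiniteMeasure β]
    (hβ : IsBernoulliMeasure β) (γ : Γ) {A : Set (Γ → Bool)} (hA : MeasurableSet A) :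
    β (bernoulliShift γ ⁻¹' A) = β A := by
  have : β.map (bernoulliShift γ) = β := by
    refine (bern_ext hβ ?_).symm
    intro D φ
    rw [Measure.map_apply (sh_meas γ) (cyl_meas D φ)]
    have h := hβ (D.image (· * γ)) (fun δ => φ (δ * γ⁻¹))
    rw [Finset.card_image_of_injective _ (mul_left_injective γ)] at h
    rw [← h]
    congr 1
    ext x
    constructor
    · intro h δ hδ
      obtain ⟨b, hb, rfl⟩ := Finset.mem_image.mp hδ
      simpa [bernoulliShift] using h b hb
    · intro h δ hδ
      simpa [bernoulliShift] using h (δ * γ) (Finset.mem_image_of_mem _ hδ)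
  conv_rhs => rw [← this]
  rw [Measure.map_apply (sh_meas γ) hA]

open Classical in
lemma exists_disj [Infinite Γ] {γ : Γ} (hγ : γ ≠ 1) (n : ℕ) :
    ∃ E : Finset Γ, E.card = n ∧ Disjoint E (E.image (· * γ)) := by
  induction n with
  | zero => exact ⟨∅, by simp⟩
  | succ n ih =>
    obtain ⟨E, hE, hd⟩ := ih
    obtain ⟨δ, hδ⟩ := Infinite.exists_notMem_finset
      (E ∪ E.image (· * γ) ∪ E.image (· * γ⁻¹))
    simp only [Finset.mem_union, Finset.mem_image, not_or, not_exists, not_and] at hδ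
    obtain ⟨⟨h1, h2⟩, h3⟩ := hδ
    refine ⟨insert δ E, by simp [h1, hE], ?_⟩
    rw [Finset.disjoint_left] at hd ⊢
    intro a ha hb
    simp only [Finset.mem_insert, Finset.mem_image] at ha hb hd
    obtain ⟨b, hb, rfl⟩ := hb
    rcases ha with ha | ha <;> rcases hb with hb | hb
    · subst hb; exact hγ (by simpa using ha)
    · exact h2 b hb ha
    · subst hb; exact h3 _ ha (by simp)
    · exact hd ha ⟨b, hb, rfl⟩

open Classical in
lemma fix_null [Infinite Γ] {β : Measure (Γ → Bool)}
    (hβ : IsBernoulliMeasure β) {γ : Γ} (hγ : γ ≠ 1) :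
    β {x : Γ → Bool | bernoulliShift γ x = x} = 0 := by
  have key : ∀ n : ℕ, β {x : Γ → Bool | bernoulliShift γ x = x} ≤ (1 / 2 : ENNReal) ^ n := by
    intro n
    obtain ⟨E, hE, hd⟩ := exists_disj hγ n
    let ext : (E → Bool) → Γ → Bool := fun φ δ =>
      if h : δ ∈ E then φ ⟨δ, h⟩ else if h : δ * γ⁻¹ ∈ E then φ ⟨δ * γ⁻¹, h⟩ else false
    have hsub : {x : Γ → Bool | bernoulliShift γ x = x} ⊆
        ⋃ φ : E → Bool, {x | ∀ δ ∈ E ∪ E.image (· * γ), x δ = ext φ δ} := by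
      intro x hx
      refine Set.mem_iUnion.mpr ⟨fun δ => x δ, ?_⟩
      intro δ hδ
      simp only [ext]
      by_cases h1 : δ ∈ E
      · simp [h1]
      · have h2 : δ * γ⁻¹ ∈ E := by
          rcases Finset.mem_union.mp hδ with h | h
          · exact absurd h h1
          · obtain ⟨b, hb, rfl⟩ := Finset.mem_image.mp h
            simpa using hb
        simp only [h1, h2, dif_pos, dif_neg, not_false_eq_true]
        have := congrFun hx (δ * γ⁻¹)
        simpa [bernoulliShift] using this
    calc _ ≤ _ := measure_mono hsub
      _ ≤ ∑ φ : E → Bool, β {x | ∀ δ ∈ E ∪ E.image (· * γ), x δ = ext φ δ} := by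
        simpa using measure_iUnion_fintype_le β
          (fun φ : E → Bool => {x | ∀ δ ∈ E ∪ E.image (· * γ), x δ = ext φ δ})
      _ = ∑ φ : E → Bool, (1 / 2 : ENNReal) ^ (n + n) := by
        refine Finset.sum_congr rfl fun φ _ => ?_
        rw [hβ, Finset.card_union_of_disjoint hd,
          Finset.card_image_of_injective _ (mul_left_injective γ), hE]
      _ = (1 / 2 : ENNReal) ^ n := by
        simp only [Finset.sum_const, Finset.card_univ, Fintype.card_fun, Fintype.card_bool,
          Fintype.card_coe, hE, nsmul_eq_mul, pow_add]
        push_cast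
        rw [← mul_assoc, ← mul_pow]
        simp [ENNReal.mul_inv_cancel]
  have ht : Filter.Tendsto (fun n : ℕ => (1 / 2 : ENNReal) ^ n) Filter.atTop (nhds 0) :=
    ENNReal.tendsto_pow_atTop_nhds_zero_of_lt_one (by simp)
  exact le_antisymm (ge_of_tendsto' ht key) (zero_le)

lemma free_full [Infinite Γ] [Countable Γ] {β : Measure (Γ → Bool)} [IsProbabilityMeasure β]
    (hβ : IsBernoulliMeasure β) : β (freePart Γ) = 1 := by
  rw [← prob_compl_eq_zero_iff free_meas]
  have : (freePart Γ)ᶜ = ⋃ γ : Γ, ⋃ _ : γ ≠ 1, {x : Γ → Bool | bernoulliShift γ x = x} := by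
    ext x; simp [freePart]
  rw [this]
  exact measure_iUnion_null fun γ => measure_iUnion_null fun h => fix_null hβ h

open Classical in
/-- pigeonhole -/
lemma exists_fresh (S : Finset Γ) (g : Γ → ℕ) :
    ∃ j, (1 ≤ j ∧ ∀ s ∈ S, g s ≠ j) ∧ j ≤ S.card + 1 := by
  have : (Finset.Icc 1 (S.card + 1) \ S.image g).Nonempty := by
    rw [← Finset.card_pos]
    have h1 := Finset.le_card_sdiff (S.image g) (Finset.Icc 1 (S.card + 1))
    have h2 : (S.image g).card ≤ S.card := Finset.card_image_le
    simp at h1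
    omega
  obtain ⟨j, hj⟩ := this
  simp only [Finset.mem_sdiff, Finset.mem_Icc, Finset.mem_image, not_exists, not_and] at hj
  exact ⟨j, ⟨hj.1.1, hj.2⟩, hj.1.2⟩

lemma ex_fresh (S : Finset Γ) (g : Γ → ℕ) : ∃ j, (1 ≤ j ∧ ∀ s ∈ S, g s ≠ j) :=
  (exists_fresh S g).imp fun _ h => h.1

open Classical in
/-- greedy coloring -/
noncomputable def gc (S : Finset Γ) (A : ℕ → Set (Γ → Bool)) : ℕ → (Γ → Bool) → ℕ
  | 0 => fun _ => 0
  | n + 1 => fun x => if gc S A n x = 0 ∧ x ∈ A n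
      then Nat.find (ex_fresh S (fun s => gc S A n (bernoulliShift s x))) else gc S A n x

open Classical in
lemma gc_succ (S : Finset Γ) (A : ℕ → Set (Γ → Bool)) (n : ℕ) (x : Γ → Bool) :
    gc S A (n + 1) x = if gc S A n x = 0 ∧ x ∈ A n
      then Nat.find (ex_fresh S (fun s => gc S A n (bernoulliShift s x))) else gc S A n x := rfl

lemma gc_meas (S : Finset Γ) (A : ℕ → Set (Γ → Bool)) (hA : ∀ n, MeasurableSet (A n)) (n : ℕ) :
    Measurable (gc S A n) := by
  classical
  induction n with
  | zero => exact measurable_const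
  | succ n ih =>
    unfold gc
    refine Measurable.ite ?_ ?_ ih
    · exact (ih (measurableSet_singleton 0)).inter (hA n)
    · refine measurable_find (p := fun x j => 1 ≤ j ∧ ∀ s ∈ S, gc S A n (bernoulliShift s x) ≠ j)
        (fun x => ex_fresh S _) ?_
      intro k
      have : {x : Γ → Bool | 1 ≤ k ∧ ∀ s ∈ S, gc S A n (bernoulliShift s x) ≠ k} =
          {x | 1 ≤ k} ∩ ⋂ s ∈ S, (fun x => gc S A n (bernoulliShift s x)) ⁻¹' {k}ᶜ := by
        ext x; simp
      rw [this]
      refine (MeasurableSet.const _).inter (Finset.measurableSet_biInter _ fun s _ => ?_)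
      exact (ih.comp (sh_meas s)) (measurableSet_singleton k).compl

lemma gc_le (S : Finset Γ) (A : ℕ → Set (Γ → Bool)) (n : ℕ) (x : Γ → Bool) :
    gc S A n x ≤ S.card + 1 := by
  classical
  induction n with
  | zero => simp [gc]
  | succ n ih =>
    unfold gc
    split_ifs
    · obtain ⟨j, hj, hj'⟩ := exists_fresh S (fun s => gc S A n (bernoulliShift s x))
      exact (Nat.find_min' _ hj).trans hj'
    · exact ih

lemma gc_stable (S : Finset Γ) (A : ℕ → Set (Γ → Bool)) {n k : ℕ} (hk : n ≤ k) (x : Γ → Bool)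
    (h : gc S A n x ≠ 0) : gc S A k x = gc S A n x := by
  classical
  induction k, hk using Nat.le_induction with
  | base => rfl
  | succ k hk ih => 
    rw [gc_succ, if_neg, ih]
    rw [ih]; tauto

lemma gc_pos (S : Finset Γ) (A : ℕ → Set (Γ → Bool)) {n : ℕ} {x : Γ → Bool}
    (h : x ∈ A n) : gc S A (n + 1) x ≠ 0 := by
  classical
  rw [gc_succ]
  split_ifs with h1
  · have := (Nat.find_spec (ex_fresh S (fun s => gc S A n (bernoulliShift s x)))).1
    omega
  · tauto

lemma gc_proper (S : Finset Γ) (hS : ∀ s ∈ S, s⁻¹ ∈ S) (A : ℕ → Set (Γ → Bool))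
    (hA : ∀ n, ∀ x ∈ A n, ∀ s ∈ S, bernoulliShift s x ∉ A n) (n : ℕ) :
    ∀ x, ∀ s ∈ S, gc S A n x ≠ 0 → gc S A n x ≠ gc S A n (bernoulliShift s x) := by
  classical
  induction n with
  | zero => simp [gc]
  | succ n ih =>
    intro x s hs h0
    by_cases h1 : gc S A n x = 0 ∧ x ∈ A n
    · have h2 : ¬ (gc S A n (bernoulliShift s x) = 0 ∧ bernoulliShift s x ∈ A n) :=
        fun h => hA n x h1.2 s hs h.2
      have e1 : gc S A (n+1) (bernoulliShift s x) = gc S A n (bernoulliShift s x) := by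
        rw [gc_succ, if_neg h2]
      rw [e1, gc_succ, if_pos h1]
      exact ((Nat.find_spec (ex_fresh S (fun s => gc S A n (bernoulliShift s x)))).2 s hs).symm
    · have e0 : gc S A (n+1) x = gc S A n x := by
        rw [gc_succ, if_neg h1]
      rw [e0] at h0 ⊢
      by_cases h2 : (gc S A n (bernoulliShift s x) = 0 ∧ bernoulliShift s x ∈ A n)
      · rw [gc_succ, if_pos h2]
        have := (Nat.find_spec (ex_fresh S
          (fun t => gc S A n (bernoulliShift t (bernoulliShift s x))))).2 s⁻¹ (hS s hs)
        simpa only [sh_inv] using this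
      · rw [gc_succ, if_neg h2]
        exact ih x s hs h0

lemma exists_A [Countable Γ] (S : Finset Γ) (hS1 : (1 : Γ) ∉ S) :
    ∃ A : ℕ → Set (Γ → Bool), (∀ n, MeasurableSet (A n)) ∧
      (∀ n, ∀ x ∈ A n, ∀ s ∈ S, bernoulliShift s x ∉ A n) ∧
      ∀ x ∈ freePart Γ, ∃ n, x ∈ A n := by
  classical
  obtain ⟨e, he⟩ := exists_surjective_nat (Finset Γ × Finset Γ)
  refine ⟨fun n => {x | ∀ δ ∈ (e n).1, x δ = decide (δ ∈ (e n).2)} ∩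
    ⋂ s ∈ S, (bernoulliShift s ⁻¹' {x | ∀ δ ∈ (e n).1, x δ = decide (δ ∈ (e n).2)})ᶜ, ?_, ?_, ?_⟩
  · intro n
    refine (cyl_meas (e n).1 _).inter (Finset.measurableSet_biInter _ fun s _ => ?_)
    exact (sh_meas s (cyl_meas (e n).1 (fun δ => decide (δ ∈ (e n).2)))).compl
  · intro n x hx s hs hx'
    have := Set.mem_iInter₂.mp hx.2 s hs
    exact this hx'.1
  · intro x hx
    have : ∀ s : S, ∃ δ, bernoulliShift s.1 x δ ≠ x δ := by
      intro s
      by_contra hcon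
      push Not at hcon
      exact hx s.1 (fun h => hS1 (h ▸ s.2)) (funext hcon)
    choose w hw using this
    obtain ⟨n, hn⟩ := he (Finset.univ.image w, (Finset.univ.image w).filter (fun δ => x δ = true))
    refine ⟨n, ?_, ?_⟩
    · intro δ hδ
      rw [hn] at hδ ⊢
      simp only at hδ ⊢
      simp only [Finset.mem_filter, hδ, true_and, Bool.decide_eq_true]
    · refine Set.mem_iInter₂.mpr fun s hs hmem => ?_
      have hδ : w ⟨s, hs⟩ ∈ Finset.univ.image w := Finset.mem_image_of_mem _ (Finset.mem_univ _)
      have h1 := hmem (w ⟨s, hs⟩) (by rw [hn]; exact hδ)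
      rw [hn] at h1
      simp only [Finset.mem_filter, hδ, true_and, Bool.decide_eq_true] at h1
      exact hw ⟨s, hs⟩ h1

lemma exists_coloring [Countable Γ] (S : Finset Γ) (hS1 : (1 : Γ) ∉ S) (hS : ∀ s ∈ S, s⁻¹ ∈ S) :
    ∃ (N : ℕ) (c : (Γ → Bool) → Fin N), Measurable c ∧
      ∀ x ∈ freePart Γ, ∀ s ∈ S, c (bernoulliShift s x) ≠ c x := by
  classical
  obtain ⟨A, hAm, hAi, hAc⟩ := exists_A S hS1
  have hex : ∀ x : Γ → Bool, ∃ n, x ∈ A n ∨ x ∉ freePart Γ := by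
    intro x
    by_cases hx : x ∈ freePart Γ
    · exact (hAc x hx).imp fun _ h => Or.inl h
    · exact ⟨0, Or.inr hx⟩
  let ix : (Γ → Bool) → ℕ := fun x => Nat.find (hex x)
  have hix : Measurable ix := measurable_find (p := fun x n => x ∈ A n ∨ x ∉ freePart Γ) hex
    fun k => (hAm k).union free_meas.compl
  have hA' : ∀ x ∈ freePart Γ, x ∈ A (ix x) := fun x hx =>
    (Nat.find_spec (hex x)).resolve_right (not_not.mpr hx)
  let c0 : (Γ → Bool) → ℕ := fun x => gc S A (ix x + 1) x
  have hc0 : Measurable c0 := by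
    have h1 : Measurable (fun p : ℕ × (Γ → Bool) => gc S A (p.1 + 1) p.2) :=
      measurable_from_prod_countable_right fun n => gc_meas S A hAm (n + 1)
    exact h1.comp (hix.prodMk measurable_id)
  refine ⟨S.card + 2, fun x => ⟨c0 x, by have := gc_le S A (ix x + 1) x; simp only [c0]; omega⟩,
    ?_, ?_⟩
  · refine measurable_to_countable' fun j => ?_
    have : (fun x => (⟨c0 x, by have := gc_le S A (ix x + 1) x; simp only [c0]; omega⟩ :
      Fin (S.card + 2))) ⁻¹' {j} = c0 ⁻¹' {j.1} := by
      ext x; simp [Fin.ext_iff]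
    rw [this]
    exact hc0 (measurableSet_singleton _)
  · intro x hx s hs heq
    have heq' : c0 (bernoulliShift s x) = c0 x := congrArg Fin.val heq
    have hy := free_sh hx s
    set y := bernoulliShift s x with hydef
    let M := max (ix x + 1) (ix y + 1)
    have e1 : gc S A M x = c0 x := gc_stable S A (le_max_left _ _) x (gc_pos S A (hA' x hx))
    have e2 : gc S A M y = c0 y := gc_stable S A (le_max_right _ _) y (gc_pos S A (hA' y hy))
    refine gc_proper S hS A hAi M x s hs ?_ ?_
    · rw [e1]; exact gc_pos S A (hA' x hx)
    · rw [← hydef, e1, e2, heq']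

lemma count_extend {ι κ : Type*} [Finite ι] [Finite κ] (e : ι → κ)
    (he : Function.Injective e) (S : Set (ι → Bool)) :
    Nat.card {f : κ → Bool // f ∘ e ∈ S} * Nat.card (ι → Bool) =
      Nat.card S * Nat.card (κ → Bool) := by
  rw [← Nat.card_prod, ← Nat.card_prod]
  refine Nat.card_congr
    { toFun := fun p => (⟨p.1.1 ∘ e, p.1.2⟩, Function.extend e p.2 p.1.1)
      invFun := fun q => (⟨Function.extend e q.1.1 q.2, by
        rw [Function.extend_comp he]; exact q.1.2⟩, q.2 ∘ e)
      left_inv := ?_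
      right_inv := ?_ }
  · rintro ⟨⟨f, hf⟩, ψ⟩
    refine Prod.ext (Subtype.ext ?_) ?_
    · funext k
      by_cases hk : ∃ i, e i = k
      · obtain ⟨i, rfl⟩ := hk
        simp [he.extend_apply]
      · simp [Function.extend_apply' _ _ _ hk]
    · exact Function.extend_comp he _ _
  · rintro ⟨⟨φ, hφ⟩, g⟩
    refine Prod.ext (Subtype.ext ?_) ?_
    · exact Function.extend_comp he _ _
    · funext k
      by_cases hk : ∃ i, e i = k
      · obtain ⟨i, rfl⟩ := hk
        simp [he.extend_apply]
      · simp [Function.extend_apply' _ _ _ hk]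

lemma main_step [Countable Γ] (F : Finset Γ) (hne : (freePart Γ).Nonempty) (D : Finset Γ)
    (S : Set (D → Bool)) (hS : S.Nonempty)
    (hB : ∀ x ∈ cylinder (α := fun _ => Bool) D S, ∀ σ : Γ, (σ ∈ F ∨ σ⁻¹ ∈ F) → σ ≠ 1 →
      bernoulliShift σ x ∉ cylinder (α := fun _ => Bool) D S) :
    ∃ (k ℓ : ℕ) (I : Fin ℓ → Set (Γ → Bool)), 1 ≤ k ∧ k * 2 ^ D.card = Nat.card S * ℓ ∧
        (∀ i, MeasurableSet (I i) ∧ I i ⊆ freePart Γ ∧ IndepIn (schreierAdj F) (I i)) ∧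
        (∀ x ∈ freePart Γ, k ≤ Nat.card {i : Fin ℓ // x ∈ I i}) := by
  classical
  obtain ⟨N, c, hc, hcp⟩ := exists_coloring
    (((D ×ˢ D).image (fun p : Γ × Γ => p.1 * p.2⁻¹)).erase 1) (by simp) (by
      intro s hs
      simp only [Finset.mem_erase, Finset.mem_image, Finset.mem_product, Prod.exists] at hs ⊢
      obtain ⟨h1, a, b, ⟨ha, hb⟩, rfl⟩ := hs
      exact ⟨fun h => h1 (inv_eq_one.mp h), b, a, ⟨hb, ha⟩, by simp⟩)
  let e : (Γ → Bool) → D → Fin N := fun x δ => c (bernoulliShift δ.1 x)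
  have he : ∀ x ∈ freePart Γ, Function.Injective (e x) := by
    intro x hx a b hab
    by_contra hne
    refine hcp (bernoulliShift a.1 x) (free_sh hx _) (b.1 * a.1⁻¹) ?_ ?_
    · simp only [Finset.mem_erase, Finset.mem_image, Finset.mem_product, Prod.exists]
      refine ⟨?_, b.1, a.1, ⟨b.2, a.2⟩, rfl⟩
      intro h
      exact hne (Subtype.ext (mul_inv_eq_one.mp h).symm)
    · rw [sh_sh]
      simpa using hab.symm
  let P : (Fin N → Bool) → (Γ → Bool) → (Γ → Bool) := fun f x δ => f (c (bernoulliShift δ x))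
  have hP : ∀ f, Measurable (P f) := fun f =>
    measurable_pi_lambda _ fun δ => (measurable_of_countable f).comp (hc.comp (sh_meas δ))
  have hPe : ∀ f σ x, P f (bernoulliShift σ x) = bernoulliShift σ (P f x) := by
    intro f σ x
    funext δ
    simp only [P, sh_sh]
    rfl
  let I0 : (Fin N → Bool) → Set (Γ → Bool) := fun f =>
    freePart Γ ∩ P f ⁻¹' (cylinder (α := fun _ => Bool) D S)
  have hmem : ∀ x ∈ freePart Γ, ∀ f, x ∈ I0 f ↔ f ∘ e x ∈ S := fun x hx f =>
    ⟨fun h => h.2, fun h => ⟨hx, h⟩⟩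
  have hcount : ∀ x ∈ freePart Γ, Nat.card {f : Fin N → Bool // f ∘ e x ∈ S} * 2 ^ D.card =
      Nat.card S * 2 ^ N := by
    intro x hx
    have := count_extend (e x) (he x hx) S
    simpa [Nat.card_eq_fintype_card] using this
  obtain ⟨x0, hx0⟩ := hne
  let E := Fintype.equivFin (Fin N → Bool)
  have hSpos : 0 < Nat.card S := by
    have := hS.to_subtype
    exact Nat.card_pos
  refine ⟨Nat.card {f : Fin N → Bool // f ∘ e x0 ∈ S}, Fintype.card (Fin N → Bool),
    fun i => I0 (E.symm i), ?_, ?_, ?_, ?_⟩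
  · rw [Nat.one_le_iff_ne_zero]
    intro h
    have := hcount x0 hx0
    rw [h] at this
    have : 0 < Nat.card S * 2 ^ N := by positivity
    omega
  · rw [hcount x0 hx0]; simp
  · intro i
    refine ⟨free_meas.inter (hP _ (MeasurableSet.cylinder D S.toFinite.measurableSet)),
      Set.inter_subset_left, ?_⟩
    rintro x hx y hy ⟨hxf, -, hxy, σ, hσ, rfl⟩
    have hy2 := hy.2
    rw [Set.mem_preimage, hPe] at hy2
    refine hB _ hx.2 σ hσ ?_ hy2
    rintro rfl
    exact hxy (sh_one x).symm
  · intro x hx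
    have h1 := hcount x hx
    rw [← hcount x0 hx0] at h1
    have h2 := Nat.eq_of_mul_eq_mul_right (by positivity) h1
    rw [← h2]
    refine le_of_eq (Nat.card_congr ?_)
    exact E.subtypeEquiv (fun f => by simp [hmem x hx])

open Classical in
lemma sh_cyl {B : Set (Γ → Bool)} (hB : B ∈ measurableCylinders fun _ : Γ => Bool) (σ : Γ) :
    bernoulliShift σ ⁻¹' B ∈ measurableCylinders fun _ : Γ => Bool := by
  obtain ⟨D, S, -, rfl⟩ := (mem_measurableCylinders B).mp hB
  refine (mem_measurableCylinders _).mpr ⟨D.image (· * σ),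
    {ψ | (fun δ : D => ψ ⟨δ.1 * σ, Finset.mem_image_of_mem (· * σ) δ.2⟩) ∈ S},
    Set.Finite.measurableSet (Set.toFinite _), ?_⟩
  ext x
  rfl

open Classical in
lemma approx {β : Measure (Γ → Bool)} [IsProbabilityMeasure β] (hβ : IsBernoulliMeasure β)
    (T : Finset Γ) {A : Set (Γ → Bool)} (hA : MeasurableSet A)
    (hind : ∀ x ∈ A, ∀ σ ∈ T, bernoulliShift σ x ∉ A) (p : ℝ) (hp : p < β.real A) :
    ∃ (D : Finset Γ) (S : Set (D → Bool)), p < β.real (cylinder (α := fun _ => Bool) D S) ∧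
      ∀ x ∈ cylinder (α := fun _ => Bool) D S, ∀ σ ∈ T,
        bernoulliShift σ x ∉ cylinder (α := fun _ => Bool) D S := by
  have hdense : β.MeasureDense (measurableCylinders fun _ : Γ => Bool) :=
    Measure.MeasureDense.of_generateFrom_isSetAlgebra_finite β isSetAlgebra_measurableCylinders
      generateFrom_measurableCylinders.symm
  have hT : (0 : ℝ) < T.card + 1 := by positivity
  obtain ⟨B, hB, hAB⟩ := hdense.approx A hA (measure_ne_top _ _)
    ((β.real A - p) / (T.card + 1)) (div_pos (by linarith) hT)
  have hBm := MeasurableSet.of_mem_measurableCylinders hB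
  have hAB' : β.real (symmDiff A B) < (β.real A - p) / (T.card + 1) := by
    rw [Measure.real, ← ENNReal.lt_ofReal_iff_toReal_lt (measure_ne_top _ _)]
    exact hAB
  have hB' : B \ ⋃ σ ∈ T, bernoulliShift σ ⁻¹' B ∈ measurableCylinders fun _ : Γ => Bool := by
    refine sdiff_mem_measurableCylinders hB ?_
    exact isSetAlgebra_measurableCylinders.biUnion_mem T (fun σ _ => sh_cyl hB σ)
  obtain ⟨D, S, -, hDS⟩ := (mem_measurableCylinders _).mp hB'
  refine ⟨D, S, ?_, ?_⟩
  · rw [← hDS]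
    have hsub : A ⊆ ((B \ ⋃ σ ∈ T, bernoulliShift σ ⁻¹' B) ∪ symmDiff A B) ∪
        ⋃ σ ∈ T, bernoulliShift σ ⁻¹' (symmDiff A B) := by
      intro x hx
      by_cases hxB : x ∈ B
      · by_cases h : ∃ σ ∈ T, bernoulliShift σ x ∈ B
        · obtain ⟨σ, hσ, h⟩ := h
          right
          exact Set.mem_iUnion₂.mpr ⟨σ, hσ, Or.inr ⟨h, hind x hx σ hσ⟩⟩
        · left; left
          refine ⟨hxB, fun h' => h ?_⟩
          obtain ⟨σ, hσ, h'⟩ := Set.mem_iUnion₂.mp h'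
          exact ⟨σ, hσ, h'⟩
      · left; right; exact Or.inl ⟨hx, hxB⟩
    have h1 := measureReal_mono hsub (measure_ne_top β _)
    have h2 := measureReal_union_le (μ := β) ((B \ ⋃ σ ∈ T, bernoulliShift σ ⁻¹' B) ∪ symmDiff A B)
      (⋃ σ ∈ T, bernoulliShift σ ⁻¹' (symmDiff A B))
    have h3 := measureReal_union_le (μ := β) (B \ ⋃ σ ∈ T, bernoulliShift σ ⁻¹' B) (symmDiff A B)
    have h4 := measureReal_biUnion_finset_le (μ := β) T
      (fun σ => bernoulliShift σ ⁻¹' (symmDiff A B))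
    have h5 : ∑ σ ∈ T, β.real (bernoulliShift σ ⁻¹' (symmDiff A B)) =
        T.card * β.real (symmDiff A B) := by
      rw [Finset.sum_congr rfl (fun σ _ => by
        rw [Measure.real, bern_inv hβ σ (hA.symmDiff hBm)])]
      simp [Measure.real]
    rw [lt_div_iff₀ hT] at hAB'
    linarith
  · rw [← hDS]
    rintro x ⟨-, hx⟩ σ hσ ⟨h, -⟩
    exact hx (Set.mem_iUnion₂.mpr ⟨σ, hσ, h⟩)

end BFC

/-- If the free part of the shift is the union of `m` `β`-measurable
independent sets, then the Borel fractional chromatic number of the Schreier graph of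
the free part of the shift is at most `m`. -/
theorem borel_fractional_chromatic_le_measurable_chromatic
    {Γ : Type*} [Group Γ] [Countable Γ]
    (β : Measure (Γ → Bool)) [IsProbabilityMeasure β] (hβ : IsBernoulliMeasure β)
    (F : Finset Γ) (m : ℕ)
    (J : Fin m → Set (Γ → Bool))
    (hJmeas : ∀ j, NullMeasurableSet (J j) β)
    (hJfree : ∀ j, J j ⊆ freePart Γ)
    (hJind : ∀ j, IndepIn (schreierAdj F) (J j))
    (hJcov : (⋃ j, J j) = freePart Γ) :
    sInf { r : ℝ | ∃ (k ℓ : ℕ) (I : Fin ℓ → Set (Γ → Bool)),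
        1 ≤ k ∧ r = (ℓ : ℝ) / (k : ℝ) ∧
        (∀ i, MeasurableSet (I i) ∧ I i ⊆ freePart Γ ∧ IndepIn (schreierAdj F) (I i)) ∧
        (∀ x ∈ freePart Γ, k ≤ Nat.card {i : Fin ℓ // x ∈ I i}) } ≤ (m : ℝ) := by
  classical
  have hbdd : BddBelow { r : ℝ | ∃ (k ℓ : ℕ) (I : Fin ℓ → Set (Γ → Bool)),
        1 ≤ k ∧ r = (ℓ : ℝ) / (k : ℝ) ∧
        (∀ i, MeasurableSet (I i) ∧ I i ⊆ freePart Γ ∧ IndepIn (schreierAdj F) (I i)) ∧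
        (∀ x ∈ freePart Γ, k ≤ Nat.card {i : Fin ℓ // x ∈ I i}) } := by
    refine ⟨0, ?_⟩
    rintro r ⟨k, ℓ, I, -, rfl, -⟩
    positivity
  rcases finite_or_infinite Γ with hfin | hinf
  · refine csInf_le hbdd ⟨1, m, J, le_rfl, by simp, ?_, ?_⟩
    · exact fun i => ⟨(Set.toFinite _).measurableSet, hJfree i, hJind i⟩
    · intro x hx
      rw [← hJcov] at hx
      obtain ⟨i, hi⟩ := Set.mem_iUnion.mp hx
      have : Nonempty {i : Fin m // x ∈ J i} := ⟨⟨i, hi⟩⟩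
      exact Nat.card_pos
  · have hfull := BFC.free_full hβ
    have hne : (freePart Γ).Nonempty := by
      by_contra h
      rw [Set.not_nonempty_iff_eq_empty] at h
      simp [h] at hfull
    have hm : 0 < m := by
      obtain ⟨x, hx⟩ := hne
      rw [← hJcov] at hx
      obtain ⟨i, -⟩ := Set.mem_iUnion.mp hx
      exact i.pos
    have hmR : (0 : ℝ) < m := by exact_mod_cast hm
    obtain ⟨j, hj⟩ : ∃ j, 1 / (m : ℝ) ≤ β.real (J j) := by
      by_contra! hcon
      have h1 : β.real (⋃ j, J j) ≤ ∑ j, β.real (J j) := measureReal_iUnion_fintype_le _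
      have h2 : β.real (⋃ j, J j) = 1 := by rw [hJcov, Measure.real, hfull]; simp
      have h3 : ∑ j, β.real (J j) < ∑ j : Fin m, 1 / (m : ℝ) :=
        Finset.sum_lt_sum_of_nonempty ⟨⟨0, hm⟩, Finset.mem_univ _⟩ fun j _ => hcon j
      have h4 : ∑ j : Fin m, 1 / (m : ℝ) = 1 := by
        simp [hmR.ne']
      linarith
    obtain ⟨A, hAJ, hA, hAe⟩ := (hJmeas j).exists_measurable_subset_ae_eq
    have hAr : 1 / (m : ℝ) ≤ β.real A := by
      rw [Measure.real, measure_congr hAe]; exact hj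
    by_contra! hcon
    set q := sInf { r : ℝ | ∃ (k ℓ : ℕ) (I : Fin ℓ → Set (Γ → Bool)),
        1 ≤ k ∧ r = (ℓ : ℝ) / (k : ℝ) ∧
        (∀ i, MeasurableSet (I i) ∧ I i ⊆ freePart Γ ∧ IndepIn (schreierAdj F) (I i)) ∧
        (∀ x ∈ freePart Γ, k ≤ Nat.card {i : Fin ℓ // x ∈ I i}) } with hq
    have hqpos : 0 < q := hmR.trans hcon
    have hp : 1 / q < β.real A := (one_div_lt_one_div_of_lt hmR hcon).trans_le hAr
    obtain ⟨D, S, hDS, hi⟩ := BFC.approx hβ ((F ∪ F.image (·⁻¹)).erase 1) hA (by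
      intro x hx σ hσ hx'
      simp only [Finset.mem_erase, Finset.mem_union, Finset.mem_image] at hσ
      have hxf := hJfree j (hAJ hx)
      refine hJind j x (hAJ hx) _ (hAJ hx') ⟨hxf, BFC.free_sh hxf σ,
        (hxf σ hσ.1).symm, σ, ?_, rfl⟩
      rcases hσ.2 with h | ⟨a, ha, rfl⟩
      · exact Or.inl h
      · right; simpa using ha) (1 / q) hp
    have hreal : β.real (cylinder (α := fun _ => Bool) D S) = Nat.card S / 2 ^ D.card := by
      rw [Measure.real, BFC.cyl_measure hβ]
      simp [div_eq_mul_inv]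
    rw [hreal] at hDS
    have hSne : S.Nonempty := by
      by_contra h
      rw [Set.not_nonempty_iff_eq_empty] at h
      subst h
      have : 0 < 1 / q := by positivity
      simp at hDS
      linarith
    obtain ⟨k, ℓ, I, hk, hkl, hI, hcov⟩ := BFC.main_step F hne D S hSne (by
      intro x hx σ hσ h1
      refine hi x hx σ ?_
      simp only [Finset.mem_erase, Finset.mem_union, Finset.mem_image]
      refine ⟨h1, hσ.imp id fun h => ⟨σ⁻¹, h, by simp⟩⟩)
    have hle : q ≤ (ℓ : ℝ) / k := csInf_le hbdd ⟨k, ℓ, I, hk, rfl, hI, hcov⟩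
    have hkR : (0 : ℝ) < k := by exact_mod_cast hk
    have hklR : (k : ℝ) * 2 ^ D.card = Nat.card S * ℓ := by exact_mod_cast hkl
    have h2 : (0 : ℝ) < 2 ^ D.card := by positivity
    rw [le_div_iff₀ hkR] at hle
    rw [div_lt_div_iff₀ hqpos h2] at hDS
    have hl : (0 : ℝ) < ℓ := by nlinarith [mul_pos hqpos hkR]
    nlinarith [mul_lt_mul_of_pos_left hDS hkR, mul_le_mul_of_nonneg_left hle (Nat.cast_nonneg (α := ℝ) (Nat.card S)), mul_pos hkR h2]
end

section
/- For n ≥ 1 let G_n denote the Schreier graph of the free part of the Bernoulli shift of the free group F_n with respect to its standard generating set {σ_1, …, σ_n}, and let χ*_B(G_n) := inf{ ℓ/k : k ≥ 1 and there exist Borel G_n-independent sets I_1, …, I_ℓ such that every point of Free(2^{F_n}) belongs to at least k of them }. Then lim_{n→∞} χ*_B(G_n) · (log n) / n = 2, where log denotes the natural logarithm. In particular, χ*_B(G_n) = (2 + o(1))·n/log n. -/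
open MeasureTheory

/-- Adjacency in the Schreier graph `G_n` of the free part of the Bernoulli shift of the
free group `F_n` w.r.t. its standard generating set. -/
def freeGroupSchreierAdj (n : ℕ) (x y : FreeGroup (Fin n) → Bool) : Prop :=
  x ∈ freePart (FreeGroup (Fin n)) ∧ y ∈ freePart (FreeGroup (Fin n)) ∧ x ≠ y ∧
    ∃ i : Fin n, y = bernoulliShift (FreeGroup.of i) x ∨
      y = bernoulliShift (FreeGroup.of i)⁻¹ x

section
namespace BFC

section Entropy
variable {Ω : Type*} [MeasurableSpace Ω] (P : Measure Ω)

/-- law weights -/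
noncomputable def lw {A : Type*} (X : Ω → A) (a : A) : ℝ := P.real (X ⁻¹' {a})

noncomputable def Hn {A : Type*} [Fintype A] (X : Ω → A) : ℝ :=
  ∑ a, Real.negMulLog (lw P X a)

/-- measurability of a discrete variable -/
def Dm {A : Type*} (X : Ω → A) : Prop := ∀ a, MeasurableSet (X ⁻¹' {a})

lemma lw_nonneg {A : Type*} (X : Ω → A) (a : A) : 0 ≤ lw P X a := measureReal_nonneg

variable {P}

lemma Dm.prodMk {A B : Type*} {X : Ω → A} {Y : Ω → B} (hX : Dm X) (hY : Dm Y) :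
    Dm (fun ω => (X ω, Y ω)) := by
  rintro ⟨a, b⟩
  have : (fun ω => (X ω, Y ω)) ⁻¹' {(a, b)} = X ⁻¹' {a} ∩ Y ⁻¹' {b} := by
    ext; simp
  rw [this]; exact (hX a).inter (hY b)

lemma lw_comp {A B : Type*} [Fintype A] [DecidableEq B] [IsProbabilityMeasure P] {X : Ω → A}
    (hX : Dm X) (g : A → B) (b : B) :
    lw P (g ∘ X) b = ∑ a with g a = b, lw P X a := by
  unfold lw
  have : (g ∘ X) ⁻¹' {b} = ⋃ a ∈ (Finset.univ.filter fun a => g a = b), X ⁻¹' {a} := by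
    ext ω; simp
  rw [this, measureReal_biUnion_finset]
  · intro a _ a' _ h
    exact Disjoint.preimage _ (by simpa using h)
  · intro a _; exact hX a

lemma lw_sum {A : Type*} [Fintype A] [IsProbabilityMeasure P] {X : Ω → A} (hX : Dm X) :
    ∑ a, lw P X a = 1 := by
  have := lw_comp (P := P) hX (fun _ => ()) ()
  have h2 : ((fun _ => ()) ∘ X) ⁻¹' {()} = (Set.univ : Set Ω) := by ext; simp
  rw [lw, h2] at this
  simpa using this.symm

lemma Dm.comp {A B : Type*} [Fintype A] {X : Ω → A} (hX : Dm X) (g : A → B) : Dm (g ∘ X) := by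
  classical
  intro b
  have : (g ∘ X) ⁻¹' {b} = ⋃ a ∈ (Finset.univ.filter fun a => g a = b), X ⁻¹' {a} := by
    ext ω; simp
  rw [this]
  exact Finset.measurableSet_biUnion _ (fun a _ => hX a)

/-- sum along a map -/
lemma Hn_comp {A B : Type*} [Fintype A] [Fintype B] [IsProbabilityMeasure P] {X : Ω → A}
    (hX : Dm X) (g : A → B) :
    Hn P (g ∘ X) = - ∑ a, lw P X a * Real.log (lw P (g ∘ X) (g a)) := by
  classical
  unfold Hn
  rw [← Finset.sum_neg_distrib, ← Finset.sum_fiberwise (s := Finset.univ) (g := g)]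
  refine Finset.sum_congr rfl fun b _ => ?_
  rw [Real.negMulLog]
  nth_rewrite 1 [lw_comp hX]
  rw [neg_mul, Finset.sum_mul, ← Finset.sum_neg_distrib]
  refine Finset.sum_congr rfl fun a ha => ?_
  simp only [Finset.mem_filter] at ha
  rw [ha.2]

lemma lw_le_comp {A B : Type*} [Fintype A] [IsProbabilityMeasure P] {X : Ω → A}
    (g : A → B) (a : A) : lw P X a ≤ lw P (g ∘ X) (g a) := by
  unfold lw
  apply measureReal_mono
  · intro ω h; simp at h ⊢; rw [h]
  · exact measure_ne_top _ _

lemma Hn_comp_le {A B : Type*} [Fintype A] [Fintype B] [IsProbabilityMeasure P] {X : Ω → A}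
    (hX : Dm X) (g : A → B) : Hn P (g ∘ X) ≤ Hn P X := by
  rw [Hn_comp hX g, Hn, ← Finset.sum_neg_distrib]
  refine Finset.sum_le_sum fun a _ => ?_
  rw [Real.negMulLog, neg_mul, neg_le_neg_iff]
  rcases (lw_nonneg P X a).eq_or_lt with h | h
  · rw [← h]; simp
  · exact mul_le_mul_of_nonneg_left (Real.log_le_log h (lw_le_comp g a)) h.le

lemma Hn_le_of_factor {A B : Type*} [Fintype A] [Fintype B] [IsProbabilityMeasure P] {X : Ω → A}
    {Y : Ω → B} (hX : Dm X) (g : A → B) (h : ∀ ω, Y ω = g (X ω)) : Hn P Y ≤ Hn P X := by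
  have : Y = g ∘ X := funext h
  rw [this]; exact Hn_comp_le hX g

lemma Hn_submod {A B C : Type*} [Fintype A] [Fintype B] [Fintype C] [IsProbabilityMeasure P]
    {X : Ω → A} {Y : Ω → B} {Z : Ω → C} (hX : Dm X) (hY : Dm Y) (hZ : Dm Z) :
    Hn P (fun ω => (X ω, Y ω, Z ω)) + Hn P Z ≤
      Hn P (fun ω => (X ω, Z ω)) + Hn P (fun ω => (Y ω, Z ω)) := by
  classical
  set T : Ω → A × B × C := fun ω => (X ω, Y ω, Z ω) with hT
  have hTm : Dm T := hX.prodMk (hY.prodMk hZ)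
  set p := lw P T
  set pz := lw P Z
  set px := lw P (fun ω => (X ω, Z ω))
  set py := lw P (fun ω => (Y ω, Z ω))
  have e0 : Hn P T = - ∑ t, p t * Real.log (p t) := by
    simp [Hn, Real.negMulLog, p]
  have e1 : Hn P Z = - ∑ t, p t * Real.log (pz t.2.2) :=
    Hn_comp hTm (fun t => t.2.2)
  have e2 : Hn P (fun ω => (X ω, Z ω)) = - ∑ t, p t * Real.log (px (t.1, t.2.2)) :=
    Hn_comp hTm (fun t => (t.1, t.2.2))
  have e3 : Hn P (fun ω => (Y ω, Z ω)) = - ∑ t, p t * Real.log (py (t.2.1, t.2.2)) :=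
    Hn_comp hTm (fun t => (t.2.1, t.2.2))
  rw [e0, e1, e2, e3]
  have key : ∀ t : A × B × C, p t - px (t.1, t.2.2) * py (t.2.1, t.2.2) / pz t.2.2 ≤
      p t * Real.log (p t) + p t * Real.log (pz t.2.2) - p t * Real.log (px (t.1, t.2.2))
        - p t * Real.log (py (t.2.1, t.2.2)) := by
    intro t
    rcases (lw_nonneg P T t).eq_or_lt with h | h
    · change 0 = p t at h
      rw [← h]
      have : 0 ≤ px (t.1, t.2.2) * py (t.2.1, t.2.2) / pz t.2.2 :=
        div_nonneg (mul_nonneg (lw_nonneg _ _ _) (lw_nonneg _ _ _)) (lw_nonneg _ _ _)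
      simpa using this
    · have h1 : 0 < px (t.1, t.2.2) := h.trans_le (lw_le_comp (P := P) (X := T) (fun t => (t.1, t.2.2)) t)
      have h2 : 0 < py (t.2.1, t.2.2) := h.trans_le (lw_le_comp (P := P) (X := T) (fun t => (t.2.1, t.2.2)) t)
      have h3 : 0 < pz t.2.2 := h.trans_le (lw_le_comp (P := P) (X := T) (fun t => t.2.2) t)
      change 0 < p t at h
      have hq : 0 < px (t.1, t.2.2) * py (t.2.1, t.2.2) / (pz t.2.2 * p t) := by positivity
      have := Real.log_le_sub_one_of_pos hq
      rw [Real.log_div (by positivity) (by positivity), Real.log_mul h1.ne' h2.ne',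
        Real.log_mul h3.ne' h.ne'] at this
      have h4 := mul_le_mul_of_nonneg_left this h.le
      have h5 : p t * (px (t.1, t.2.2) * py (t.2.1, t.2.2) / (pz t.2.2 * p t) - 1) =
        px (t.1, t.2.2) * py (t.2.1, t.2.2) / pz t.2.2 - p t := by
        field_simp
      rw [h5] at h4
      linarith
  have s := Finset.sum_le_sum (fun t (_ : t ∈ Finset.univ) => key t)
  simp only [Finset.sum_sub_distrib, Finset.sum_add_distrib] at s
  have s1 : ∑ t, p t = 1 := lw_sum hTm
  have s2 : ∑ t : A × B × C, px (t.1, t.2.2) * py (t.2.1, t.2.2) / pz t.2.2 ≤ 1 := by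
    have mx : ∀ c, ∑ a, px (a, c) = pz c := by
      intro c
      have := lw_comp (P := P) (hX.prodMk hZ) (fun t => t.2) c
      change pz c = _ at this
      rw [this, Finset.sum_filter, Fintype.sum_prod_type]
      refine Finset.sum_congr rfl fun a _ => ?_
      simp [px]
    have my : ∀ c, ∑ a, py (a, c) = pz c := by
      intro c
      have := lw_comp (P := P) (hY.prodMk hZ) (fun t => t.2) c
      change pz c = _ at this
      rw [this, Finset.sum_filter, Fintype.sum_prod_type]
      refine Finset.sum_congr rfl fun a _ => ?_
      simp [py]
    calc ∑ t : A × B × C, px (t.1, t.2.2) * py (t.2.1, t.2.2) / pz t.2.2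
        = ∑ c, (∑ a, px (a, c)) * (∑ b, py (b, c)) / pz c := by
          rw [Fintype.sum_prod_type]
          simp only [Fintype.sum_prod_type]
          simp only [Finset.sum_mul_sum, Finset.sum_div]
          conv_rhs => rw [Finset.sum_comm]
          refine Finset.sum_congr rfl fun _ _ => ?_
          rw [Finset.sum_comm]
      _ ≤ ∑ c, pz c := by
          refine Finset.sum_le_sum fun c _ => ?_
          rw [mx, my]
          rcases (lw_nonneg P Z c).eq_or_lt with h | h
          · change 0 = pz c at h; rw [← h]; simp
          · change 0 < pz c at h; rw [mul_div_assoc, div_self h.ne', mul_one]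
      _ = 1 := lw_sum hZ
  linarith

end Entropy
end BFC
end

section
namespace BFC

section FreeG
variable {n : ℕ}

abbrev FG (n : ℕ) := FreeGroup (Fin n)

/-- element of a letter -/
def el (t : Fin n × Bool) : FG n := FreeGroup.mk [t]
/-- inverse letter -/
def iv (t : Fin n × Bool) : Fin n × Bool := (t.1, !t.2)

@[simp] lemma iv_iv (t : Fin n × Bool) : iv (iv t) = t := by simp [iv]

lemma el_iv (t : Fin n × Bool) : el (iv t) = (el t)⁻¹ := by
  simp [el, iv, FreeGroup.inv_mk, FreeGroup.invRev]

lemma el_true (i : Fin n) : el (i, true) = FreeGroup.of i := rfl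
lemma el_false (i : Fin n) : el (i, false) = (FreeGroup.of i)⁻¹ := by
  rw [← el_true, ← el_iv]; rfl

/-- first letter of the inverse = inverse of the last letter -/
def rl (g : FG n) : Option (Fin n × Bool) := (g⁻¹).toWord.head?

@[simp] lemma rl_one : rl (1 : FG n) = none := by simp [rl]

lemma hd_el_mul (s : Fin n × Bool) (g : FG n) (h : g.toWord.head? ≠ some (iv s)) :
    (el s * g).toWord.head? = some s := by
  have h1 : (el s * g).toWord = FreeGroup.reduce (s :: g.toWord) := by
    rw [FreeGroup.toWord_mul, el, FreeGroup.toWord_mk, FreeGroup.reduce_singleton]; rfl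
  rw [h1, FreeGroup.reduce.cons, FreeGroup.reduce_toWord]
  rcases hw : g.toWord with _ | ⟨a, l⟩
  · simp
  · rw [hw] at h
    simp only [List.head?_cons, ne_eq, Option.some.injEq] at h
    have : ¬ (s.1 = a.1 ∧ s.2 = !a.2) := by
      rintro ⟨h2, h3⟩
      apply h
      ext <;> simp [iv, h2, h3]
    simp [this]

lemma rl_mul (t : Fin n × Bool) (g : FG n) (h : rl g ≠ some t) : rl (g * el t) = some (iv t) := by
  unfold rl at *
  rw [mul_inv_rev, ← el_iv]
  apply hd_el_mul
  simpa using h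

lemma forest (W : Finset (FG n)) (h1 : (1 : FG n) ∈ W) :
    (∑ i : Fin n, (W.filter fun w => w * FreeGroup.of i ∈ W).card) + 1 ≤ W.card := by
  classical
  rw [← Finset.card_sigma]
  have : (Finset.univ.sigma fun i : Fin n => W.filter fun w => w * FreeGroup.of i ∈ W).card ≤
      (W.erase 1).card := by
    apply Finset.card_le_card_of_injOn
      (fun x => if rl x.2 = some (x.1, true) then x.2 else x.2 * FreeGroup.of x.1)
    · rintro ⟨i, w⟩ hx
      simp only [Finset.coe_sigma, Finset.coe_univ, Finset.coe_filter, Set.mem_sigma_iff,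
        Set.mem_univ, Set.mem_ofPred_eq, true_and] at hx
      simp only [Finset.coe_erase, Set.mem_sdiff, Finset.mem_coe, Set.mem_singleton_iff]
      split_ifs with h
      · refine ⟨hx.1, ?_⟩
        rintro rfl
        simp at h
      · refine ⟨hx.2, fun h2 => ?_⟩
        have := rl_mul (i, true) w h
        rw [el_true, h2] at this
        simp at this
    · rintro ⟨i, w⟩ _ ⟨j, v⟩ _ hxy
      have key : ∀ (i : Fin n) (w : FG n), 
        (rl w = some (i, true) ∧ rl (if rl w = some (i, true) then w else w * FreeGroup.of i) = some (i, true)) ∨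
        (rl w ≠ some (i, true) ∧ rl (if rl w = some (i, true) then w else w * FreeGroup.of i) = some (i, false)) := by
        intro i w
        by_cases h : rl w = some (i, true)
        · left; simp [h]
        · right; refine ⟨h, ?_⟩
          rw [if_neg h]; exact rl_mul (i, true) w h
      simp only at hxy
      rcases key i w with ⟨h1, h2⟩ | ⟨h1, h2⟩ <;> rcases key j v with ⟨h3, h4⟩ | ⟨h3, h4⟩ <;>
        rw [hxy, h4] at h2 <;> simp at h2 <;> subst h2
      · rw [if_pos h1, if_pos h3] at hxy; subst hxy; rfl
      · rw [if_neg h1, if_neg h3] at hxy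
        have := mul_right_cancel hxy; subst this; rfl
  rw [Finset.card_erase_of_mem h1] at this
  have h2 := Finset.card_pos.mpr ⟨_, h1⟩
  omega

/-- right translate -/
def rt (W : Finset (FG n)) (τ : FG n) : Finset (FG n) := W.image (· * τ)

lemma mem_rt {W : Finset (FG n)} {τ g : FG n} : g ∈ rt W τ ↔ ∃ w ∈ W, w * τ = g := by
  unfold rt; exact Finset.mem_image

lemma card_rt (W : Finset (FG n)) (τ : FG n) : (rt W τ).card = W.card :=
  Finset.card_image_of_injective _ (mul_left_injective τ)

lemma rt_union (W V : Finset (FG n)) (τ : FG n) : rt (W ∪ V) τ = rt W τ ∪ rt V τ :=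
  Finset.image_union _ _

lemma rt_rt (W : Finset (FG n)) (τ τ' : FG n) : rt (rt W τ) τ' = rt W (τ * τ') := by
  ext g; simp [rt, mul_assoc]

lemma rt_one (W : Finset (FG n)) : rt W 1 = W := by
  ext g; simp [rt]

lemma rt_mono {W V : Finset (FG n)} (h : W ⊆ V) (τ : FG n) : rt W τ ⊆ rt V τ :=
  Finset.image_subset_image h

lemma rt_sing (τ : FG n) : rt {1} τ = {τ} := by simp [rt]

lemma card_union_rt (W : Finset (FG n)) (i : Fin n) :
    (W ∪ rt W (FreeGroup.of i)).card + (W.filter fun w => w * FreeGroup.of i ∈ W).card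
      = 2 * W.card := by
  have h := Finset.card_union_add_card_inter W (rt W (FreeGroup.of i))
  rw [card_rt] at h
  have h2 : W ∩ rt W (FreeGroup.of i) =
     (W.filter fun w => w * FreeGroup.of i ∈ W).image (· * FreeGroup.of i) := by
    ext g
    simp only [Finset.mem_inter, mem_rt, Finset.mem_image, Finset.mem_filter]
    constructor
    · rintro ⟨h1, w, hw, rfl⟩; exact ⟨w, ⟨hw, h1⟩, rfl⟩
    · rintro ⟨w, ⟨hw, h1⟩, rfl⟩; exact ⟨h1, w, hw, rfl⟩
  rw [h2, Finset.card_image_of_injective _ (mul_left_injective _)] at h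
  omega

structure Poly (h : Finset (FG n) → Finset (FG n) → ℝ) : Prop where
  mono : ∀ {V V' U U'}, V ⊆ V' → U ⊆ U' → h V U ≤ h V' U'
  dim : ∀ {V V1 U U1} (V2 U2), V ⊆ V1 → U ⊆ U1 →
    h (V1 ∪ V2) (U1 ∪ U2) + h V U ≤ h V1 U1 + h (V ∪ V2) (U ∪ U2)
  shift : ∀ V U τ, h (rt V τ) (rt U τ) = h V U

noncomputable def Phi (h : Finset (FG n) → Finset (FG n) → ℝ) (W : Finset (FG n)) : ℝ :=
  ∑ i : Fin n, h (W ∪ rt W (FreeGroup.of i)) {1, FreeGroup.of i} - (2 * n - 1) * h W {1}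

variable {h : Finset (FG n) → Finset (FG n) → ℝ}

lemma Phi_step (hp : Poly h) (W : Finset (FG n)) (i0 : Fin n) (τ : FG n)
    (hτ : τ = FreeGroup.of i0 ∨ τ = (FreeGroup.of i0)⁻¹) :
    Phi h (W ∪ rt W τ) ≤ Phi h W := by
  set W' := W ∪ rt W τ with hW'
  set Δ := h W' {1} - h W {1} with hΔ
  have hWW' : W ⊆ W' := Finset.subset_union_left
  have add1 : ∀ C U, W ⊆ C → {1} ⊆ U → h (C ∪ W') U ≤ h C U + Δ := by
    intro C U hC hU
    have := hp.dim W' ∅ hC hU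
    rw [Finset.union_empty, Finset.union_empty, Finset.union_eq_right.mpr hWW'] at this
    linarith
  have add2 : ∀ σ C U, rt W σ ⊆ C → {σ} ⊆ U → h (C ∪ rt W' σ) U ≤ h C U + Δ := by
    intro σ C U hC hU
    have := hp.dim (rt W' σ) ∅ hC hU
    rw [Finset.union_empty, Finset.union_empty,
      Finset.union_eq_right.mpr (rt_mono hWW' σ)] at this
    have e1 := hp.shift W' {1} σ
    have e2 := hp.shift W {1} σ
    rw [rt_sing] at e1 e2
    rw [e1, e2] at this
    linarith
  have hgen : ∀ i, h (W' ∪ rt W' (FreeGroup.of i)) {1, FreeGroup.of i} ≤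
      h (W ∪ rt W (FreeGroup.of i)) {1, FreeGroup.of i} + 2 * Δ := by
    intro i
    set σ := FreeGroup.of i
    have e : W' ∪ rt W' σ = ((W ∪ rt W σ) ∪ W') ∪ rt W' σ := by
      have := rt_mono hWW' σ
      ext g; simp only [Finset.mem_union]
      have a := @hWW' g; have b := @this g
      tauto
    rw [e]
    have a1 := add2 σ ((W ∪ rt W σ) ∪ W') {1, σ}
      (Finset.subset_union_right.trans Finset.subset_union_left) (by simp)
    have a2 := add1 (W ∪ rt W σ) {1, σ} Finset.subset_union_left (by simp)
    linarith
  have hspec : h (W' ∪ rt W' (FreeGroup.of i0)) {1, FreeGroup.of i0} ≤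
      h (W ∪ rt W (FreeGroup.of i0)) {1, FreeGroup.of i0} + Δ := by
    set σ := FreeGroup.of i0
    rcases hτ with hτ | hτ
    · have e : W' ∪ rt W' σ = (W ∪ rt W σ) ∪ rt W' σ := by rw [hW', hτ]
      rw [e]
      exact add2 σ _ _ Finset.subset_union_right (by simp)
    · have e : W' ∪ rt W' σ = (W ∪ rt W σ) ∪ W' := by
        have : rt W' σ = rt W σ ∪ W := by
          rw [hW', rt_union, rt_rt, hτ, inv_mul_cancel, rt_one]
        rw [this]
        ext g; simp only [Finset.mem_union]
        have a := @hWW' g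
        tauto
      rw [e]
      exact add1 _ _ Finset.subset_union_left (by simp)
  unfold Phi
  have hsum : ∑ i : Fin n, h (W' ∪ rt W' (FreeGroup.of i)) {1, FreeGroup.of i} ≤
      ∑ i : Fin n, h (W ∪ rt W (FreeGroup.of i)) {1, FreeGroup.of i} + (2 * n - 1) * Δ := by
    have : ∀ i ∈ (Finset.univ : Finset (Fin n)), h (W' ∪ rt W' (FreeGroup.of i)) {1, FreeGroup.of i} ≤
       h (W ∪ rt W (FreeGroup.of i)) {1, FreeGroup.of i} + (2 * Δ - if i = i0 then Δ else 0) := by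
      intro i _
      split_ifs with hi
      · subst hi; linarith
      · have := hgen i; linarith
    have := Finset.sum_le_sum this
    rw [Finset.sum_add_distrib, Finset.sum_sub_distrib, Finset.sum_ite_eq' ] at this
    simp at this
    linarith
  have : h W' {1} = h W {1} + Δ := by rw [hΔ]; ring
  rw [this]
  linarith

lemma Phi_reach (hp : Poly h) (g : FG n) : ∀ (W : Finset (FG n)) (w : FG n), w ∈ W →
    ∃ W', W ⊆ W' ∧ w * g ∈ W' ∧ Phi h W' ≤ Phi h W := by
  induction g using FreeGroup.induction_on with
  | C1 => intro W w hw; exact ⟨W, subset_rfl, by simpa using hw, le_rfl⟩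
  | of i =>
    intro W w hw
    exact ⟨W ∪ rt W (FreeGroup.of i), Finset.subset_union_left,
      Finset.mem_union_right _ (mem_rt.mpr ⟨w, hw, rfl⟩), Phi_step hp W i _ (Or.inl rfl)⟩
  | inv_of i _ =>
    intro W w hw
    exact ⟨W ∪ rt W (FreeGroup.of i)⁻¹, Finset.subset_union_left,
      Finset.mem_union_right _ (mem_rt.mpr ⟨w, hw, rfl⟩), Phi_step hp W i _ (Or.inr rfl)⟩
  | mul x y hx hy =>
    intro W w hw
    obtain ⟨W1, a1, b1, c1⟩ := hx W w hw
    obtain ⟨W2, a2, b2, c2⟩ := hy W1 _ b1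
    exact ⟨W2, a1.trans a2, by rwa [mul_assoc] at b2, c2.trans c1⟩

lemma Phi_reach_set (hp : Poly h) (D : Finset (FG n)) :
    ∃ W', (1 : FG n) ∈ W' ∧ D ⊆ W' ∧ Phi h W' ≤ Phi h {1} := by
  induction D using Finset.induction_on with
  | empty => exact ⟨{1}, by simp, by simp, le_rfl⟩
  | insert a s _ ih =>
    obtain ⟨W, h1, h2, h3⟩ := ih
    obtain ⟨W', a1, b1, c1⟩ := Phi_reach hp a W 1 h1
    refine ⟨W', a1 h1, ?_, c1.trans h3⟩
    rw [one_mul] at b1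
    exact Finset.insert_subset b1 (h2.trans a1)

theorem edge_vertex (hp : Poly h) (η : ℝ) (hη : ∀ V, h V ∅ = V.card * η) (D : Finset (FG n))
    (hD : ∀ V, D ⊆ V → h V {1} ≤ h V ∅) :
    (2 * n - 1) * h ∅ {1} ≤ ∑ i : Fin n, h ∅ {1, FreeGroup.of i} := by
  have h0 : h ∅ ∅ = 0 := by rw [hη]; simp
  have hη0 : 0 ≤ η := by
    have := hp.mono (Finset.empty_subset {1}) (subset_refl ∅)
    rw [h0, hη] at this; simpa using this
  obtain ⟨W, h1, h2, h3⟩ := Phi_reach_set hp D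
  rcases Nat.eq_zero_or_pos n with hn | hn
  · subst hn
    have := hp.mono (subset_refl ∅) (Finset.empty_subset {1})
    simp; linarith
  have low : η ≤ Phi h W := by
    unfold Phi
    have a1 : ∑ i : Fin n, ((W ∪ rt W (FreeGroup.of i)).card : ℝ) * η ≤
        ∑ i : Fin n, h (W ∪ rt W (FreeGroup.of i)) {1, FreeGroup.of i} := by
      refine Finset.sum_le_sum fun i _ => ?_
      rw [← hη]
      exact hp.mono subset_rfl (Finset.empty_subset _)
    have a2 : h W {1} ≤ W.card * η := by rw [← hη]; exact hD W h2
    have a3 : ((2 * n - 1) * W.card + 1 : ℝ) ≤ ∑ i : Fin n, ((W ∪ rt W (FreeGroup.of i)).card : ℝ) := by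
      have e : (∑ i : Fin n, (W ∪ rt W (FreeGroup.of i)).card) +
        (∑ i : Fin n, (W.filter fun w => w * FreeGroup.of i ∈ W).card) = n * (2 * W.card) := by
        rw [← Finset.sum_add_distrib, Finset.sum_congr rfl (fun i _ => card_union_rt W i)]
        simp
      have f := forest W h1
      have e' : (∑ i : Fin n, ((W ∪ rt W (FreeGroup.of i)).card : ℝ)) +
        (∑ i : Fin n, ((W.filter fun w => w * FreeGroup.of i ∈ W).card : ℝ)) = n * (2 * W.card) := by
        exact_mod_cast e
      have f' : (∑ i : Fin n, ((W.filter fun w => w * FreeGroup.of i ∈ W).card : ℝ)) + 1 ≤ W.card := by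
        exact_mod_cast f
      linarith
    rw [← Finset.sum_mul] at a1
    have a4 := mul_le_mul_of_nonneg_right a3 hη0
    have hn' : (1 : ℝ) ≤ n := by exact_mod_cast hn
    have a5 := mul_le_mul_of_nonneg_left a2 (by linarith : (0:ℝ) ≤ 2 * n - 1)
    nlinarith
  have up : Phi h {1} ≤ ∑ i : Fin n, h ∅ {1, FreeGroup.of i} - (2 * n - 1) * h ∅ {1} + η := by
    set E := h {1} {1} - h ∅ {1} with hE
    have hEη : E ≤ η := by
      have := hp.dim {1} ∅ (subset_refl ∅) (Finset.empty_subset {1})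
      simp only [Finset.empty_union, Finset.union_empty] at this
      rw [h0, hη {1}] at this
      simp at this; linarith
    have : ∀ i ∈ (Finset.univ : Finset (Fin n)), h ({1} ∪ rt {1} (FreeGroup.of i)) {1, FreeGroup.of i} ≤
        h ∅ {1, FreeGroup.of i} + 2 * E := by
      intro i _
      set σ := FreeGroup.of i
      have b1 := hp.dim (V1 := ∅) (U1 := {1, σ}) (U := {1}) {1} ∅ (subset_refl ∅) (by simp)
      have b2 := hp.dim (V1 := {1}) (U1 := {1, σ}) (U := {σ}) {σ} ∅ (Finset.empty_subset _) (by simp)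
      simp only [Finset.empty_union, Finset.union_empty] at b1 b2
      have e1 := hp.shift {1} {1} σ
      have e2 := hp.shift ∅ {1} σ
      have e3 : rt (∅ : Finset (FG n)) σ = ∅ := by simp [rt]
      rw [rt_sing] at e1 e2
      rw [e3] at e2
      rw [rt_sing]
      linarith
    have := Finset.sum_le_sum this
    rw [Finset.sum_add_distrib] at this
    simp at this
    unfold Phi
    have e : h {1} {1} = h ∅ {1} + E := by rw [hE]; ring
    rw [e]
    simp only [Finset.singleton_union] at this ⊢
    nlinarith
  linarith

end FreeG
end BFC
end

section
namespace BFC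

lemma Hn_le_of_det {Ω : Type*} [MeasurableSpace Ω] {P : Measure Ω} [IsProbabilityMeasure P]
    {A B : Type*} [Fintype A] [Fintype B] {X : Ω → A} {Y : Ω → B} (hX : Dm X)
    (h : ∀ ω ω', X ω = X ω' → Y ω = Y ω') : Hn P Y ≤ Hn P X := by
  classical
  have : Nonempty Ω := P.nonempty_of_neZero
  have hB : Nonempty B := this.map Y
  refine Hn_le_of_factor hX
    (fun a => if ha : ∃ ω, X ω = a then Y ha.choose else Classical.arbitrary B) (fun ω => ?_)
  have hex : ∃ ω', X ω' = X ω := ⟨ω, rfl⟩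
  rw [dif_pos hex]
  exact (h _ _ hex.choose_spec).symm

/-- shift -/
def sh {n : ℕ} {L : Type*} (τ : FG n) (x : FG n → L) : FG n → L := fun δ => x (δ * τ)

section shift
variable {n : ℕ} {L : Type*}

lemma sh_sh_s4 (u τ : FG n) (x : FG n → L) : sh u (sh τ x) = sh (u * τ) x := by
  funext δ; simp [sh, mul_assoc]

lemma sh_one_s4 (x : FG n → L) : sh 1 x = x := by funext δ; simp [sh]

/-- depends only on coordinates in D -/
def Dep {B : Type*} (D : Set (FG n)) (f : (FG n → L) → B) : Prop :=
  ∀ x y, (∀ d ∈ D, x d = y d) → f x = f y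

variable [MeasurableSpace L]

@[fun_prop] lemma measurable_sh (τ : FG n) : Measurable (sh τ : (FG n → L) → _) := by
  unfold sh; fun_prop

lemma Dep.measurable [Fintype L] [MeasurableSingletonClass L] {B : Type*} {D : Finset (FG n)}
    {f : (FG n → L) → B} (hf : Dep (D : Set (FG n)) f) (S : Set B) : MeasurableSet (f ⁻¹' S) := by
  classical
  rcases isEmpty_or_nonempty (FG n → L) with he | ⟨⟨x0⟩⟩
  · have : f ⁻¹' S = ∅ := Set.eq_empty_of_isEmpty _
    rw [this]; exact MeasurableSet.empty
  let ext : (D → L) → (FG n → L) := fun c g => if hg : g ∈ D then c ⟨g, hg⟩ else x0 g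
  have : f ⁻¹' S = (fun x (d : D) => x d.1) ⁻¹' {c | f (ext c) ∈ S} := by
    ext x
    simp only [Set.mem_preimage, Set.mem_ofPred_eq]
    rw [hf x (ext fun d => x d.1)]
    intro d hd
    simp [ext, Finset.mem_coe.mp hd]
  rw [this]
  have hm : Measurable (fun (x : FG n → L) (d : D) => x d.1) := by fun_prop
  exact hm (Set.toFinite _).measurableSet

lemma Dep.dm [Fintype L] [MeasurableSingletonClass L] {B : Type*} {D : Finset (FG n)}
    {f : (FG n → L) → B} (hf : Dep (D : Set (FG n)) f) : Dm f := fun _ => hf.measurable _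

noncomputable abbrev PM (n : ℕ) (μ : Measure L) : Measure (FG n → L) :=
  Measure.infinitePi (fun _ : FG n => μ)

lemma sh_mp (μ : Measure L) [IsProbabilityMeasure μ] (τ : FG n) :
    MeasurePreserving (sh τ) (PM n μ) (PM n μ) := by
  refine ⟨measurable_sh τ, ?_⟩
  have := Measure.infinitePi_map_piCongrLeft (μ := fun _ : FG n => μ) (Equiv.mulRight τ⁻¹)
  have h2 : (⇑(MeasurableEquiv.piCongrLeft (fun _ : FG n => L) (Equiv.mulRight τ⁻¹))) = sh τ := by
    funext x δ
    have := MeasurableEquiv.piCongrLeft_apply_apply (Equiv.mulRight τ⁻¹) (β := fun _ : FG n => L)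
      x (δ * τ)
    simpa [sh] using this
  rw [h2] at this
  exact this

lemma cyl (μ : Measure L) [IsProbabilityMeasure μ] [MeasurableSingletonClass L]
    (V : Finset (FG n)) (c : FG n → L) :
    (PM n μ).real {x | ∀ v ∈ V, x v = c v} = ∏ v ∈ V, μ.real {c v} := by
  have : {x : FG n → L | ∀ v ∈ V, x v = c v} = Set.pi V (fun v => {c v}) := by
    ext x; simp [Set.mem_pi]
  rw [this, measureReal_def, Measure.infinitePi_pi _ (fun i _ => measurableSet_singleton _),
    ENNReal.toReal_prod]
  rfl

lemma entropy_prod {ι : Type*} [Fintype ι] [DecidableEq ι] {A : Type*} [Fintype A] (m : A → ℝ)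
    (hm : ∑ a, m a = 1) :
    ∑ c : ι → A, Real.negMulLog (∏ i, m (c i)) =
      Fintype.card ι * ∑ a, Real.negMulLog (m a) := by
  classical
  have e : ∀ c : ι → A, Real.negMulLog (∏ i, m (c i)) =
      ∑ i, ∏ j, (if j = i then Real.negMulLog (m (c j)) else m (c j)) := by
    intro c
    by_cases h : ∀ i, m (c i) ≠ 0
    · rw [Real.negMulLog, Real.log_prod (fun i _ => h i), Finset.mul_sum]
      refine Finset.sum_congr rfl fun i _ => ?_
      rw [← Finset.mul_prod_erase _ _ (Finset.mem_univ i),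
        ← Finset.mul_prod_erase _ (fun j => if j = i then _ else _) (Finset.mem_univ i)]
      have hprod : ∏ j ∈ Finset.univ.erase i,
          (if j = i then Real.negMulLog (m (c j)) else m (c j)) =
          ∏ j ∈ Finset.univ.erase i, m (c j) :=
        Finset.prod_congr rfl (fun j hj => if_neg (Finset.ne_of_mem_erase hj))
      rw [if_pos rfl, hprod, Real.negMulLog]
      ring
    · push Not at h
      obtain ⟨i0, h0⟩ := h
      rw [Finset.prod_eq_zero (Finset.mem_univ i0) h0, Real.negMulLog_zero]
      symm
      apply Finset.sum_eq_zero
      intro i _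
      apply Finset.prod_eq_zero (Finset.mem_univ i0)
      split_ifs <;> simp [h0]
  rw [Finset.sum_congr rfl (fun c _ => e c), Finset.sum_comm]
  have e2 : ∀ i : ι, ∑ c : ι → A, ∏ j, (if j = i then Real.negMulLog (m (c j)) else m (c j)) =
      ∑ a, Real.negMulLog (m a) := by
    intro i
    have := Finset.prod_univ_sum (fun _ : ι => (Finset.univ : Finset A))
      (fun j a => if j = i then Real.negMulLog (m a) else m a)
    rw [Fintype.piFinset_univ] at this
    rw [← this, ← Finset.mul_prod_erase _ _ (Finset.mem_univ i)]
    simp only [if_true]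
    rw [Finset.prod_eq_one, mul_one]
    intro j hj
    simp [Finset.ne_of_mem_erase hj, hm]
  rw [Finset.sum_congr rfl (fun i _ => e2 i)]
  simp

variable [Fintype L] [MeasurableSingletonClass L] {B : Type*} [Fintype B]

/-- joint variable -/
def jv (ξ : (FG n → L) → B) (V U : Finset (FG n)) (ω : FG n → L) : (V → L) × (U → B) :=
  (fun v => ω v.1, fun u => ξ (sh u.1 ω))

lemma jv_det (ξ : (FG n → L) → B) (V U : Finset (FG n)) (ω ω' : FG n → L) :
    jv ξ V U ω = jv ξ V U ω' ↔ (∀ v ∈ V, ω v = ω' v) ∧ (∀ u ∈ U, ξ (sh u ω) = ξ (sh u ω')) := by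
  simp [jv, funext_iff]

lemma jv_dm {ξ : (FG n → L) → B} {D : Finset (FG n)} (hξ : Dep (D : Set (FG n)) ξ)
    (V U : Finset (FG n)) : Dm (jv ξ V U) := by
  classical
  apply Dep.dm (D := V ∪ U.biUnion (fun u => rt D u))
  intro x y hxy
  rw [jv_det]
  refine ⟨fun v hv => hxy v (by simp [hv]), fun u hu => hξ _ _ fun d hd => ?_⟩
  refine hxy _ ?_
  simp only [Finset.coe_union, Set.mem_union, Finset.mem_coe, Finset.mem_biUnion]
  exact Or.inr ⟨u, hu, mem_rt.mpr ⟨d, hd, rfl⟩⟩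

lemma jv_poly (μ : Measure L) [IsProbabilityMeasure μ] {ξ : (FG n → L) → B} {D : Finset (FG n)}
    (hξ : Dep (D : Set (FG n)) ξ) : Poly (fun V U => Hn (PM n μ) (jv ξ V U)) where
  mono := by
    intro V V' U U' hV hU
    apply Hn_le_of_det (jv_dm hξ _ _)
    intro ω ω'
    rw [jv_det, jv_det]
    exact fun ⟨h1, h2⟩ => ⟨fun v hv => h1 v (hV hv), fun u hu => h2 u (hU hu)⟩
  dim := by
    intro V V1 U U1 V2 U2 hV hU
    have := Hn_submod (P := PM n μ) (jv_dm hξ V1 U1) (jv_dm hξ (V ∪ V2) (U ∪ U2)) (jv_dm hξ V U)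
    have a1 : Hn (PM n μ) (jv ξ (V1 ∪ V2) (U1 ∪ U2)) ≤
      Hn (PM n μ) (fun ω => (jv ξ V1 U1 ω, jv ξ (V ∪ V2) (U ∪ U2) ω, jv ξ V U ω)) := by
      apply Hn_le_of_det ((jv_dm hξ _ _).prodMk ((jv_dm hξ _ _).prodMk (jv_dm hξ _ _)))
      intro ω ω'
      simp only [Prod.mk.injEq, jv_det, Finset.mem_union]
      rintro ⟨⟨h1, h2⟩, ⟨h3, h4⟩, _⟩
      refine ⟨fun v hv => ?_, fun u hu => ?_⟩
      · rcases hv with hv | hv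
        exacts [h1 v hv, h3 v (Or.inr hv)]
      · rcases hu with hv | hv
        exacts [h2 u hv, h4 u (Or.inr hv)]
    have a2 : Hn (PM n μ) (fun ω => (jv ξ V1 U1 ω, jv ξ V U ω)) ≤ Hn (PM n μ) (jv ξ V1 U1) := by
      apply Hn_le_of_det (jv_dm hξ _ _)
      intro ω ω'
      simp only [Prod.mk.injEq, jv_det]
      exact fun ⟨h1, h2⟩ => ⟨⟨h1, h2⟩, fun v hv => h1 v (hV hv), fun u hu => h2 u (hU hu)⟩
    have a3 : Hn (PM n μ) (fun ω => (jv ξ (V ∪ V2) (U ∪ U2) ω, jv ξ V U ω)) ≤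
        Hn (PM n μ) (jv ξ (V ∪ V2) (U ∪ U2)) := by
      apply Hn_le_of_det (jv_dm hξ _ _)
      intro ω ω'
      simp only [Prod.mk.injEq, jv_det, Finset.mem_union]
      exact fun ⟨h1, h2⟩ => ⟨⟨h1, h2⟩, fun v hv => h1 v (Or.inl hv), fun u hu => h2 u (Or.inl hu)⟩
    linarith
  shift := by
    intro V U τ
    have key : Hn (PM n μ) (jv ξ V U ∘ sh τ) = Hn (PM n μ) (jv ξ V U) := by
      unfold Hn
      refine Finset.sum_congr rfl fun a _ => ?_
      unfold lw
      rw [Set.preimage_comp, (sh_mp μ τ).measureReal_preimage (jv_dm hξ V U a).nullMeasurableSet]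
    have det : ∀ ω ω', (jv ξ V U ∘ sh τ) ω = (jv ξ V U ∘ sh τ) ω' ↔
        jv ξ (rt V τ) (rt U τ) ω = jv ξ (rt V τ) (rt U τ) ω' := by
      intro ω ω'
      simp only [Function.comp, jv_det, sh_sh_s4]
      constructor
      · rintro ⟨h1, h2⟩
        refine ⟨fun v hv => ?_, fun u hu => ?_⟩
        · obtain ⟨w, hw, rfl⟩ := mem_rt.mp hv; exact h1 w hw
        · obtain ⟨w, hw, rfl⟩ := mem_rt.mp hu; exact h2 w hw
      · rintro ⟨h1, h2⟩
        exact ⟨fun v hv => h1 _ (mem_rt.mpr ⟨v, hv, rfl⟩), fun u hu => h2 _ (mem_rt.mpr ⟨u, hu, rfl⟩)⟩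
    change Hn (PM n μ) (jv ξ (rt V τ) (rt U τ)) = Hn (PM n μ) (jv ξ V U)
    rw [← key]
    apply le_antisymm
    · apply Hn_le_of_det
      · intro a
        exact measurable_sh τ (jv_dm hξ V U a)
      · exact fun ω ω' h => (det ω ω').mp h
    · apply Hn_le_of_det (jv_dm hξ _ _)
      exact fun ω ω' h => (det ω ω').mpr h

/-- The edge-vertex entropy inequality. -/
theorem edge_vertex' (μ : Measure L) [IsProbabilityMeasure μ] {ξ : (FG n → L) → B}
    {D : Finset (FG n)} (hξ : Dep (D : Set (FG n)) ξ) :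
    (2 * n - 1) * Hn (PM n μ) ξ ≤
      ∑ i : Fin n, Hn (PM n μ) (fun ω => (ξ ω, ξ (sh (FreeGroup.of i) ω))) := by
  have main := edge_vertex (jv_poly μ hξ) (∑ a, Real.negMulLog (μ.real {a})) ?_ D ?_
  · have e1 : Hn (PM n μ) (jv ξ ∅ {1}) = Hn (PM n μ) ξ := by
      apply le_antisymm
      · apply Hn_le_of_det hξ.dm
        intro ω ω' h
        rw [jv_det]; simp [sh_one_s4, h]
      · apply Hn_le_of_det (jv_dm hξ _ _)
        intro ω ω' h
        rw [jv_det] at h; simpa [sh_one_s4] using h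
    have e2 : ∀ i : Fin n, Hn (PM n μ) (jv ξ ∅ {1, FreeGroup.of i}) ≤
        Hn (PM n μ) (fun ω => (ξ ω, ξ (sh (FreeGroup.of i) ω))) := by
      intro i
      apply Hn_le_of_det
      · refine hξ.dm.prodMk fun b => measurable_sh _ (hξ.dm b)
      · intro ω ω' h
        rw [jv_det]; simpa [sh_one_s4] using h
    rw [e1] at main
    exact main.trans (Finset.sum_le_sum fun i _ => e2 i)
  · intro V
    have hs : ∑ a, μ.real {a} = 1 := by
      have := lw_sum (P := μ) (X := id) (fun a : L => by simp)
      simpa [lw] using this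
    have := entropy_prod (ι := V) (fun a => μ.real {a}) hs
    rw [Fintype.card_coe] at this
    rw [← this]
    have : Hn (PM n μ) (jv ξ V ∅) = Hn (PM n μ) (fun ω (v : V) => ω v.1) := by
      apply le_antisymm
      · apply Hn_le_of_det
        · apply Dep.dm (D := V)
          intro x y h; funext v; exact h v v.2
        · intro ω ω' h
          rw [jv_det]; simp; intro v hv; exact congrFun h ⟨v, hv⟩
      · apply Hn_le_of_det (jv_dm hξ _ _)
        intro ω ω' h
        rw [jv_det] at h; funext v; exact h.1 v v.2
    rw [this]
    unfold Hn
    refine Finset.sum_congr rfl fun c _ => ?_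
    congr 1
    classical
    rcases isEmpty_or_nonempty L with he | ⟨⟨l0⟩⟩
    · exfalso
      have := μ.nonempty_of_neZero
      exact (not_isEmpty_of_nonempty L) he
    have := cyl μ V (fun g => if hg : g ∈ V then c ⟨g, hg⟩ else l0)
    rw [lw]
    rw [← Finset.prod_coe_sort] at this
    simp only [Finset.coe_mem, dif_pos] at this
    rw [← this]
    congr 1
    ext x
    simp only [Set.mem_preimage, Set.mem_singleton_iff, funext_iff, Set.mem_ofPred_eq, Subtype.forall]
    refine forall₂_congr fun v hv => ?_
    rw [dif_pos hv]
  · intro V hV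
    apply Hn_le_of_det (jv_dm hξ _ _)
    intro ω ω'
    rw [jv_det, jv_det]
    rintro ⟨h1, _⟩
    refine ⟨h1, fun u hu => ?_⟩
    simp at hu; subst hu
    rw [sh_one_s4, sh_one_s4]
    exact hξ _ _ fun d hd => h1 d (hV hd)

end shift
end BFC
end

section
namespace BFC

section mi
variable {n : ℕ} {L : Type*} [MeasurableSpace L] [Fintype L] [MeasurableSingletonClass L]
  {B : Type*} [Fintype B]

open Classical in
lemma mi_bound (μ : Measure L) [IsProbabilityMeasure μ] {ξ : (FG n → L) → B}
    {D : Finset (FG n)} (hξ : Dep (D : Set (FG n)) ξ) (bad : B → B → Prop)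
    (hbad : ∀ ω i, ¬ bad (ξ ω) (ξ (sh (FreeGroup.of i) ω))) :
    n * (1 - ∑ s, ∑ t, if bad s t then 0 else lw (PM n μ) ξ s * lw (PM n μ) ξ t) ≤
      Hn (PM n μ) ξ := by
  set P := PM n μ
  set p := lw P ξ with hp
  set c := 1 - ∑ s, ∑ t, if bad s t then 0 else p s * p t with hc
  have key : ∀ i : Fin n, Hn P (fun ω => (ξ ω, ξ (sh (FreeGroup.of i) ω))) ≤ 2 * Hn P ξ - c := by
    intro i
    set Y : (FG n → L) → B := fun ω => ξ (sh (FreeGroup.of i) ω) with hY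
    have hYm : Dm Y := fun b => measurable_sh _ (hξ.dm b)
    have hlY : lw P Y = p := by
      funext b
      unfold p lw
      exact (sh_mp μ (FreeGroup.of i)).measureReal_preimage (hξ.dm b).nullMeasurableSet
    set T : (FG n → L) → B × B := fun ω => (ξ ω, Y ω) with hT
    have hTm : Dm T := hξ.dm.prodMk hYm
    set q := lw P T
    have e0 : Hn P T = - ∑ t, q t * Real.log (q t) := by simp [Hn, Real.negMulLog, q]
    have e1 : Hn P ξ = - ∑ t, q t * Real.log (p t.1) := Hn_comp hTm (fun t => t.1)
    have e2 : Hn P ξ = - ∑ t, q t * Real.log (p t.2) := by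
      have : Hn P Y = - ∑ t, q t * Real.log (lw P Y t.2) := Hn_comp hTm (fun t => t.2)
      rw [hlY] at this
      rw [← this, Hn, Hn, hlY]
    have main : ∀ t : B × B, q t - (if bad t.1 t.2 then 0 else p t.1 * p t.2) ≤
        q t * Real.log (q t) - q t * Real.log (p t.1) - q t * Real.log (p t.2) := by
      intro t
      rcases (lw_nonneg P T t).eq_or_lt with h | h
      · change 0 = q t at h
        rw [← h]
        have : 0 ≤ (if bad t.1 t.2 then 0 else p t.1 * p t.2) := by
          split_ifs
          · exact le_rfl
          · exact mul_nonneg (lw_nonneg _ _ _) (lw_nonneg _ _ _)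
        simpa using this
      · have hb : ¬ bad t.1 t.2 := by
          intro hb
          have : T ⁻¹' {t} = ∅ := by
            ext ω
            simp only [Set.mem_preimage, Set.mem_singleton_iff, Set.mem_empty_iff_false, iff_false]
            intro hω
            rw [← hω] at hb
            exact hbad ω i hb
          rw [lw, this] at h
          simp at h
        rw [if_neg hb]
        have h1 : 0 < p t.1 := h.trans_le (lw_le_comp (P := P) (X := T) (fun t => t.1) t)
        have h2 : 0 < p t.2 := by
          rw [← hlY]; exact h.trans_le (lw_le_comp (P := P) (X := T) (fun t => t.2) t)
        change 0 < q t at h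
        have hq : 0 < p t.1 * p t.2 / q t := by positivity
        have := Real.log_le_sub_one_of_pos hq
        rw [Real.log_div (by positivity) (by positivity), Real.log_mul h1.ne' h2.ne'] at this
        have h4 := mul_le_mul_of_nonneg_left this h.le
        have h5 : q t * (p t.1 * p t.2 / q t - 1) = p t.1 * p t.2 - q t := by field_simp
        rw [h5] at h4
        linarith
    have s := Finset.sum_le_sum (fun t (_ : t ∈ Finset.univ) => main t)
    simp only [Finset.sum_sub_distrib] at s
    have s1 : ∑ t, q t = 1 := lw_sum hTm
    rw [s1, Fintype.sum_prod_type (fun t : B × B => if bad t.1 t.2 then 0 else p t.1 * p t.2)] at s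
    simp only at s
    linarith
  have ev := edge_vertex' μ hξ
  have := Finset.sum_le_sum (fun i (_ : i ∈ Finset.univ) => key i)
  simp only [Finset.sum_const, Finset.card_univ, Fintype.card_fin, nsmul_eq_mul] at this
  have h3 := ev.trans this
  change (2 * n - 1) * Hn P ξ ≤ _ at h3
  linarith

end mi

lemma negMulLog_le_one_sub {x : ℝ} (hx : 0 ≤ x) : Real.negMulLog x ≤ 1 - x := by
  rcases hx.eq_or_lt with h | h
  · rw [← h]; simp
  · have := Real.one_sub_inv_le_log_of_pos h
    have h2 := mul_le_mul_of_nonneg_left this h.le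
    rw [mul_sub, mul_inv_cancel₀ h.ne'] at h2
    rw [Real.negMulLog]; linarith

lemma ent_bound {B : Type*} [Fintype B] (p : B → ℝ) (hp : ∀ s, 0 ≤ p s) (h1 : ∑ s, p s = 1)
    (s0 : B) : ∑ s, Real.negMulLog (p s) ≤
      (1 - p s0) * (1 + Real.log (Fintype.card B) - Real.log (1 - p s0)) := by
  classical
  set b := 1 - p s0 with hb
  have hsum : ∑ s ∈ Finset.univ.erase s0, p s = b := by
    have := Finset.add_sum_erase Finset.univ p (Finset.mem_univ s0)
    linarith
  rw [← Finset.add_sum_erase _ _ (Finset.mem_univ s0)]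
  have h0 := negMulLog_le_one_sub (hp s0)
  have hb0 : 0 ≤ b := by rw [← hsum]; exact Finset.sum_nonneg fun s _ => hp s
  have hN : 0 < (Fintype.card B : ℝ) := by
    have : 0 < Fintype.card B := Fintype.card_pos_iff.mpr ⟨s0⟩
    exact_mod_cast this
  rcases hb0.eq_or_lt with hz | hz
  · have : ∑ s ∈ Finset.univ.erase s0, Real.negMulLog (p s) = 0 := by
      apply Finset.sum_eq_zero
      intro s hs
      rw [← hz] at hsum
      rw [(Finset.sum_eq_zero_iff_of_nonneg (fun s _ => hp s)).mp hsum s hs]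
      simp
    rw [this, ← hz]; linarith
  · have key : ∀ s, Real.negMulLog (p s) ≤
        p s * (Real.log (Fintype.card B) - Real.log b) + (b / Fintype.card B - p s) := by
      intro s
      rcases (hp s).eq_or_lt with h | h
      · rw [← h]; simp; positivity
      · have hq : 0 < b / Fintype.card B / p s := by positivity
        have := Real.log_le_sub_one_of_pos hq
        rw [Real.log_div (by positivity) (by positivity), Real.log_div hz.ne' hN.ne'] at this
        have h4 := mul_le_mul_of_nonneg_left this h.le
        have h5 : p s * (b / Fintype.card B / p s - 1) = b / Fintype.card B - p s := by field_simp
        rw [h5] at h4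
        rw [Real.negMulLog]; linarith
    have s := Finset.sum_le_sum (fun s (_ : s ∈ Finset.univ.erase s0) => key s)
    rw [Finset.sum_add_distrib, ← Finset.sum_mul, Finset.sum_sub_distrib, hsum] at s
    have : ∑ s ∈ Finset.univ.erase s0, b / (Fintype.card B : ℝ) ≤ b := by
      calc _ ≤ ∑ s : B, b / (Fintype.card B : ℝ) :=
            Finset.sum_le_sum_of_subset_of_nonneg (Finset.erase_subset _ _)
              (fun _ _ _ => by positivity)
        _ = b := by simp; field_simp
    linarith

end BFC
end

section
namespace BFC

section lawsec
variable {n : ℕ} {L : Type*} 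

open Classical in
/-- extension of a partial configuration -/
noncomputable def extd {n : ℕ} {L : Type*} {D : Finset (FG n)} (l0 : L) (c : D → L) : FG n → L :=
  fun g => if hg : g ∈ D then c ⟨g, hg⟩ else l0

lemma extd_mem {D : Finset (FG n)} (l0 : L) (c : D → L) (d : D) : extd l0 c d = c d := by
  simp [extd]

lemma extd_mem' {D : Finset (FG n)} (l0 : L) (c : D → L) {d : FG n} (h : d ∈ D) :
    extd l0 c d = c ⟨d, h⟩ := by
  simp [extd, h]

lemma Dep.extd {B : Type*} {D : Finset (FG n)} {g : (FG n → L) → B} (hg : Dep (D : Set (FG n)) g)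
    (l0 : L) (x : FG n → L) : g (extd l0 (fun d : D => x d)) = g x := by
  apply hg
  intro d hd
  rw [extd_mem' _ _ (Finset.mem_coe.mp hd)]

variable [MeasurableSpace L] [Fintype L] [MeasurableSingletonClass L]

lemma lw_dep (μ : Measure L) [IsProbabilityMeasure μ] (l0 : L) {B : Type*} [DecidableEq B] {D : Finset (FG n)}
    {g : (FG n → L) → B} (hg : Dep (D : Set (FG n)) g) (b : B) :
    lw (PM n μ) g b = ∑ c : D → L, (∏ d, μ.real {c d}) * if g (extd l0 c) = b then 1 else 0 := by
  have hX : Dm (fun (x : FG n → L) (d : D) => x d) := by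
    apply Dep.dm (D := D)
    intro x y h; funext d; exact h d d.2
  have e : g = (fun c : D → L => g (extd l0 c)) ∘ (fun x d => x d) := by
    funext x; simp only [Function.comp]; rw [hg.extd]
  have := lw_comp (P := PM n μ) hX (fun c : D → L => g (extd l0 c)) b
  rw [← e] at this
  rw [this, Finset.sum_filter]
  refine Finset.sum_congr rfl fun c _ => ?_
  split_ifs with h
  · rw [mul_one, lw]
    have := cyl μ D (extd l0 c)
    rw [← Finset.prod_coe_sort] at this
    simp only [extd_mem] at this
    rw [← this]
    congr 1
    ext x
    simp only [Set.mem_preimage, Set.mem_singleton_iff, funext_iff, Set.mem_ofPred_eq, Subtype.forall]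
    refine forall₂_congr fun v hv => ?_
    rw [extd_mem' _ _ hv]
  · rw [mul_zero]

/-- weighted measure on a finite type -/
noncomputable def wm (w : L → ℝ) : Measure L :=
  ∑ l, ENNReal.ofReal (w l) • Measure.dirac l

lemma wm_real {w : L → ℝ} (hw : ∀ l, 0 ≤ w l) (l : L) : (wm w).real {l} = w l := by
  classical
  rw [measureReal_def, wm, Measure.finsetSum_apply]
  rw [Finset.sum_eq_single l]
  · simp [hw l]
  · intro b _ hb
    simp [Set.indicator, hb]
  · simp

lemma wm_prob {w : L → ℝ} (hw : ∀ l, 0 ≤ w l) (h1 : ∑ l, w l = 1) : IsProbabilityMeasure (wm w) := by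
  constructor
  rw [wm, Measure.finsetSum_apply]
  simp only [Measure.smul_apply, measure_univ, smul_eq_mul, mul_one]
  rw [← ENNReal.ofReal_sum_of_nonneg (fun l _ => hw l), h1, ENNReal.ofReal_one]

end lawsec

lemma prod_sum' {ι A : Type*} [Fintype ι] [DecidableEq ι] [Fintype A] (g : ι → A → ℝ) :
    ∑ c : ι → A, ∏ i, g i (c i) = ∏ i, ∑ a, g i a := by
  have := Finset.prod_univ_sum (fun _ : ι => (Finset.univ : Finset A)) g
  rw [Fintype.piFinset_univ] at this
  exact this.symm

section merge
variable {n : ℕ}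

def mg (b : Bool × Bool) (z : Bool) : Bool := if b.1 then b.2 else z

noncomputable def wt (p : ℝ) (b : Bool × Bool) : ℝ := (if b.1 then p else 1 - p) / 2

lemma wt_nonneg {p : ℝ} (h0 : 0 ≤ p) (h1 : p ≤ 1) (b) : 0 ≤ wt p b := by
  unfold wt; split_ifs <;> linarith

lemma wt_sum (p : ℝ) : ∑ b, wt p b = 1 := by
  simp [Fintype.sum_prod_type, wt]

noncomputable def Pt {D : Finset (FG n)} (p : ℝ) (τ : D → Bool × Bool) : ℝ := ∏ d, wt p (τ d)

noncomputable def Qt {D : Finset (FG n)} (F : (FG n → Bool) → Bool) (τ : D → Bool × Bool) : ℝ :=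
  ∑ z : D → Bool, (∏ _d : D, (1/2 : ℝ)) * if F (extd false (fun d => mg (τ d) (z d))) = true then 1 else 0

/-- density -/
noncomputable def dn (D : Finset (FG n)) (F : (FG n → Bool) → Bool) : ℝ :=
  ∑ z : D → Bool, (∏ _d : D, (1/2 : ℝ)) * if F (extd false z) = true then 1 else 0

variable {D : Finset (FG n)} (F : (FG n → Bool) → Bool)

lemma Pt_nonneg {p : ℝ} (h0 : 0 ≤ p) (h1 : p ≤ 1) (τ : D → Bool × Bool) : 0 ≤ Pt p τ :=
  Finset.prod_nonneg fun _ _ => wt_nonneg h0 h1 _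

lemma Pt_sum (p : ℝ) : ∑ τ : D → Bool × Bool, Pt p τ = 1 := by
  unfold Pt
  rw [prod_sum' (fun _ => wt p)]
  simp [wt_sum]

lemma half_sum : ∑ _z : D → Bool, (∏ _d : D, (1/2 : ℝ)) = 1 := by
  rw [prod_sum' (fun _ _ => (1/2 : ℝ))]
  simp

lemma Qt_nonneg (τ : D → Bool × Bool) : 0 ≤ Qt F τ := by
  unfold Qt
  refine Finset.sum_nonneg fun z _ => ?_
  split_ifs <;> simp

lemma Qt_compl (τ : D → Bool × Bool) : 
    ∑ z : D → Bool, (∏ _d : D, (1/2 : ℝ)) * (if F (extd false (fun d => mg (τ d) (z d))) = false then 1 else 0) = 1 - Qt F τ := by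
  rw [eq_sub_iff_add_eq, Qt, ← Finset.sum_add_distrib, ← half_sum (D := D)]
  refine Finset.sum_congr rfl fun z _ => ?_
  cases F (extd false fun d => mg (τ d) (z d)) <;> simp

lemma Qt_le_one (τ : D → Bool × Bool) : Qt F τ ≤ 1 := by
  have := Qt_compl F τ
  have h : 0 ≤ 1 - Qt F τ := by
    rw [← this]
    refine Finset.sum_nonneg fun z _ => ?_
    split_ifs <;> simp
  linarith

lemma EQ (p : ℝ) : ∑ τ : D → Bool × Bool, Pt p τ * Qt F τ = dn D F := by
  unfold Pt Qt dn
  have e1 : ∀ τ : D → Bool × Bool, ∀ z : D → Bool,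
      (∏ d, wt p (τ d)) * ((∏ _d : D, (1/2 : ℝ)) *
        if F (extd false (fun d => mg (τ d) (z d))) = true then 1 else 0) =
      ∑ y : D → Bool, (if F (extd false y) = true then 1 else 0) *
        ∏ d, (wt p (τ d) * (1/2) * if y d = mg (τ d) (z d) then 1 else 0) := by
    intro τ z
    rw [Finset.sum_eq_single (fun d => mg (τ d) (z d))]
    · simp only [if_true, mul_one, Finset.prod_mul_distrib]; ring
    · intro y _ hy
      obtain ⟨d, hd⟩ := Function.ne_iff.mp hy
      rw [Finset.prod_eq_zero (Finset.mem_univ d), mul_zero]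
      rw [if_neg hd, mul_zero]
    · simp
  simp only [Finset.mul_sum, e1]
  have e2 : ∀ τ : D → Bool × Bool, ∑ z : D → Bool, ∑ y : D → Bool, 
      ((if F (extd false y) = true then 1 else 0) *
        ∏ d, (wt p (τ d) * (1/2) * if y d = mg (τ d) (z d) then 1 else 0) : ℝ) =
      ∑ y : D → Bool, (if F (extd false y) = true then 1 else 0) *
        ∏ d, ∑ z : Bool, (wt p (τ d) * (1/2) * if y d = mg (τ d) z then 1 else 0) := by
    intro τ
    rw [Finset.sum_comm]
    refine Finset.sum_congr rfl fun y _ => ?_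
    rw [← Finset.mul_sum, prod_sum' (fun d z => (wt p (τ d) * (1/2) * if y d = mg (τ d) z then 1 else 0))]
  simp only [e2]
  rw [Finset.sum_comm]
  refine Finset.sum_congr rfl fun y _ => ?_
  rw [← Finset.mul_sum, prod_sum' (fun d t => ∑ z : Bool, (wt p t * (1/2) * if y d = mg t z then 1 else 0)), mul_comm]
  congr 1
  refine Finset.prod_congr rfl fun d _ => ?_
  cases y d <;> simp [Fintype.sum_prod_type, wt, mg] <;> ring

/-- at `p = 0` all patterns with positive weight have `Q = a` -/
lemma Qt_zero (τ : D → Bool × Bool) (h : Pt 0 τ ≠ 0) : Qt F τ = dn D F := by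
  have h1 : ∀ d, (τ d).1 = false := by
    intro d
    by_contra hd
    apply h
    apply Finset.prod_eq_zero (Finset.mem_univ d)
    simp [wt, hd]
  unfold Qt dn
  simp [mg, h1]

lemma Qt_one (τ : D → Bool × Bool) (h : Pt 1 τ ≠ 0) : Qt F τ = 0 ∨ Qt F τ = 1 := by
  have h1 : ∀ d, (τ d).1 = true := by
    intro d
    by_contra hd
    apply h
    apply Finset.prod_eq_zero (Finset.mem_univ d)
    simp [wt, hd]
  unfold Qt
  simp only [mg, h1, if_true]
  rw [← Finset.sum_mul, half_sum]
  split_ifs <;> simp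

/-- the k-fold coupled process -/
def xi (k : ℕ) (F : (FG n → Bool) → Bool) (ω : FG n → (Bool × Bool) × (Fin k → Bool)) : Fin k → Bool :=
  fun j => F (fun g => mg (ω g).1 ((ω g).2 j))

noncomputable def wk (k : ℕ) (p : ℝ) (l : (Bool × Bool) × (Fin k → Bool)) : ℝ :=
  wt p l.1 * ∏ _j : Fin k, (1/2 : ℝ)

lemma xi_dep (k : ℕ) {F : (FG n → Bool) → Bool} (hF : Dep (D : Set (FG n)) F) :
    Dep (D : Set (FG n)) (xi k F) := by
  intro x y h
  funext j
  apply hF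
  intro d hd
  rw [h d hd]

lemma wk_nonneg (k : ℕ) {p : ℝ} (h0 : 0 ≤ p) (h1 : p ≤ 1) (l) : 0 ≤ wk k p l :=
  mul_nonneg (wt_nonneg h0 h1 _) (by positivity)

lemma wk_sum (k : ℕ) (p : ℝ) : ∑ l, wk k p l = 1 := by
  unfold wk
  rw [Fintype.sum_prod_type]
  simp only [← Finset.mul_sum]
  rw [prod_sum' (fun (_ : Fin k) (_ : Bool) => (1/2 : ℝ))]
  simp [wt_sum]

lemma xi_law (k : ℕ) {F : (FG n → Bool) → Bool} (hF : Dep (D : Set (FG n)) F) {p : ℝ} (h0 : 0 ≤ p) (h1 : p ≤ 1)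
    (s : Fin k → Bool) :
    lw (PM n (wm (wk k p))) (xi k F) s =
      ∑ τ : D → Bool × Bool, Pt p τ * ∏ j, if s j then Qt F τ else 1 - Qt F τ := by
  have := wm_prob (wk_nonneg k h0 h1) (wk_sum k p)
  rw [lw_dep (wm (wk k p)) ((false, false), fun _ => false) (xi_dep k hF) s]
  simp only [wm_real (wk_nonneg k h0 h1)]
  have e : ∀ τ : D → Bool × Bool, (∏ j, if s j then Qt F τ else 1 - Qt F τ) =
      ∑ z : Fin k → D → Bool, ∏ j, ((∏ _d : D, (1/2 : ℝ)) *
        if F (extd false (fun d => mg (τ d) (z j d))) = s j then 1 else 0) := by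
    intro τ
    rw [prod_sum' (fun (j : Fin k) (z : D → Bool) => ((∏ _d : D, (1/2 : ℝ)) *
        if F (extd false (fun d => mg (τ d) (z d))) = s j then 1 else 0))]
    refine Finset.prod_congr rfl fun j _ => ?_
    cases s j
    · simp only [Bool.false_eq_true, if_false]; exact (Qt_compl F τ).symm
    · simp only [if_true]; rfl
  simp only [e, Finset.mul_sum]
  rw [← Fintype.sum_prod_type' (f := fun (τ : D → Bool × Bool) (z : Fin k → D → Bool) => Pt p τ * ∏ j, ((∏ _d : D, (1/2 : ℝ)) *
        if F (extd false (fun d => mg (τ d) (z j d))) = s j then 1 else 0))]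
  let eq : (D → (Bool × Bool) × (Fin k → Bool)) ≃ (D → Bool × Bool) × (Fin k → D → Bool) :=
    (Equiv.arrowProdEquivProdArrow _ _ _).trans (Equiv.prodCongr (Equiv.refl _) (Equiv.piComm _))
  refine Fintype.sum_equiv eq _ _ fun c => ?_
  have q1 : (eq c).1 = fun d => (c d).1 := rfl
  have q2 : (eq c).2 = fun j d => (c d).2 j := rfl
  rw [q1, q2]
  simp only [wk, Pt, Finset.prod_mul_distrib, mul_assoc]
  congr 1
  rw [Finset.prod_comm]
  congr 1
  rw [Finset.prod_ite_zero]
  simp only [Finset.prod_const_one]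
  congr 1
  simp only [funext_iff, Finset.mem_univ, true_implies]
  refine propext (forall_congr' fun j => ?_)
  have : (fun g => mg (extd ((false, false), fun _ => false) c g).1 ((extd ((false, false), fun _ => false) c g).2 j)) =
     extd false (fun d => mg (c d).1 ((c d).2 j)) := by
    funext g
    by_cases hg : g ∈ D
    · simp [extd, hg]
    · simp [extd, hg, mg]
  rw [xi, this]

/-- main family of inequalities -/
lemma nk_bound (k : ℕ) {F : (FG n → Bool) → Bool} (hF : Dep (D : Set (FG n)) F)
    (hind : ∀ x i, ¬ (F x = true ∧ F (sh (FreeGroup.of i) x) = true))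
    {p : ℝ} (h0 : 0 ≤ p) (h1 : p ≤ 1) :
    n * ∑ τ : D → Bool × Bool, ∑ τ' : D → Bool × Bool, Pt p τ * Pt p τ' * (1 - (1 - Qt F τ * Qt F τ') ^ k) ≤
      (∑ τ : D → Bool × Bool, Pt p τ * (1 - (1 - Qt F τ) ^ k)) *
       (1 + k * Real.log 2 - Real.log (∑ τ : D → Bool × Bool, Pt p τ * (1 - (1 - Qt F τ) ^ k))) := by
  classical
  have := wm_prob (wk_nonneg k h0 h1) (wk_sum k p)
  have m := mi_bound (wm (wk k p)) (xi_dep k hF) (fun s t => ∃ j, s j = true ∧ t j = true) (by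
    rintro ω i ⟨j, hj⟩
    exact hind _ i hj)
  have eb := ent_bound (lw (PM n (wm (wk k p))) (xi k F)) (lw_nonneg _ _) (lw_sum (xi_dep k hF).dm)
    (fun _ => false)
  have hb : 1 - lw (PM n (wm (wk k p))) (xi k F) (fun _ => false) =
      ∑ τ : D → Bool × Bool, Pt p τ * (1 - (1 - Qt F τ) ^ k) := by
    rw [xi_law k hF h0 h1]
    simp [mul_sub, Pt_sum]
  rw [hb] at eb
  have hcard : Real.log (Fintype.card (Fin k → Bool)) = k * Real.log 2 := by simp
  rw [hcard] at eb
  refine le_trans (le_of_eq ?_) (m.trans eb)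
  congr 1
  simp only [xi_law k hF h0 h1]
  have e1 : ∀ s t : Fin k → Bool, (if ∃ j, s j = true ∧ t j = true then 0 else
      (∑ τ : D → Bool × Bool, Pt p τ * ∏ j, if s j = true then Qt F τ else 1 - Qt F τ) *
       ∑ τ : D → Bool × Bool, Pt p τ * ∏ j, if t j = true then Qt F τ else 1 - Qt F τ) =
      ∑ τ : D → Bool × Bool, ∑ τ' : D → Bool × Bool, Pt p τ * Pt p τ' *
        ∏ j, ((if s j = true ∧ t j = true then 0 else 1) * 
         ((if s j = true then Qt F τ else 1 - Qt F τ) * (if t j = true then Qt F τ' else 1 - Qt F τ'))) := by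
    intro s t
    split_ifs with h
    · obtain ⟨j, hj⟩ := h
      symm
      refine Finset.sum_eq_zero fun τ _ => Finset.sum_eq_zero fun τ' _ => ?_
      rw [Finset.prod_eq_zero (Finset.mem_univ j), mul_zero]
      rw [if_pos hj, zero_mul]
    · push Not at h
      rw [Finset.sum_mul_sum]
      refine Finset.sum_congr rfl fun τ _ => Finset.sum_congr rfl fun τ' _ => ?_
      have : ∀ j, ((if s j = true ∧ t j = true then 0 else 1 : ℝ)) = 1 := by
        intro j; rw [if_neg]; rintro ⟨a, b⟩; exact h j a b
      simp only [this, one_mul, Finset.prod_mul_distrib]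
      ring
  simp only [e1]
  have e2 : ∀ τ τ' : D → Bool × Bool, ∑ s : Fin k → Bool, ∑ t : Fin k → Bool, 
      ∏ j, ((if s j = true ∧ t j = true then 0 else 1) * 
         ((if s j = true then Qt F τ else 1 - Qt F τ) * (if t j = true then Qt F τ' else 1 - Qt F τ')))
      = (1 - Qt F τ * Qt F τ') ^ k := by
    intro τ τ'
    have : ∀ s : Fin k → Bool, ∑ t : Fin k → Bool, 
      ∏ j, ((if s j = true ∧ t j = true then 0 else 1) * 
         ((if s j = true then Qt F τ else 1 - Qt F τ) * (if t j = true then Qt F τ' else 1 - Qt F τ')))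
      = ∏ j, ∑ b : Bool, ((if s j = true ∧ b = true then 0 else 1) * 
         ((if s j = true then Qt F τ else 1 - Qt F τ) * (if b = true then Qt F τ' else 1 - Qt F τ'))) := by
      intro s
      exact prod_sum' (fun j b => ((if s j = true ∧ b = true then 0 else 1) * 
         ((if s j = true then Qt F τ else 1 - Qt F τ) * (if b = true then Qt F τ' else 1 - Qt F τ'))))
    simp only [this]
    rw [prod_sum' (fun (j : Fin k) (a : Bool) => ∑ b : Bool, ((if a = true ∧ b = true then 0 else 1) * 
         ((if a = true then Qt F τ else 1 - Qt F τ) * (if b = true then Qt F τ' else 1 - Qt F τ'))))]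
    simp only [Finset.prod_const, Finset.card_univ, Fintype.card_fin]
    congr 1
    simp; ring
  have e3 : ∑ s : Fin k → Bool, ∑ t : Fin k → Bool, ∑ τ : D → Bool × Bool, ∑ τ' : D → Bool × Bool, Pt p τ * Pt p τ' *
        ∏ j, ((if s j = true ∧ t j = true then 0 else 1) * 
         ((if s j = true then Qt F τ else 1 - Qt F τ) * (if t j = true then Qt F τ' else 1 - Qt F τ'))) =
      ∑ τ : D → Bool × Bool, ∑ τ' : D → Bool × Bool, Pt p τ * Pt p τ' * (1 - Qt F τ * Qt F τ') ^ k := by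
    have c1 : ∀ (f : (Fin k → Bool) → (Fin k → Bool) → (D → Bool × Bool) → (D → Bool × Bool) → ℝ),
        ∑ s, ∑ t, ∑ τ, ∑ τ', f s t τ τ' = ∑ τ, ∑ τ', ∑ s, ∑ t, f s t τ τ' := by
      intro f
      calc _ = ∑ s, ∑ τ, ∑ t, ∑ τ', f s t τ τ' := 
            Finset.sum_congr rfl fun s _ => Finset.sum_comm
        _ = ∑ τ, ∑ s, ∑ t, ∑ τ', f s t τ τ' := Finset.sum_comm
        _ = ∑ τ, ∑ s, ∑ τ', ∑ t, f s t τ τ' := 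
            Finset.sum_congr rfl fun τ _ => Finset.sum_congr rfl fun s _ => Finset.sum_comm
        _ = _ := Finset.sum_congr rfl fun τ _ => Finset.sum_comm
    rw [c1]
    refine Finset.sum_congr rfl fun τ _ => Finset.sum_congr rfl fun τ' _ => ?_
    simp only [← Finset.mul_sum]
    rw [e2]
  rw [e3]
  simp only [mul_sub, mul_one, Finset.sum_sub_distrib, ← Finset.mul_sum, Pt_sum]

end merge
end BFC
end

section
namespace BFC

noncomputable def Gd (δ y : ℝ) : ℝ := y / (δ + (1 - δ) * y)

noncomputable def Cd (δ : ℝ) : ℝ :=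
  ∑' k : ℕ, δ * (1 - δ) ^ k * (((k : ℝ) + 1) * (1 + ((k : ℝ) + 1) * Real.log 2))

lemma Gd_hasSum {δ y : ℝ} (h0 : 0 < δ) (h1 : δ < 1) (hy0 : 0 ≤ y) (hy1 : y ≤ 1) :
    HasSum (fun k : ℕ => δ * (1 - δ) ^ k * (1 - (1 - y) ^ (k + 1))) (Gd δ y) := by
  have a1 := (hasSum_geometric_of_lt_one (r := 1 - δ) (by linarith) (by linarith)).mul_left δ
  have hr : (1 - δ) * (1 - y) < 1 := by nlinarith
  have a2 := (hasSum_geometric_of_lt_one (r := (1 - δ) * (1 - y))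
    (mul_nonneg (by linarith) (by linarith)) hr).mul_left (δ * (1 - y))
  have a3 := a1.sub a2
  have hpos : 0 < δ + (1 - δ) * y := by nlinarith
  have e1 : (fun k : ℕ => δ * (1 - δ) ^ k * (1 - (1 - y) ^ (k + 1))) =
      fun b => δ * (1 - δ) ^ b - δ * (1 - y) * ((1 - δ) * (1 - y)) ^ b := by
    funext k; rw [mul_pow]; ring
  have e2 : Gd δ y = δ * (1 - (1 - δ))⁻¹ - δ * (1 - y) * (1 - (1 - δ) * (1 - y))⁻¹ := by
    have e : 1 - (1 - δ) * (1 - y) = δ + (1 - δ) * y := by ring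
    have : 1 - (1 - δ) = δ := by ring
    rw [e, Gd, this, mul_inv_cancel₀ h0.ne', div_eq_iff hpos.ne', sub_mul, mul_assoc (δ * (1 - y)),
      inv_mul_cancel₀ hpos.ne']
    ring
  rw [e1, e2]
  exact a3

lemma Cd_summable {δ : ℝ} (h0 : 0 < δ) (h1 : δ < 1) :
    Summable (fun k : ℕ => δ * (1 - δ) ^ k * (((k : ℝ) + 1) * (1 + ((k : ℝ) + 1) * Real.log 2))) := by
  have hn : ‖1 - δ‖ < 1 := by rw [Real.norm_eq_abs, abs_lt]; constructor <;> linarith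
  have s0 := (summable_pow_mul_geometric_of_norm_lt_one 0 hn).mul_left (δ * (1 + Real.log 2))
  have s1 := (summable_pow_mul_geometric_of_norm_lt_one 1 hn).mul_left (δ * (1 + 2 * Real.log 2))
  have s2 := (summable_pow_mul_geometric_of_norm_lt_one 2 hn).mul_left (δ * (Real.log 2))
  refine ((s0.add s1).add s2).congr fun k => ?_
  ring

section dist
variable {T : Type*} [Fintype T] {P Q : T → ℝ} {a N : ℝ}

lemma fixed_dist (hP : ∀ t, 0 ≤ P t) (hQ0 : ∀ t, 0 ≤ Q t)
    (hQ1 : ∀ t, Q t ≤ 1) (ha : ∑ t, P t * Q t = a) (hapos : 0 < a)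
    (hk : ∀ k : ℕ, N * ∑ t, ∑ t', P t * P t' * (1 - (1 - Q t * Q t') ^ k) ≤
      (∑ t, P t * (1 - (1 - Q t) ^ k)) *
       (1 + k * Real.log 2 - Real.log (∑ t, P t * (1 - (1 - Q t) ^ k))))
    {δ : ℝ} (h0 : 0 < δ) (h1 : δ < 1) :
    N * ∑ t, ∑ t', P t * P t' * Gd δ (Q t * Q t') ≤
      (- Real.log a) * ∑ t, P t * Gd δ (Q t) + a * Cd δ := by
  have S1 : HasSum (fun k : ℕ => δ * (1 - δ) ^ k *
      (N * ∑ t, ∑ t', P t * P t' * (1 - (1 - Q t * Q t') ^ (k+1))))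
      (N * ∑ t, ∑ t', P t * P t' * Gd δ (Q t * Q t')) := by
    have : HasSum (fun k : ℕ => N * ∑ t, ∑ t', P t * P t' * (δ * (1 - δ) ^ k * (1 - (1 - Q t * Q t') ^ (k+1))))
      (N * ∑ t, ∑ t', P t * P t' * Gd δ (Q t * Q t')) := by
      refine HasSum.mul_left _ (hasSum_sum fun t _ => hasSum_sum fun t' _ => HasSum.mul_left _ ?_)
      exact Gd_hasSum h0 h1 (mul_nonneg (hQ0 t) (hQ0 t')) (mul_le_one₀ (hQ1 t) (hQ0 t') (hQ1 t'))
    refine (iff_of_eq (congrArg (HasSum · _) (funext fun k => ?_))).mpr this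
    simp only [Finset.mul_sum]
    refine Finset.sum_congr rfl fun t _ => Finset.sum_congr rfl fun t' _ => ?_
    ring
  have S2 : HasSum (fun k : ℕ => δ * (1 - δ) ^ k * ∑ t, P t * (1 - (1 - Q t) ^ (k+1)))
      (∑ t, P t * Gd δ (Q t)) := by
    have : HasSum (fun k : ℕ => ∑ t, P t * (δ * (1 - δ) ^ k * (1 - (1 - Q t) ^ (k+1))))
      (∑ t, P t * Gd δ (Q t)) := by
      refine hasSum_sum fun t _ => HasSum.mul_left _ ?_
      exact Gd_hasSum h0 h1 (hQ0 t) (hQ1 t)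
    refine (iff_of_eq (congrArg (HasSum · _) (funext fun k => ?_))).mpr this
    simp only [Finset.mul_sum]
    refine Finset.sum_congr rfl fun t _ => ?_
    ring
  have S3 := (Cd_summable h0 h1).hasSum
  refine hasSum_le (fun k => ?_) S1 ((S2.mul_left (- Real.log a)).add (S3.mul_left a))
  have hw : 0 ≤ δ * (1 - δ) ^ k := mul_nonneg h0.le (pow_nonneg (by linarith) _)
  set b := ∑ t, P t * (1 - (1 - Q t) ^ (k+1)) with hb
  have hab : a ≤ b := by
    rw [← ha]
    refine Finset.sum_le_sum fun t _ => mul_le_mul_of_nonneg_left ?_ (hP t)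
    have : (1 - Q t) ^ (k+1) ≤ (1 - Q t) := pow_le_of_le_one (by linarith [hQ1 t]) (by linarith [hQ0 t]) (by omega)
    linarith
  have hbk : b ≤ (k + 1) * a := by
    rw [← ha, Finset.mul_sum]
    refine Finset.sum_le_sum fun t _ => ?_
    have := one_add_mul_le_pow (a := - Q t) (by linarith [hQ1 t]) (k + 1)
    push_cast at this
    have h2 : 1 - (1 - Q t) ^ (k+1) ≤ (k + 1) * Q t := by
      rw [← sub_eq_add_neg] at this
      linarith
    nlinarith [hP t]
  have hlog : Real.log a ≤ Real.log b := Real.log_le_log hapos hab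
  have hkk := hk (k + 1)
  rw [← hb] at hkk
  push_cast at hkk
  have hl2 : 0 < Real.log 2 := Real.log_pos (by norm_num)
  have c1 : b * (1 + (k + 1) * Real.log 2 - Real.log b) ≤
      (k+1) * a * (1 + (k + 1) * Real.log 2) + (- Real.log a) * b := by
    have hb0 : 0 < b := by linarith
    have x1 : b * Real.log a ≤ b * Real.log b := mul_le_mul_of_nonneg_left hlog hb0.le
    have x2 : b * (1 + (k + 1) * Real.log 2) ≤ (k+1) * a * (1 + (k + 1) * Real.log 2) :=
      mul_le_mul_of_nonneg_right hbk (by positivity)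
    linarith
  have := mul_le_mul_of_nonneg_left (hkk.trans c1) hw
  linarith

lemma Gd_key {δ y z : ℝ} (h0 : 0 < δ) (h1 : δ < 1) (hy0 : 0 ≤ y) (hy1 : y ≤ 1) (hz0 : 0 ≤ z) (hz1 : z ≤ 1) :
    y * z * (1 - Gd δ y * Gd δ z) ≤ δ * Gd δ (y * z) := by
  have p1 : 0 < δ + (1 - δ) * y := by nlinarith
  have p2 : 0 < δ + (1 - δ) * z := by nlinarith
  have hyz : 0 ≤ y * z := mul_nonneg hy0 hz0
  have p3 : 0 < δ + (1 - δ) * (y * z) := by nlinarith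
  unfold Gd
  have e : δ * (y * z / (δ + (1 - δ) * (y * z))) = y * z * (δ / (δ + (1 - δ) * (y * z))) := by ring
  rw [e]
  refine mul_le_mul_of_nonneg_left ?_ hyz
  have e2 : y / (δ + (1 - δ) * y) * (z / (δ + (1 - δ) * z)) =
    (y * z) / ((δ + (1 - δ) * y) * (δ + (1 - δ) * z)) := by field_simp
  rw [e2]
  have key : (1 - δ) * ((δ + (1 - δ) * y) * (δ + (1 - δ) * z)) ≤ δ + (1 - δ) * (y * z) := by
    have : 0 ≤ (1 - δ) * δ := mul_nonneg (by linarith) h0.le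
    nlinarith [mul_nonneg (mul_nonneg this h0.le) (mul_nonneg (sub_nonneg.mpr hy1) (sub_nonneg.mpr hz1)), mul_nonneg this hyz, mul_nonneg this (mul_nonneg (sub_nonneg.mpr hy1) (sub_nonneg.mpr hz1)), mul_nonneg (mul_nonneg this h0.le) hyz]
  have : 1 - y * z / ((δ + (1 - δ) * y) * (δ + (1 - δ) * z)) ≤ 1 - (1 - δ) * (y * z) / (δ + (1 - δ) * (y * z)) := by
    apply sub_le_sub_left
    rw [div_le_div_iff₀ p3 (by positivity)]
    nlinarith [mul_le_mul_of_nonneg_left key hyz]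
  refine this.trans (le_of_eq ?_)
  rw [eq_div_iff p3.ne', sub_mul, div_mul_cancel₀ _ p3.ne']
  ring

lemma fixed_dist2 (hP : ∀ t, 0 ≤ P t) (hQ0 : ∀ t, 0 ≤ Q t)
    (hQ1 : ∀ t, Q t ≤ 1) (ha : ∑ t, P t * Q t = a) (hapos : 0 < a) (hN : 0 ≤ N)
    (hk : ∀ k : ℕ, N * ∑ t, ∑ t', P t * P t' * (1 - (1 - Q t * Q t') ^ k) ≤
      (∑ t, P t * (1 - (1 - Q t) ^ k)) *
       (1 + k * Real.log 2 - Real.log (∑ t, P t * (1 - (1 - Q t) ^ k))))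
    {δ : ℝ} (h0 : 0 < δ) (h1 : δ < 1) {v : ℝ} (hv : ∑ t, P t * (Q t * Gd δ (Q t)) = a * v) :
    N * a * (1 - v ^ 2) ≤ (- Real.log a) * (1 - (1 - δ) * v) + δ * Cd δ := by
  have h := fixed_dist hP hQ0 hQ1 ha hapos hk h0 h1
  have e1 : δ * ∑ t, P t * Gd δ (Q t) = a * (1 - (1 - δ) * v) := by
    have : a * (1 - (1 - δ) * v) = a - (1 - δ) * (a * v) := by ring
    rw [this, ← hv, ← ha, Finset.mul_sum, Finset.mul_sum, ← Finset.sum_sub_distrib]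
    refine Finset.sum_congr rfl fun t _ => ?_
    have p1 : 0 < δ + (1 - δ) * Q t := by nlinarith [hQ0 t, hQ1 t]
    have e : Gd δ (Q t) * (δ + (1 - δ) * Q t) = Q t := by
      unfold Gd; exact div_mul_cancel₀ _ p1.ne'
    linear_combination (P t) * e
  have e2 : a ^ 2 * (1 - v ^ 2) ≤ δ * ∑ t, ∑ t', P t * P t' * Gd δ (Q t * Q t') := by
    have : a ^ 2 * (1 - v ^ 2) = a * a - (a * v) * (a * v) := by ring
    rw [this, ← hv, ← ha, Finset.sum_mul_sum, Finset.sum_mul_sum, Finset.mul_sum, ← Finset.sum_sub_distrib]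
    refine Finset.sum_le_sum fun t _ => ?_
    rw [Finset.mul_sum, ← Finset.sum_sub_distrib]
    refine Finset.sum_le_sum fun t' _ => ?_
    have := mul_le_mul_of_nonneg_left (Gd_key h0 h1 (hQ0 t) (hQ1 t) (hQ0 t') (hQ1 t')) (mul_nonneg (hP t) (hP t'))
    linarith
  have h3 := mul_le_mul_of_nonneg_left h h0.le
  have h4 := mul_le_mul_of_nonneg_left e2 hN
  have h5 : a * (N * a * (1 - v ^ 2)) ≤ a * ((- Real.log a) * (1 - (1 - δ) * v) + δ * Cd δ) := by
    have : a * ((- Real.log a) * (1 - (1 - δ) * v) + δ * Cd δ) =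
      (-Real.log a) * (δ * ∑ t, P t * Gd δ (Q t)) + δ * (a * Cd δ) := by rw [e1]; ring
    rw [this]
    linarith
  exact le_of_mul_le_mul_left h5 hapos

end dist

lemma Gd_cont_sum {n : ℕ} {D : Finset (FG n)} (f : (D → Bool × Bool) → ℝ) :
    Continuous (fun p : ℝ => ∑ τ, Pt p τ * f τ) := by
  unfold Pt wt
  refine continuous_finsetSum _ fun τ _ => Continuous.mul (continuous_finsetProd _ fun d _ => ?_) continuous_const
  split_ifs <;> fun_prop

lemma local_bound {n : ℕ} {D : Finset (FG n)} {F : (FG n → Bool) → Bool} (hF : Dep (D : Set (FG n)) F)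
    (hind : ∀ x i, ¬ (F x = true ∧ F (sh (FreeGroup.of i) x) = true))
    {ε : ℝ} (h0 : 0 < ε) (h1 : ε < 1) (ha : 0 < dn D F) (hs : dn D F ≤ ε ^ 2 * (1 - ε)) :
    n * dn D F * (2 - ε) ≤ (- Real.log (dn D F)) * (1 + ε) + ε * Cd (ε ^ 2) := by
  set a := dn D F
  have hδ0 : 0 < ε ^ 2 := by positivity
  have hδ1 : ε ^ 2 < 1 := by nlinarith
  set δ := ε ^ 2 with hδ
  have hG0 : ∑ τ : D → Bool × Bool, Pt 0 τ * (Qt F τ * Gd δ (Qt F τ)) ≤ a * (1 - ε) := by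
    have : ∑ τ : D → Bool × Bool, Pt 0 τ * (Qt F τ * Gd δ (Qt F τ)) = a * Gd δ a := by
      have : ∀ τ : D → Bool × Bool, Pt 0 τ * (Qt F τ * Gd δ (Qt F τ)) = Pt 0 τ * (a * Gd δ a) := by
        intro τ
        by_cases h : Pt 0 τ = 0
        · rw [h]; ring
        · rw [Qt_zero F τ h]
      rw [Finset.sum_congr rfl (fun τ _ => this τ), ← Finset.sum_mul, Pt_sum, one_mul]
    rw [this]
    refine mul_le_mul_of_nonneg_left ?_ ha.le
    unfold Gd
    rw [div_le_iff₀ (by nlinarith)]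
    nlinarith [mul_nonneg (mul_nonneg (sub_nonneg.mpr hδ1.le) ha.le) (sub_nonneg.mpr h1.le)]
  have hG1 : a * (1 - ε) ≤ ∑ τ : D → Bool × Bool, Pt 1 τ * (Qt F τ * Gd δ (Qt F τ)) := by
    have : ∑ τ : D → Bool × Bool, Pt 1 τ * (Qt F τ * Gd δ (Qt F τ)) = a := by
      change _ = dn D F
      rw [← EQ (D := D) F 1]
      refine Finset.sum_congr rfl fun τ _ => ?_
      by_cases h : Pt 1 τ = 0
      · rw [h]; ring
      · rcases Qt_one F τ h with h | h <;> rw [h] <;> simp [Gd]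
    rw [this]
    nlinarith
  obtain ⟨p, hp, hv⟩ := intermediate_value_Icc (zero_le_one (α := ℝ))
    (Gd_cont_sum (D := D) (fun τ => Qt F τ * Gd δ (Qt F τ))).continuousOn ⟨hG0, hG1⟩
  have := fixed_dist2 (N := n) (Pt_nonneg hp.1 hp.2) (Qt_nonneg F) (Qt_le_one F) (EQ (D := D) F p) ha
    (Nat.cast_nonneg n) (fun k => nk_bound k hF hind hp.1 hp.2) hδ0 hδ1 hv
  have e1 : n * dn D F * (1 - (1 - ε) ^ 2) = ε * (n * a * (2 - ε)) := by ring
  have e2 : -Real.log (dn D F) * (1 - (1 - δ) * (1 - ε)) + δ * Cd δ = 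
     ε * ((- Real.log a) * (1 + ε - ε ^ 2) + ε * Cd δ) := by rw [hδ]; ring
  rw [e1, e2] at this
  have h3 := le_of_mul_le_mul_left this h0
  have hlog : 0 ≤ - Real.log a := by
    have : Real.log a ≤ 0 := Real.log_nonpos ha.le (by nlinarith)
    linarith
  nlinarith [mul_nonneg hlog hδ0.le]

lemma local_bound1 {n : ℕ} {D : Finset (FG n)} {F : (FG n → Bool) → Bool} (hF : Dep (D : Set (FG n)) F)
    (hind : ∀ x i, ¬ (F x = true ∧ F (sh (FreeGroup.of i) x) = true)) (ha : 0 < dn D F) :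
    n * dn D F ≤ 1 + Real.log 2 - Real.log (dn D F) := by
  have := nk_bound 1 hF hind (le_refl (0 : ℝ)) zero_le_one
  simp only [pow_one, sub_sub_cancel, EQ] at this
  have e : ∑ τ : D → Bool × Bool, ∑ τ' : D → Bool × Bool, Pt 0 τ * Pt 0 τ' * (Qt F τ * Qt F τ') = dn D F * dn D F := by
    rw [← EQ (D := D) F 0, Finset.sum_mul_sum]
    refine Finset.sum_congr rfl fun t _ => Finset.sum_congr rfl fun t' _ => ?_
    ring
  rw [e] at this
  push_cast at this
  rw [one_mul] at this
  have h5 : dn D F * (n * dn D F) ≤ dn D F * (1 + Real.log 2 - Real.log (dn D F)) := by linarith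
  exact le_of_mul_le_mul_left h5 ha

lemma local_max {η : ℝ} (h0 : 0 < η) (h1 : η ≤ 1) : ∃ N : ℕ, ∀ n ≥ N, ∀ (D : Finset (FG n))
    (F : (FG n → Bool) → Bool), Dep (D : Set (FG n)) F →
    (∀ x i, ¬ (F x = true ∧ F (sh (FreeGroup.of i) x) = true)) →
    dn D F ≤ (1 + η) / 2 * (Real.log n / n) := by
  set ε := η / 3 with hε
  have hε0 : 0 < ε := by positivity
  have hε1 : ε < 1 := by linarith
  set δ' := ε ^ 2 * (1 - ε)
  have hδ' : 0 < δ' := mul_pos (by positivity) (by linarith)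
  have t1 : Filter.Tendsto (fun n : ℕ => Real.log n) Filter.atTop Filter.atTop :=
    Real.tendsto_log_atTop.comp tendsto_natCast_atTop_atTop
  have t2 : Filter.Tendsto (fun n : ℕ => Real.log n / n) Filter.atTop (nhds 0) := by
    have := (Real.isLittleO_log_id_atTop.tendsto_div_nhds_zero).comp (tendsto_natCast_atTop_atTop (R := ℝ))
    simpa [Function.comp_def] using this
  have ev1 := t1.eventually_ge_atTop (2 + 3 / η * (ε * Cd (ε ^ 2)))
  have ev3 := t1.eventually_ge_atTop 2
  have ev2 := t2.eventually_lt_const (show (0 : ℝ) < δ' / 2 by positivity)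
  have ev4 := Filter.eventually_ge_atTop 1
  obtain ⟨N, hN⟩ := Filter.eventually_atTop.mp (ev1.and (ev2.and (ev3.and ev4)))
  refine ⟨N, fun n hn D F hF hind => ?_⟩
  obtain ⟨g1, g2, g3, g4⟩ := hN n hn
  have hn0 : (0 : ℝ) < n := by exact_mod_cast g4
  by_contra! hcon
  set a := dn D F
  have hq : 1 / (n : ℝ) ≤ (1 + η) / 2 * (Real.log n / n) := by
    rw [← mul_div_assoc]
    apply div_le_div_of_nonneg_right _ hn0.le
    nlinarith
  have ha : 1 / (n : ℝ) < a := lt_of_le_of_lt hq hcon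
  have hapos : 0 < a := lt_trans (by positivity) ha
  have hlog : - Real.log a ≤ Real.log n := by
    have := Real.log_le_log (by positivity) ha.le
    rw [one_div, Real.log_inv] at this
    linarith
  have hna : (1 + η) / 2 * Real.log n < n * a := by
    have := mul_lt_mul_of_pos_left hcon hn0
    have e : (n : ℝ) * ((1 + η) / 2 * (Real.log n / n)) = (1 + η) / 2 * Real.log n := by field_simp
    linarith
  by_cases hs : a ≤ δ'
  · have := local_bound hF hind hε0 hε1 hapos hs
    have x1 : (1 + η) / 2 * Real.log n * (2 - ε) < n * a * (2 - ε) := by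
      apply mul_lt_mul_of_pos_right hna; linarith
    have x2 : -Real.log a * (1 + ε) ≤ Real.log n * (1 + ε) :=
      mul_le_mul_of_nonneg_right hlog (by linarith)
    have x3 : Real.log n * ((1 + η) / 2 * (2 - ε) - (1 + ε)) < ε * Cd (ε ^ 2) := by
      change n * a * (2 - ε) ≤ -Real.log a * (1 + ε) + _ at this
      linarith
    have x4 : η / 3 ≤ (1 + η) / 2 * (2 - ε) - (1 + ε) := by rw [hε]; nlinarith
    have x5 : Real.log n * (η / 3) ≤ Real.log n * ((1 + η) / 2 * (2 - ε) - (1 + ε)) :=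
      mul_le_mul_of_nonneg_left x4 (by linarith)
    have x6 := mul_le_mul_of_nonneg_right g1 (show 0 ≤ η / 3 by positivity)
    have x7 : (2 + 3 / η * (ε * Cd (ε ^ 2))) * (η / 3) = 2 * (η / 3) + ε * Cd (ε ^ 2) := by
      field_simp
    linarith
  · push Not at hs
    have := local_bound1 hF hind hapos
    have hl2 : Real.log 2 < 1 := by
      have := Real.log_two_lt_d9; linarith
    rw [div_lt_iff₀ hn0] at g2
    have : n * a ≤ 1 + Real.log 2 - Real.log a := this
    have h9 : δ' * n < n * a := by nlinarith
    nlinarith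

end BFC
end

section
open scoped symmDiff

namespace BFC

noncomputable def ub : Measure Bool := wm (fun _ => (1/2 : ℝ))

instance : IsProbabilityMeasure ub := wm_prob (fun _ => by norm_num) (by simp)

lemma ub_real (b : Bool) : ub.real {b} = 1 / 2 := wm_real (fun _ => by norm_num) b

section
variable {n : ℕ}

lemma PM_dn {D : Finset (FG n)} {F : (FG n → Bool) → Bool} (hF : Dep (D : Set (FG n)) F) :
    (PM n ub).real {x | F x = true} = dn D F := by
  have := lw_dep ub false hF true
  simp only [ub_real] at this
  exact this

lemma bern_eq {β : Measure (FG n → Bool)} [IsProbabilityMeasure β] (hβ : IsBernoulliMeasure β) :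
    β = PM n ub := by
  apply Measure.eq_infinitePi
  intro s t ht
  rw [← Measure.infinitePi_pi (μ := fun _ : FG n => ub) (fun i _ => ht i)]
  classical
  set F : (FG n → Bool) → Bool := fun x => decide (x ∈ Set.pi (s : Set (FG n)) t)
  have hF : Dep (s : Set (FG n)) F := by
    intro x y h
    simp only [F, Set.mem_pi]
    congr 1
    refine propext (forall₂_congr fun d hd => ?_)
    rw [h d hd]
  have hset : Set.pi (s : Set (FG n)) t = {x | F x = true} := by ext; simp [F]
  have e1 := PM_dn hF
  have hX : Dm (fun (x : FG n → Bool) (d : s) => x d) := by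
    apply Dep.dm (D := s)
    intro x y h; funext d; exact h d d.2
  have e : F = (fun c : s → Bool => F (extd false c)) ∘ (fun x d => x d) := by
    funext x; simp only [Function.comp]; rw [hF.extd]
  have e2 := lw_comp (P := β) hX (fun c : s → Bool => F (extd false c)) true
  rw [← e] at e2
  have e3 : β.real {x | F x = true} = dn s F := by
    change lw β F true = _
    rw [e2, Finset.sum_filter, dn]
    refine Finset.sum_congr rfl fun c _ => ?_
    split_ifs with h
    · rw [mul_one, lw]
      have := hβ s (extd false c)
      have h2 : ((fun (x : FG n → Bool) (d : s) => x d) ⁻¹' {c}) = {x | ∀ δ ∈ s, x δ = extd false c δ} := by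
        ext x
        simp only [Set.mem_preimage, Set.mem_singleton_iff, funext_iff, Set.mem_ofPred_eq, Subtype.forall]
        refine forall₂_congr fun v hv => ?_
        rw [extd_mem' _ _ hv]
      rw [h2, measureReal_def, this]
      simp
    · rw [mul_zero]
  rw [hset]
  rw [← e1] at e3
  exact (ENNReal.toReal_eq_toReal_iff' (measure_ne_top _ _) (measure_ne_top _ _)).mp e3

lemma ae_free : ∀ᵐ x ∂(PM n ub), x ∈ freePart (FG n) := by
  have : Countable (FG n) := inferInstance
  change ∀ᵐ x ∂(PM n ub), ∀ γ : FG n, γ ≠ 1 → bernoulliShift γ x ≠ x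
  rw [ae_all_iff]
  intro γ
  by_cases hγ : γ = 1
  · exact Filter.Eventually.of_forall fun x h => absurd hγ h
  have hinj : Function.Injective (fun i : ℕ => γ ^ i) := by
    intro i j hij
    have : γ ^ ((i : ℤ) - j) = 1 := by
      rw [zpow_sub]; simp only at hij; simp [hij]
    rw [IsMulTorsionFree.zpow_eq_one_iff_right hγ] at this
    omega
  have hz : (PM n ub).real {x | bernoulliShift γ x = x} = 0 := by
    classical
    have hb : ∀ N : ℕ, (PM n ub).real {x | bernoulliShift γ x = x} ≤ 2 * (1 / 2 : ℝ) ^ N := by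
      intro N
      set V := (Finset.range N).image (fun i : ℕ => γ ^ i) with hV
      have hc : V.card = N := by rw [hV, Finset.card_image_of_injective _ hinj, Finset.card_range]
      have hsub : {x | bernoulliShift γ x = x} ⊆
          {x : FG n → Bool | ∀ v ∈ V, x v = (fun _ => true) v} ∪ {x : FG n → Bool | ∀ v ∈ V, x v = (fun _ => false) v} := by
        intro x hx
        have hx1 : ∀ i : ℕ, x (γ ^ i) = x 1 := by
          intro i
          induction i with
          | zero => simp
          | succ i ih =>
            have := congrFun hx (γ ^ i)
            rw [bernoulliShift, ← pow_succ] at this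
            rw [this, ih]
        cases h : x 1
        · right
          intro v hv
          obtain ⟨i, _, rfl⟩ := Finset.mem_image.mp hv
          rw [hx1, h]
        · left
          intro v hv
          obtain ⟨i, _, rfl⟩ := Finset.mem_image.mp hv
          rw [hx1, h]
      refine (measureReal_mono hsub (measure_ne_top _ _)).trans ((measureReal_union_le _ _).trans (le_of_eq ?_))
      rw [cyl, cyl]
      simp only [ub_real, Finset.prod_const, hc]
      ring
    have t : Filter.Tendsto (fun N : ℕ => 2 * (1 / 2 : ℝ) ^ N) Filter.atTop (nhds (2 * 0)) :=
      (tendsto_pow_atTop_nhds_zero_of_lt_one (by norm_num) (by norm_num)).const_mul 2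
    rw [mul_zero] at t
    exact le_antisymm (ge_of_tendsto' t hb) measureReal_nonneg
  have hz' : (PM n ub) {x | bernoulliShift γ x = x} = 0 := by
    rwa [measureReal_eq_zero_iff] at hz
  have h9 : ∀ᵐ x ∂(PM n ub), ¬ (bernoulliShift γ x = x) := by
    rw [ae_iff]; simpa using hz'
  filter_upwards [h9] with x hx _ using hx

lemma borel_max {η : ℝ} (h0 : 0 < η) (h1 : η ≤ 1) : ∃ N : ℕ, ∀ n ≥ N, ∀ (I : Set (FG n → Bool)),
    MeasurableSet I → I ⊆ freePart (FG n) → IndepIn (freeGroupSchreierAdj n) I →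
    (PM n ub).real I ≤ (1 + η) / 2 * (Real.log n / n) := by
  classical
  obtain ⟨N, hN⟩ := local_max h0 h1
  refine ⟨N, fun n hn I hI hfree hind => ?_⟩
  have hdisj : ∀ x ∈ I, ∀ i : Fin n, sh (FreeGroup.of i) x ∉ I := by
    intro x hx i hy
    refine hind x hx _ hy ⟨hfree hx, hfree hy, ?_, i, Or.inl rfl⟩
    intro h
    exact hfree hx (FreeGroup.of i) (FreeGroup.of_ne_one i) h.symm
  apply le_of_forall_pos_le_add
  intro ε hε
  set ε' := ε / (n + 1) with hε'
  have hε'0 : 0 < ε' := by positivity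
  obtain ⟨C, hC, hCI⟩ := exists_measure_symmDiff_lt_of_generateFrom_isSetRing (μ := PM n ub)
    (isSetRing_measurableCylinders (α := fun _ : FG n => Bool))
    ⟨{Set.univ}, Set.countable_singleton _, by
      simpa using univ_mem_measurableCylinders (fun _ : FG n => Bool), by simp⟩
    generateFrom_measurableCylinders.symm hI (ENNReal.ofReal_pos.mpr hε'0)
  obtain ⟨D, S, hS, rfl⟩ := (mem_measurableCylinders _).mp hC
  set C := cylinder (α := fun _ : FG n => Bool) D S with hCdef
  have hCm : MeasurableSet C := MeasurableSet.of_mem_measurableCylinders hC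
  have hCdep : Dep (D : Set (FG n)) (fun x => x ∈ C) := by
    intro x y h
    simp only [hCdef, mem_cylinder]
    have : Finset.restrict (π := fun _ : FG n => Bool) D x = Finset.restrict (π := fun _ : FG n => Bool) D y := by
      funext d
      exact h d d.2
    rw [this]
  have hsd : (PM n ub).real (C ∆ I) ≤ ε' := by
    rw [measureReal_def]
    exact ENNReal.toReal_le_of_le_ofReal hε'0.le hCI.le
  set F : (FG n → Bool) → Bool := fun x => decide (x ∈ C ∧ ∀ i : Fin n, sh (FreeGroup.of i) x ∉ C) with hF
  set D' := D ∪ Finset.univ.biUnion (fun i : Fin n => rt D (FreeGroup.of i)) with hD'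
  have hFdep : Dep (D' : Set (FG n)) F := by
    intro x y h
    have a1 : (x ∈ C) = (y ∈ C) := hCdep x y fun d hd => h d (by simp [hD', Finset.mem_coe.mp hd])
    have a2 : ∀ i : Fin n, (sh (FreeGroup.of i) x ∈ C) = (sh (FreeGroup.of i) y ∈ C) := by
      intro i
      apply hCdep
      intro d hd
      apply h
      simp only [hD', Finset.coe_union, Set.mem_union, Finset.mem_coe, Finset.mem_biUnion]
      exact Or.inr ⟨i, Finset.mem_univ _, mem_rt.mpr ⟨d, hd, rfl⟩⟩
    simp only [hF, a1, a2]
  have hFind : ∀ x i, ¬ (F x = true ∧ F (sh (FreeGroup.of i) x) = true) := by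
    rintro x i ⟨h1, h2⟩
    simp only [hF, decide_eq_true_eq] at h1 h2
    exact h1.2 i h2.1
  have hmax := hN n hn D' F hFdep hFind
  rw [← PM_dn hFdep] at hmax
  have hsub : I ⊆ {x | F x = true} ∪ ((C ∆ I) ∪ ⋃ i : Fin n, sh (FreeGroup.of i) ⁻¹' (C ∆ I)) := by
    intro x hx
    by_cases hxC : x ∈ C
    · by_cases hall : ∀ i : Fin n, sh (FreeGroup.of i) x ∉ C
      · left; simp [hF, hxC, hall]
      · right; right
        push Not at hall
        obtain ⟨i, hi⟩ := hall
        exact Set.mem_iUnion.mpr ⟨i, Or.inl ⟨hi, hdisj x hx i⟩⟩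
    · right; left; exact Or.inr ⟨hx, hxC⟩
  have hm : ∀ i : Fin n, (PM n ub).real (sh (FreeGroup.of i) ⁻¹' (C ∆ I)) = (PM n ub).real (C ∆ I) := fun i =>
    (sh_mp ub _).measureReal_preimage (hCm.symmDiff hI).nullMeasurableSet
  calc (PM n ub).real I ≤ _ := measureReal_mono hsub (measure_ne_top _ _)
    _ ≤ _ := measureReal_union_le _ _
    _ ≤ (1 + η) / 2 * (Real.log n / n) + (ε' + ∑ i : Fin n, ε') := by
        refine add_le_add hmax ((measureReal_union_le _ _).trans (add_le_add hsd ?_))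
        refine (measureReal_iUnion_fintype_le _).trans (Finset.sum_le_sum fun i _ => ?_)
        rw [hm]; exact hsd
    _ = _ := by
        simp [hε']; field_simp; ring

lemma lower_part {η : ℝ} (h0 : 0 < η) (h1 : η ≤ 1) : ∃ N : ℕ, ∀ n ≥ N, ∀ (k ℓ : ℕ)
    (I : Fin ℓ → Set (FG n → Bool)), 1 ≤ k → 
    (∀ i, MeasurableSet (I i) ∧ I i ⊆ freePart (FG n) ∧ IndepIn (freeGroupSchreierAdj n) (I i)) →
    (∀ x ∈ freePart (FG n), k ≤ Nat.card {i : Fin ℓ // x ∈ I i}) →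
    (k : ℝ) ≤ ℓ * ((1 + η) / 2 * (Real.log n / n)) := by
  classical
  obtain ⟨N, hN⟩ := borel_max h0 h1
  refine ⟨N, fun n hn k ℓ I hk hI hcov => ?_⟩
  have hle : (k : ENNReal) ≤ ∑ i, PM n ub (I i) := by
    calc (k : ENNReal) = ∫⁻ _x, (k : ENNReal) ∂(PM n ub) := by simp
      _ ≤ ∫⁻ x, ∑ i, (I i).indicator 1 x ∂(PM n ub) := by
        apply lintegral_mono_ae
        filter_upwards [ae_free (n := n)] with x hx
        have := hcov x hx
        have e : (∑ i, (I i).indicator 1 x : ENNReal) = (Nat.card {i : Fin ℓ // x ∈ I i} : ENNReal) := by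
          rw [Nat.card_eq_fintype_card, Fintype.card_subtype]
          simp [Set.indicator_apply]
        rw [e]
        exact_mod_cast this
      _ = ∑ i, ∫⁻ x, (I i).indicator 1 x ∂(PM n ub) := by
        apply lintegral_finsetSum
        intro i _
        exact measurable_one.indicator (hI i).1
      _ = _ := by
        refine Finset.sum_congr rfl fun i _ => ?_
        exact lintegral_indicator_one (hI i).1
  have hr : (k : ℝ) ≤ ∑ i, (PM n ub).real (I i) := by
    have := ENNReal.toReal_mono (by simp) hle
    rw [ENNReal.toReal_sum (fun i _ => measure_ne_top _ _)] at this
    simpa [measureReal_def] using this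
  refine hr.trans ((Finset.sum_le_sum fun i _ => hN n hn (I i) (hI i).1 (hI i).2.1 (hI i).2.2).trans ?_)
  simp

end
end BFC
end

section
open MeasureTheory ProbabilityTheory

namespace BFC

section indep
variable {n : ℕ} {L : Type*} [MeasurableSpace L] [Fintype L] [MeasurableSingletonClass L]

lemma dep_meas {D : Finset (FG n)} {A : (FG n → L) → Prop} (hA : Dep (D : Set (FG n)) A) :
    MeasurableSet {x | A x} := by
  have := hA.measurable {True}
  convert this using 1
  ext x; simp

lemma Dep.mono {B : Type*} {D D' : Set (FG n)} {f : (FG n → L) → B} (h : Dep D f) (hD : D ⊆ D') : Dep D' f :=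
  fun x y hxy => h x y fun d hd => hxy d (hD hd)

lemma indep2 (μ : Measure L) [IsProbabilityMeasure μ] {D D' : Finset (FG n)} (hd : Disjoint D D')
    {A B : (FG n → L) → Prop} (hA : Dep (D : Set (FG n)) A) (hB : Dep (D' : Set (FG n)) B) :
    (PM n μ).real {x | A x ∧ B x} = (PM n μ).real {x | A x} * (PM n μ).real {x | B x} := by
  have : Nonempty L := μ.nonempty_of_neZero
  obtain ⟨l0⟩ := this
  have hi : iIndepFun (fun (i : FG n) (ω : FG n → L) => ω i) (PM n μ) :=
    iIndepFun_infinitePi (X := fun _ ω => ω) (fun _ => measurable_id)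
  have h2 := hi.indepFun_finset D D' hd (fun i => measurable_pi_apply i)
  have hAe : {x | A x} = (fun (ω : FG n → L) (i : D) => ω i) ⁻¹' {c | A (extd l0 c)} := by
    ext x; simp only [Set.mem_ofPred_eq, Set.mem_preimage]; rw [hA.extd]
  have hBe : {x | B x} = (fun (ω : FG n → L) (i : D') => ω i) ⁻¹' {c | B (extd l0 c)} := by
    ext x; simp only [Set.mem_ofPred_eq, Set.mem_preimage]; rw [hB.extd]
  have := h2.measure_inter_preimage_eq_mul {c | A (extd l0 c)} {c | B (extd l0 c)}
    (Set.toFinite _).measurableSet (Set.toFinite _).measurableSet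
  rw [← hAe, ← hBe] at this
  simp only [measureReal_def]
  rw [← ENNReal.toReal_mul, ← this]
  rfl

lemma indep_many (μ : Measure L) [IsProbabilityMeasure μ] {J : Type*} [DecidableEq J] (D : J → Finset (FG n))
    (hd : ∀ i j, i ≠ j → Disjoint (D i) (D j)) (A : J → (FG n → L) → Prop)
    (hA : ∀ j, Dep (D j : Set (FG n)) (A j)) (S : Finset J) :
    (PM n μ).real {x | ∀ j ∈ S, A j x} = ∏ j ∈ S, (PM n μ).real {x | A j x} := by
  classical
  induction S using Finset.induction_on with
  | empty => simp
  | insert j S hj ih =>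
    rw [Finset.prod_insert hj, ← ih, ← indep2 μ (D := D j) (D' := S.biUnion D) ?_ (hA j) ?_]
    · congr 1; ext x; simp
    · rw [Finset.disjoint_biUnion_right]
      intro i hi
      exact hd j i (by rintro rfl; exact hj hi)
    · intro x y h
      refine propext (forall₂_congr fun i hi => ?_)
      rw [hA i x y]
      intro d hd
      exact h d (by simp only [Finset.coe_biUnion, Set.mem_iUnion]; exact ⟨i, hi, hd⟩)

end indep

section greedy
variable {n M : ℕ}

/-- greedy recursion -/
def Kg : ℕ → (Fin n × Bool) → (FG n → Fin M) → Prop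
  | 0, _, _ => False
  | j + 1, t, Λ => Kg j t Λ ∨ ((Λ 1 : ℕ) = j ∧ ∀ t', t' ≠ iv t → ¬ Kg j t' (sh (el t') Λ))

def Evi (i : Fin M) (Λ : FG n → Fin M) : Prop :=
  Λ 1 = i ∧ ∀ t, Λ (el t) ≠ i ∧ ¬ Kg i t (sh (el t) Λ)

def Ev (Λ : FG n → Fin M) : Prop := ∃ i : Fin M, Evi i Λ

lemma Kg_mono {j j' : ℕ} (h : j ≤ j') (t : Fin n × Bool) (Λ : FG n → Fin M) (hK : Kg j t Λ) : Kg j' t Λ := by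
  induction j', h using Nat.le_induction with
  | base => exact hK
  | succ j' _ ih => exact Or.inl ih

lemma Kg_lt {j : ℕ} (t : Fin n × Bool) (Λ : FG n → Fin M) (hK : Kg j t Λ) : (Λ 1 : ℕ) < j := by
  induction j with
  | zero => exact hK.elim
  | succ j ih =>
    rcases hK with h | h
    · exact (ih h).trans (Nat.lt_succ_self j)
    · omega

lemma Ev_half (t : Fin n × Bool) (Λ : FG n → Fin M) (h1 : Ev Λ) (h2 : Ev (sh (el t) Λ)) :
    ¬ ((sh (el t) Λ) 1 < Λ 1) := by
  intro hlt
  obtain ⟨i, h1a, h1b⟩ := h1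
  obtain ⟨i', h2a, h2b⟩ := h2
  rw [h1a, h2a] at hlt
  apply (h1b t).2
  have : Kg ((i' : ℕ) + 1) t (sh (el t) Λ) := Or.inr ⟨by rw [h2a], fun t' _ => (h2b t').2⟩
  exact Kg_mono (Nat.succ_le_of_lt hlt) _ _ this

lemma Ev_indep (t : Fin n × Bool) (Λ : FG n → Fin M) : ¬ (Ev Λ ∧ Ev (sh (el t) Λ)) := by
  rintro ⟨h1, h2⟩
  have a := Ev_half t Λ h1 h2
  have e : sh (el (iv t)) (sh (el t) Λ) = Λ := by
    rw [sh_sh_s4, el_iv, inv_mul_cancel, sh_one_s4]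
  have b := Ev_half (iv t) (sh (el t) Λ) h2 (by rw [e]; exact h1)
  rw [e] at b
  have hne : (sh (el t) Λ) 1 ≠ Λ 1 := by
    obtain ⟨i, h1a, h1b⟩ := h1
    rw [h1a]
    have := (h1b t).1
    simpa [sh] using this
  rcases lt_trichotomy ((sh (el t) Λ) 1) (Λ 1) with h | h | h
  exacts [a h, hne h, b h]

lemma shift_dep {L B : Type*} {D : Finset (FG n)} {f : (FG n → L) → B} (h : Dep (D : Set (FG n)) f) (τ : FG n) :
    Dep (rt D τ : Set (FG n)) (fun x => f (sh τ x)) := by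
  intro x y hxy
  apply h
  intro d hd
  exact hxy _ (mem_rt.mpr ⟨d, hd, rfl⟩)

lemma Kg_dep (j : ℕ) : ∀ t : Fin n × Bool, ∃ D : Finset (FG n), (∀ δ ∈ D, rl δ ≠ some t) ∧
    Dep (D : Set (FG n)) (Kg j t : (FG n → Fin M) → Prop) := by
  classical
  induction j with
  | zero => exact fun t => ⟨∅, by simp, fun _ _ _ => rfl⟩
  | succ j ih =>
    choose D hD hdep using ih
    intro t
    refine ⟨D t ∪ ({1} ∪ (Finset.univ.filter (fun t' => t' ≠ iv t)).biUnion (fun t' => rt (D t') (el t'))), ?_, ?_⟩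
    · intro δ hδ
      simp only [Finset.mem_union, Finset.mem_singleton, Finset.mem_biUnion, Finset.mem_filter,
        Finset.mem_univ, true_and] at hδ
      rcases hδ with h | rfl | ⟨t', ht', h⟩
      · exact hD t δ h
      · simp
      · obtain ⟨w, hw, rfl⟩ := mem_rt.mp h
        rw [rl_mul t' w (hD t' w hw)]
        intro he
        apply ht'
        rw [← Option.some.inj he, iv_iv]
    · intro x y h
      have a1 : Kg j t x = Kg j t y := hdep t x y fun d hd => h d (by simp [Finset.mem_coe.mp hd])
      have a2 : x 1 = y 1 := h 1 (by simp)
      have a3 : ∀ t', t' ≠ iv t → Kg j t' (sh (el t') x) = Kg j t' (sh (el t') y) := by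
        intro t' ht'
        refine shift_dep (hdep t') (el t') x y fun d hd => h d ?_
        simp only [Finset.coe_union, Set.mem_union, Finset.mem_coe, Finset.mem_biUnion, Finset.mem_filter,
        Finset.mem_univ, true_and]
        exact Or.inr (Or.inr ⟨t', ht', hd⟩)
      simp only [Kg, a1, a2]
      congr 2
      refine propext (forall₂_congr fun t' ht' => ?_)
      rw [a3 t' ht']

/-- windows for the shifted events -/
lemma Kg_win (j : ℕ) : ∃ W : (Fin n × Bool) → Finset (FG n), (∀ t, ∀ δ ∈ W t, rl δ = some (iv t)) ∧
    ∀ t, Dep (W t : Set (FG n)) (fun Λ : FG n → Fin M => Kg j t (sh (el t) Λ)) := by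
  choose D hD hdep using Kg_dep (n := n) (M := M) j
  refine ⟨fun t => rt (D t) (el t), fun t δ hδ => ?_, fun t => shift_dep (hdep t) (el t)⟩
  obtain ⟨w, hw, rfl⟩ := mem_rt.mp hδ
  exact rl_mul t w (hD t w hw)

lemma el_ne_one (t : Fin n × Bool) : el t ≠ 1 := by
  intro h
  have := rl_mul t 1 (by simp)
  rw [one_mul, h] at this
  simp at this

lemma Ev_dep : ∃ D : Finset (FG n), Dep (D : Set (FG n)) (Ev : (FG n → Fin M) → Prop) := by
  classical
  choose W _ hW using fun j => Kg_win (n := n) (M := M) j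
  refine ⟨{1} ∪ Finset.univ.biUnion (fun i : Fin M => Finset.univ.biUnion (fun t => insert (el t) (W i t))), ?_⟩
  intro x y h
  have a1 : x 1 = y 1 := h 1 (by simp)
  refine propext (exists_congr fun i => ?_)
  unfold Evi
  rw [a1]
  refine and_congr_right fun _ => forall_congr' fun t => ?_
  have a2 : x (el t) = y (el t) := h _ (by
    simp only [Finset.coe_union, Set.mem_union, Finset.mem_coe, Finset.mem_biUnion, Finset.mem_univ, true_and]
    exact Or.inr ⟨i, t, Finset.mem_insert_self _ _⟩)
  have a3 := hW i t x y fun d hd => h d (by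
    simp only [Finset.coe_union, Set.mem_union, Finset.mem_coe, Finset.mem_biUnion, Finset.mem_univ, true_and]
    exact Or.inr ⟨i, t, Finset.mem_insert_of_mem hd⟩)
  simp only at a3
  rw [a2, a3]

noncomputable def mu (M : ℕ) : Measure (Fin M) := wm (fun _ => (1 / M : ℝ))

lemma mu_real (i : Fin M) : (mu M).real {i} = 1 / M := wm_real (fun _ => by positivity) i

lemma mu_prob (hM : 0 < M) : IsProbabilityMeasure (mu M) :=
  wm_prob (fun _ => by positivity) (by simp; field_simp)

noncomputable def Qs (n M : ℕ) : ℕ → ℝ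
  | 0 => 0
  | j + 1 => Qs n M j + (1 / M) * (1 - Qs n M j) ^ (2 * n - 1)

lemma lab_real (hM : 0 < M) (i : Fin M) : (PM n (mu M)).real {Λ | Λ 1 = i} = 1 / M := by
  have := mu_prob hM
  have := cyl (mu M) {(1 : FG n)} (fun _ => i)
  simpa [mu_real] using this

/-- joint probability of a label at the root and no occupied children -/
lemma child_prob (hM : 0 < M) (j : ℕ) (i : Fin M) (q : ℝ)
    (hq : ∀ t : Fin n × Bool, (PM n (mu M)).real {Λ | Kg j t Λ} = q) (S : Finset (Fin n × Bool)) :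
    (PM n (mu M)).real {Λ | Λ 1 = i ∧ ∀ t' ∈ S, ¬ Kg j t' (sh (el t') Λ)} = 1 / M * (1 - q) ^ S.card := by
  classical
  have := mu_prob hM
  obtain ⟨W, hW, hdep⟩ := Kg_win (n := n) (M := M) j
  have hnot : ∀ t, Dep (W t : Set (FG n)) (fun Λ : FG n → Fin M => ¬ Kg j t (sh (el t) Λ)) :=
    fun t x y h => by simp only [hdep t x y h]
  have hp : ∀ t, (PM n (mu M)).real {Λ | ¬ Kg j t (sh (el t) Λ)} = 1 - q := by
    intro t
    obtain ⟨D, _, hD⟩ := Kg_dep (M := M) j t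
    have e : {Λ : FG n → Fin M | ¬ Kg j t (sh (el t) Λ)} = (sh (el t) ⁻¹' {Λ | Kg j t Λ})ᶜ := rfl
    rw [e, probReal_compl_eq_one_sub (measurable_sh _ (dep_meas hD)),
      (sh_mp (mu M) _).measureReal_preimage (dep_meas hD).nullMeasurableSet, hq]
  rw [indep2 (mu M) (D := {1}) (D' := S.biUnion W) ?_ (A := fun Λ => Λ 1 = i)
    (B := fun Λ => ∀ t' ∈ S, ¬ Kg j t' (sh (el t') Λ))]
  · rw [lab_real hM, indep_many (mu M) W ?_ _ hnot]
    · simp only [hp]; simp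
    · intro s t hst
      rw [Finset.disjoint_left]
      intro δ h1 h2
      have := (hW s δ h1).symm.trans (hW t δ h2)
      apply hst
      rw [← iv_iv s, Option.some.inj this, iv_iv]
  · intro x y h; simp only [h 1 (by simp)]
  · intro x y h
    refine propext (forall₂_congr fun t ht => ?_)
    have := hnot t x y fun d hd => h d (by
      simp only [Finset.coe_biUnion, Set.mem_iUnion]; exact ⟨t, ht, hd⟩)
    simp only at this
    rw [this]
  · rw [Finset.disjoint_singleton_left]
    intro h
    obtain ⟨t, _, ht⟩ := Finset.mem_biUnion.mp h
    have := hW t 1 ht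
    simp at this

lemma Kg_prob (hM : 0 < M) (j : ℕ) (hj : j ≤ M) : ∀ t : Fin n × Bool,
    (PM n (mu M)).real {Λ | Kg j t Λ} = Qs n M j := by
  classical
  induction j with
  | zero => intro t; simp [Kg, Qs]
  | succ j ih =>
    have ih' := ih (by omega)
    intro t
    have := mu_prob hM
    have e : {Λ : FG n → Fin M | Kg (j+1) t Λ} = {Λ | Kg j t Λ} ∪
        {Λ | Λ 1 = ⟨j, by omega⟩ ∧ ∀ t' ∈ (Finset.univ.erase (iv t)), ¬ Kg j t' (sh (el t') Λ)} := by
      ext Λ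
      simp [Kg, Fin.ext_iff]
    obtain ⟨D, _, hD⟩ := Kg_dep (M := M) j t
    obtain ⟨D', _, hD'⟩ := Kg_dep (M := M) (j+1) t
    rw [e, measureReal_union' _ (dep_meas hD), ih' t, child_prob hM j _ _ ih', Qs]
    · congr 3
      rw [Finset.card_erase_of_mem (Finset.mem_univ _)]
      simp [mul_comm]
    · rw [Set.disjoint_left]
      rintro Λ h1 ⟨h2, _⟩
      have := Kg_lt t Λ h1
      rw [h2] at this
      simp at this

lemma Ev_prob (hM : 0 < M) :
    ∑ j ∈ Finset.range M, 1 / M * (1 - Qs n M j) ^ (2 * n) - 2 * n / M ≤ (PM n (mu M)).real {Λ | Ev Λ} := by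
  classical
  have := mu_prob hM
  have hmeas : ∀ i : Fin M, MeasurableSet {Λ : FG n → Fin M | Evi i Λ} := by
    intro i
    obtain ⟨D, hD⟩ := Ev_dep (n := n) (M := M)
    have : {Λ : FG n → Fin M | Evi i Λ} = {Λ | Ev Λ} ∩ {Λ | Λ 1 = i} := by
      ext Λ
      constructor
      · exact fun h => ⟨⟨i, h⟩, h.1⟩
      · rintro ⟨⟨i', h⟩, h2⟩
        have : i' = i := h.1.symm.trans h2
        rwa [this] at h
    rw [this]
    exact (dep_meas hD).inter (dep_meas (D := {1}) (A := fun Λ => Λ 1 = i) (fun x y h => by simp only [h 1 (by simp)]))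
  have e : {Λ : FG n → Fin M | Ev Λ} = ⋃ i ∈ (Finset.univ : Finset (Fin M)), {Λ | Evi i Λ} := by
    ext; simp [Ev]
  rw [e, measureReal_biUnion_finset]
  · rw [← Fin.sum_univ_eq_sum_range (fun j => 1 / (M : ℝ) * (1 - Qs n M j) ^ (2 * n)) M]
    have : (2 * n / M : ℝ) = ∑ i : Fin M, 2 * n / M * (1 / M : ℝ) := by simp; field_simp
    rw [this, ← Finset.sum_sub_distrib]
    refine Finset.sum_le_sum fun i _ => ?_
    rw [sub_le_iff_le_add]
    have c := child_prob hM i i _ (Kg_prob (n := n) hM i i.2.le) Finset.univ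
    simp only [Finset.card_univ, Fintype.card_prod, Fintype.card_fin, Fintype.card_bool, mul_comm n 2] at c
    rw [← c]
    have hsub : {Λ : FG n → Fin M | Λ 1 = i ∧ ∀ t' ∈ Finset.univ, ¬ Kg i t' (sh (el t') Λ)} ⊆
        {Λ | Evi i Λ} ∪ ⋃ t : Fin n × Bool, {Λ | ∀ v ∈ ({1, el t} : Finset (FG n)), Λ v = (fun _ => i) v} := by
      rintro Λ ⟨h1, h2⟩
      by_cases h : ∀ t, Λ (el t) ≠ i
      · left; exact ⟨h1, fun t => ⟨h t, h2 t (Finset.mem_univ t)⟩⟩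
      · right
        push Not at h
        obtain ⟨t, ht⟩ := h
        refine Set.mem_iUnion.mpr ⟨t, ?_⟩
        simp [h1, ht]
    refine (measureReal_mono hsub (measure_ne_top _ _)).trans ((measureReal_union_le _ _).trans ?_)
    refine add_le_add le_rfl ((measureReal_iUnion_fintype_le _).trans (le_of_eq ?_))
    simp only [cyl, mu_real]
    have : ∀ t : Fin n × Bool, ∏ _v ∈ ({1, el t} : Finset (FG n)), (1 / M : ℝ) = 1 / M * (1 / M) := by
      intro t
      rw [Finset.prod_pair (el_ne_one t).symm]
    simp only [this]
    simp
    ring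
  · intro i _ j _ hij
    refine Set.disjoint_left.mpr fun Λ h1 h2 => hij (h1.1.symm.trans h2.1)
  · intro i _; exact hmeas i

end greedy
end BFC
end

section
namespace BFC

section ana
variable {n M : ℕ}

lemma Y_rec (j : ℕ) : 1 - Qs n M (j+1) = (1 - Qs n M j) - (1/M) * (1 - Qs n M j)^(2*n-1) := by
  rw [Qs]; ring

lemma Y_bd (hn : 2 ≤ n) (hM : 2 ≤ M) (j : ℕ) : 0 < 1 - Qs n M j ∧ 1 - Qs n M j ≤ 1 := by
  induction j with
  | zero => simp [Qs]
  | succ j ih =>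
    obtain ⟨h0, h1⟩ := ih
    rw [Y_rec]
    set y := 1 - Qs n M j
    have hM' : (1 / M : ℝ) ≤ 1/2 := by
      apply one_div_le_one_div_of_le <;> norm_num; exact_mod_cast hM
    have hM0 : (0:ℝ) ≤ 1 / M := by positivity
    have h2 : y ^ (2*n-1) ≤ y := by
      calc y ^ (2*n-1) ≤ y ^ 1 := pow_le_pow_of_le_one h0.le h1 (by omega)
        _ = y := pow_one y
    have h3 : 0 ≤ y ^ (2*n-1) := by positivity
    constructor
    · nlinarith [mul_le_mul hM' h2 h3 (by norm_num)]
    · nlinarith [mul_nonneg hM0 h3]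

lemma one_sub_pow_mul_le {u : ℝ} (h0 : 0 ≤ u) (h1 : u ≤ 1) (m : ℕ) : (1-u)^m * (1 + m*u) ≤ 1 := by
  have h := one_add_mul_le_pow (a := u) (by linarith) m
  calc (1-u)^m * (1 + m*u) ≤ (1-u)^m * (1+u)^m := by
        apply mul_le_mul_of_nonneg_left h; exact pow_nonneg (by linarith) _
    _ = (1 - u*u)^m := by rw [← mul_pow]; ring
    _ ≤ 1 := pow_le_one₀ (by nlinarith) (by nlinarith)

lemma Y_pow (hn : 2 ≤ n) (hM : 2 ≤ M) (j : ℕ) :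
    (1 - Qs n M j)^(2*n-2) * (1 + j * (2*n-2 : ℕ) / M) ≤ 1 := by
  induction j with
  | zero => simp [Qs]
  | succ j ih =>
    obtain ⟨h0, h1⟩ := Y_bd hn hM j
    rw [Y_rec]
    set y := 1 - Qs n M j
    set m := 2*n-2 with hm
    have hM1 : (2:ℝ) ≤ M := by exact_mod_cast hM
    set u := y^m / M with hu
    have ha : y^m ≤ 1 := pow_le_one₀ h0.le h1
    have ha0 : 0 ≤ y^m := by positivity
    have hu0 : 0 ≤ u := by positivity
    have hu1 : u ≤ 1 := by rw [hu, div_le_one (by linarith)]; linarith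
    have e : y - 1/M * y^(2*n-1) = y * (1-u) := by
      have : 2*n-1 = m+1 := by omega
      rw [this, hu, pow_succ]; ring
    rw [e, mul_pow]
    have := one_sub_pow_mul_le hu0 hu1 m
    have hp : 0 ≤ (1-u)^m := pow_nonneg (by linarith) _
    calc y^m * (1-u)^m * (1 + (j+1 : ℕ) * m / M) = (1-u)^m * (y^m * (1 + j * m/M) + m * u) := by
          rw [hu]; push_cast; ring
      _ ≤ (1-u)^m * (1 + m * u) := by
          apply mul_le_mul_of_nonneg_left _ hp; linarith
      _ ≤ 1 := this

lemma Y_sum (hn : 2 ≤ n) (hM : 2 ≤ M) (K : ℕ) :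
    (1 - (1 - Qs n M K)^2)/2 ≤ ∑ j ∈ Finset.range K, 1 / M * (1 - Qs n M j) ^ (2 * n) := by
  induction K with
  | zero => simp [Qs]
  | succ j ih =>
    rw [Finset.sum_range_succ]
    have e : 1 / (M:ℝ) * (1 - Qs n M j) ^ (2 * n) = (1 - Qs n M j) * ((1 - Qs n M j) - (1 - Qs n M (j+1))) := by
      rw [Y_rec]
      have : 2*n = (2*n-1)+1 := by omega
      rw [this, pow_succ, Nat.add_sub_cancel]; ring
    rw [e]
    nlinarith [sq_nonneg ((1 - Qs n M j) - (1 - Qs n M (j+1)))]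

lemma Y_final (hn : 2 ≤ n) (hM : 2 ≤ M) :
    (Real.log n / n) * (1 - Real.log n / n) ≤ 1 - (1 - Qs n M M)^2 := by
  obtain ⟨h0, h1⟩ := Y_bd hn hM M
  have h := Y_pow hn hM M
  set y := 1 - Qs n M M
  have hM1 : (2:ℝ) ≤ M := by exact_mod_cast hM
  have hn1 : (2:ℝ) ≤ n := by exact_mod_cast hn
  have e : (1 + M * (2*n-2 : ℕ) / M : ℝ) = 2*n-1 := by
    rw [Nat.cast_sub (by omega)]; push_cast; field_simp; ring
  rw [e] at h
  have h2 : (y^2)^n * n ≤ 1 := by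
    rw [← pow_mul]
    have : y^(2*n) ≤ y^(2*n-2) := pow_le_pow_of_le_one h0.le h1 (by omega)
    have h3 : 0 ≤ y^(2*n-2) := by positivity
    nlinarith
  have hlog : n * Real.log (y^2) ≤ - Real.log n := by
    have := Real.log_nonpos (by positivity) h2
    rw [Real.log_mul (by positivity) (by positivity), Real.log_pow] at this
    linarith
  set x := Real.log n / n with hx
  have hx0 : 0 ≤ x := div_nonneg (Real.log_nonneg (by linarith)) (by linarith)
  have h4 : Real.log (y^2) ≤ -x := by
    rw [hx, ← neg_div, le_div_iff₀ (by linarith)]; linarith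
  have h5 : y^2 ≤ Real.exp (-x) := by
    rwa [← Real.log_le_iff_le_exp (by positivity)]
  have h6 : Real.exp (-x) * (1 + x) ≤ 1 := by
    have := Real.add_one_le_exp x
    rw [Real.exp_neg, inv_mul_le_iff₀ (Real.exp_pos _)]; linarith
  have h7 : Real.exp (-x) ≤ 1 - x * (1-x) := by
    have : 0 < 1 + x := by linarith
    by_contra hc
    push Not at hc
    nlinarith [mul_lt_mul_of_pos_right hc this, pow_nonneg hx0 3]
  linarith

lemma upper_local {η : ℝ} (h0 : 0 < η) : ∃ N : ℕ, ∀ n ≥ N, ∃ M : ℕ, 0 < M ∧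
    (1-η)/2 * (Real.log n / n) ≤ (PM n (mu M)).real {Λ | Ev Λ} := by
  have hl : Filter.Tendsto (fun n : ℕ => Real.log n / n) Filter.atTop (nhds 0) := by
    have := (Real.isLittleO_log_id_atTop.tendsto_div_nhds_zero).comp tendsto_natCast_atTop_atTop
    exact this
  have := (hl.eventually_le_const (show (0:ℝ) < η/2 by linarith)).and (Filter.eventually_ge_atTop 2)
  obtain ⟨N, hN⟩ := Filter.eventually_atTop.mp this
  refine ⟨N, fun n hn => ?_⟩
  obtain ⟨hx, hn2⟩ := hN n hn
  have hn1 : (2:ℝ) ≤ n := by exact_mod_cast hn2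
  set x := Real.log n / n with hxd
  have hx0 : 0 < x := div_pos (Real.log_pos (by linarith)) (by linarith)
  obtain ⟨M, hM⟩ := exists_nat_ge (max 2 (8 * n / (η * x)))
  have hM2 : 2 ≤ M := by exact_mod_cast (le_max_left _ _).trans hM
  have hM3 := (le_max_right _ _).trans hM
  refine ⟨M, by omega, ?_⟩
  have hM1 : (2:ℝ) ≤ M := by exact_mod_cast hM2
  refine le_trans ?_ (Ev_prob (n := n) (by omega : 0 < M))
  have h1 := Y_sum hn2 hM2 M
  have h2 := Y_final hn2 hM2
  have h3 : 2 * n / M ≤ η * x / 4 := by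
    rw [div_le_iff₀ (by positivity)] at hM3
    rw [div_le_iff₀ (by positivity)]
    nlinarith
  rw [← hxd] at h2
  nlinarith
end ana
end BFC
end

section
namespace BFC

section col
variable {n : ℕ}

lemma sh_free {x : FG n → Bool} (hx : x ∈ freePart (FG n)) (τ : FG n) : sh τ x ∈ freePart (FG n) := by
  intro γ hγ h
  have h1 : sh γ (sh τ x) = sh τ x := h
  have h2 : sh (τ⁻¹ * γ * τ) x = x := by
    have := congrArg (sh τ⁻¹) h1
    rw [sh_sh_s4, sh_sh_s4, sh_sh_s4] at this
    simpa [sh_one_s4, mul_assoc] using this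
  refine hx (τ⁻¹ * γ * τ) ?_ h2
  intro h3
  apply hγ
  have : γ = τ * (τ⁻¹ * γ * τ) * τ⁻¹ := by group
  rw [this, h3]; simp

lemma free_meas_s4 : MeasurableSet (freePart (FG n)) := by
  have : freePart (FG n) = ⋂ γ : FG n, {x | γ ≠ 1 → sh γ x ≠ x} := by
    ext x; simp only [Set.mem_iInter]; exact Iff.rfl
  rw [this]
  refine MeasurableSet.iInter fun γ => ?_
  by_cases h : γ = 1
  · simp [h]
  · simp only [h, ne_eq, not_false_eq_true, forall_true_left]
    exact (measurableSet_eq_fun (measurable_sh γ) measurable_id).compl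

lemma sep_one (γ : FG n) (hγ : γ ≠ 1) : ∃ f : (FG n → Bool) → ℕ × Bool, Measurable f ∧
    ∀ x ∈ freePart (FG n), f (sh γ x) ≠ f x := by
  classical
  obtain ⟨e, he⟩ := exists_surjective_nat (FG n)
  let p : (FG n → Bool) → ℕ → Prop := fun x k => x (e k * γ) ≠ x (e k) ∨ ∀ j, x (e j * γ) = x (e j)
  have hp : ∀ x, ∃ k, p x k := by
    intro x
    by_cases h : ∀ j, x (e j * γ) = x (e j)
    · exact ⟨0, Or.inr h⟩
    · push Not at h
      obtain ⟨k, hk⟩ := h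
      exact ⟨k, Or.inl hk⟩
  have hm : ∀ k, MeasurableSet {x : FG n → Bool | x (e k * γ) = x (e k)} := fun k =>
    measurableSet_eq_fun (measurable_pi_apply _) (measurable_pi_apply _)
  have hf : Measurable (fun x => Nat.find (hp x)) := by
    refine measurable_find hp fun k => ?_
    have : {x | p x k} = {x | x (e k * γ) = x (e k)}ᶜ ∪ ⋂ j, {x | x (e j * γ) = x (e j)} := by
      ext x; simp [p]
    rw [this]
    exact (hm k).compl.union (MeasurableSet.iInter hm)
  have hg : Measurable (fun q : ℕ × (FG n → Bool) => q.2 (e q.1)) :=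
    measurable_from_prod_countable_right fun k => measurable_pi_apply (e k)
  refine ⟨fun x => (Nat.find (hp x), x (e (Nat.find (hp x)))),
    hf.prodMk (hg.comp (hf.prodMk measurable_id)), fun x hx h => ?_⟩
  simp only [Prod.mk.injEq] at h
  obtain ⟨h1, h2⟩ := h
  rw [h1] at h2
  rcases Nat.find_spec (hp x) with h3 | h3
  · exact h3 h2
  · refine hx γ hγ ?_
    funext δ
    obtain ⟨j, rfl⟩ := he δ
    exact h3 j

lemma sep_all (S : Finset (FG n)) (hS : 1 ∉ S) : ∃ f : (FG n → Bool) → ℕ, Measurable f ∧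
    ∀ x ∈ freePart (FG n), ∀ γ ∈ S, f (sh γ x) ≠ f x := by
  have h := fun γ : S => sep_one γ.1 (fun h => hS (h ▸ γ.2))
  choose f hf hf2 using h
  obtain ⟨e, he⟩ := exists_injective_nat (S → ℕ × Bool)
  refine ⟨fun x => e (fun γ => f γ x), ?_, fun x hx γ hγ h => ?_⟩
  · exact (measurable_of_countable e).comp (measurable_pi_lambda _ hf)
  · exact hf2 ⟨γ, hγ⟩ x hx (congrFun (he h) ⟨γ, hγ⟩)

/-- greedy stages -/
noncomputable def stg (S : Finset (FG n)) {q : ℕ} (m : (S → Fin (q+1)) → Fin (q+1))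
    (f : (FG n → Bool) → ℕ) : ℕ → (FG n → Bool) → Fin (q+1)
  | 0 => fun _ => 0
  | i+1 => fun x => if f x = i then m (fun γ => stg S m f i (sh γ.1 x)) else stg S m f i x

lemma fin_col (S : Finset (FG n)) (hS : 1 ∉ S) (hsym : ∀ γ ∈ S, γ⁻¹ ∈ S) :
    ∃ (q : ℕ) (c : (FG n → Bool) → Fin q), 0 < q ∧ Measurable c ∧
    ∀ x ∈ freePart (FG n), ∀ γ ∈ S, c (sh γ x) ≠ c x := by
  classical
  obtain ⟨f, hf, hf2⟩ := sep_all S hS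
  have hmex : ∀ v : S → Fin (S.card+1), ∃ a, ∀ γ, v γ ≠ a := by
    intro v
    by_contra hc
    push Not at hc
    have := Fintype.card_le_of_surjective v hc
    simp at this
  choose m hm using hmex
  have hst : ∀ i, Measurable (stg S m f i) := by
    intro i
    induction i with
    | zero => exact measurable_const
    | succ i ih =>
      refine Measurable.ite (hf (measurableSet_singleton i)) ?_ ih
      exact (measurable_of_countable m).comp
        (measurable_pi_lambda _ fun γ => ih.comp (measurable_sh γ.1))
  have hlate : ∀ x i, f x < i → stg S m f i x = stg S m f (f x + 1) x := by
    intro x i hi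
    induction i, hi using Nat.le_induction with
    | base => rfl
    | succ i hi ih =>
      have : f x ≠ i := by have : f x < i := hi; omega
      rw [stg]; simp only [if_neg this]; exact ih
  have key : ∀ x, ∀ γ ∈ S, f (sh γ x) < f x → stg S m f (f (sh γ x) + 1) (sh γ x) ≠ stg S m f (f x + 1) x := by
    intro x γ hγ h
    rw [← hlate _ _ h]
    rw [stg.eq_2]; simp only [if_true]
    exact hm (fun γ => stg S m f (f x) (sh γ.1 x)) ⟨γ, hγ⟩
  refine ⟨S.card+1, fun x => stg S m f (f x + 1) x, by omega, ?_, fun x hx γ hγ => ?_⟩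
  · have : Measurable (fun q : ℕ × (FG n → Bool) => stg S m f (q.1+1) q.2) :=
      measurable_from_prod_countable_right fun k => hst (k+1)
    exact this.comp (hf.prodMk measurable_id)
  · rcases lt_or_gt_of_ne (hf2 x hx γ hγ) with h | h
    · exact key x γ hγ h
    · have e : sh γ⁻¹ (sh γ x) = x := by rw [sh_sh_s4]; simp [sh_one_s4]
      have := key (sh γ x) γ⁻¹ (hsym γ hγ)
      rw [e] at this
      exact (this h).symm

end col
end BFC
end

section
namespace BFC

section fin
variable {n M : ℕ}

lemma count_inj {A : Type*} [Fintype A] {q : ℕ} (e : A → Fin q) (he : Function.Injective e)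
    (E : (A → Fin M) → Prop) :
    Nat.card {ρ : Fin q → Fin M // E (fun a => ρ (e a))} * M ^ (Fintype.card A) =
      Nat.card {c : A → Fin M // E c} * M ^ q := by
  classical
  let p : Fin q → Prop := fun j => j ∈ Set.range e
  let Φ : (Fin q → Fin M) ≃ (A → Fin M) × ({j // ¬ p j} → Fin M) :=
    (Equiv.piEquivPiSubtypeProd p (fun _ => Fin M)).trans
      (Equiv.prodCongr (Equiv.arrowCongr (Equiv.ofInjective e he).symm (Equiv.refl _)) (Equiv.refl _))
  have hΦ : ∀ ρ, (Φ ρ).1 = fun a => ρ (e a) := fun ρ => rfl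
  have h1 : Nat.card {ρ : Fin q → Fin M // E (fun a => ρ (e a))} =
      Nat.card {c : A → Fin M // E c} * Nat.card ({j // ¬ p j} → Fin M) := by
    rw [← Nat.card_prod]
    refine Nat.card_congr ((Φ.subtypeEquiv (q := fun z => E z.1) fun ρ => ?_).trans
      Equiv.prodSubtypeFstEquivSubtypeProd)
    rw [hΦ]
  have h2 : M ^ q = M ^ Fintype.card A * Nat.card ({j // ¬ p j} → Fin M) := by
    have := Nat.card_congr Φ
    rw [Nat.card_prod] at this
    simpa using this
  rw [h1, h2]; ring

lemma Ev_count (hM : 0 < M) {D : Finset (FG n)} (hD : Dep (D : Set (FG n)) (Ev : (FG n → Fin M) → Prop)) :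
    (PM n (mu M)).real {Λ | Ev Λ} * M ^ D.card = Nat.card {c : D → Fin M // Ev (extd ⟨0, hM⟩ c)} := by
  classical
  have := mu_prob hM
  have h := lw_dep (mu M) ⟨0, hM⟩ hD True
  have e : lw (PM n (mu M)) Ev True = (PM n (mu M)).real {Λ | Ev Λ} := by
    unfold lw; congr 1; ext Λ; simp
  have hM' : (M:ℝ) ≠ 0 := by positivity
  rw [← e, h]
  simp only [mu_real, Finset.prod_const, Finset.card_univ, Fintype.card_coe, ← Finset.mul_sum, eq_iff_iff, iff_true]
  rw [Finset.sum_boole, Nat.card_eq_fintype_card, Fintype.card_subtype, mul_right_comm, ← mul_pow]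
  simp [hM']

lemma upper_part (hM : 0 < M) : ∃ (k ℓ : ℕ) (I : Fin ℓ → Set (FG n → Bool)), 0 < ℓ ∧
    (k : ℝ) = ℓ * (PM n (mu M)).real {Λ | Ev Λ} ∧
    (∀ i, MeasurableSet (I i) ∧ I i ⊆ freePart (FG n) ∧ IndepIn (freeGroupSchreierAdj n) (I i)) ∧
    ∀ x ∈ freePart (FG n), k ≤ Nat.card {i // x ∈ I i} := by
  classical
  obtain ⟨D, hD⟩ := Ev_dep (n := n) (M := M)
  let S : Finset (FG n) := ((D ×ˢ D).image fun p => p.1 * p.2⁻¹).erase 1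
  obtain ⟨q, c, hq, hc, hc2⟩ := fin_col S (by simp [S]) (by
    intro γ hγ
    simp only [S, Finset.mem_erase, Finset.mem_image, Finset.mem_product, Prod.exists] at hγ ⊢
    obtain ⟨h1, a, b, ⟨ha, hb⟩, rfl⟩ := hγ
    exact ⟨fun h => h1 (inv_eq_one.mp h), b, a, ⟨hb, ha⟩, by simp⟩)
  have hinj : ∀ x ∈ freePart (FG n), Function.Injective (fun d : D => c (sh d.1 x)) := by
    intro x hx d d' h
    by_contra hne
    have hne' : d'.1 ≠ d.1 := fun h => hne (Subtype.ext h.symm)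
    have := hc2 (sh d.1 x) (sh_free hx _) (d'.1 * d.1⁻¹) (by
      simp only [S, Finset.mem_erase, Finset.mem_image, Finset.mem_product, Prod.exists]
      refine ⟨fun h => hne' (mul_inv_eq_one.mp h), _, _, ⟨d'.2, d.2⟩, rfl⟩)
    rw [sh_sh_s4] at this
    simp only [inv_mul_cancel_right] at this
    exact this h.symm
  let Z : (Fin q → Fin M) → (FG n → Bool) → (FG n → Fin M) := fun ρ x δ => ρ (c (sh δ x))
  have hZ : ∀ ρ, Measurable (Z ρ) := fun ρ => measurable_pi_lambda _ fun δ =>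
    (measurable_of_countable ρ).comp (hc.comp (measurable_sh δ))
  have hZs : ∀ ρ γ x, Z ρ (sh γ x) = sh γ (Z ρ x) := by
    intro ρ γ x; funext δ; simp only [Z, sh_sh_s4]; rfl
  let ε := Fintype.equivFin (Fin q → Fin M)
  let I : Fin (Fintype.card (Fin q → Fin M)) → Set (FG n → Bool) :=
    fun i => freePart (FG n) ∩ {x | Ev (Z (ε.symm i) x)}
  have hcard : ∀ x ∈ freePart (FG n), (Nat.card {i // x ∈ I i} : ℝ) = M^q * (PM n (mu M)).real {Λ | Ev Λ} := by
    intro x hx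
    have e1 : Nat.card {i // x ∈ I i} = Nat.card {ρ : Fin q → Fin M //
        Ev (extd ⟨0, hM⟩ (fun d : D => ρ (c (sh d.1 x))))} := by
      refine Nat.card_congr (ε.symm.subtypeEquiv fun i => ?_)
      have : Ev (extd ⟨0, hM⟩ (fun d : D => (ε.symm i) (c (sh d.1 x)))) = Ev (Z (ε.symm i) x) :=
        hD.extd ⟨0, hM⟩ (Z (ε.symm i) x)
      rw [this]
      exact ⟨fun h => h.2, fun h => ⟨hx, h⟩⟩
    have e2 := count_inj (M := M) _ (hinj x hx) (fun z => Ev (extd ⟨0, hM⟩ z))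
    rw [← e1, Fintype.card_coe] at e2
    have e3 := Ev_count hM hD
    have e2' : (Nat.card {i // x ∈ I i} : ℝ) * M ^ D.card =
      Nat.card {c : D → Fin M // Ev (extd ⟨0, hM⟩ c)} * M ^ q := by exact_mod_cast e2
    rw [← e3] at e2'
    have hM' : (M:ℝ)^D.card ≠ 0 := by positivity
    apply mul_right_cancel₀ hM'
    rw [e2']; ring
  have hI : ∀ i, MeasurableSet (I i) ∧ I i ⊆ freePart (FG n) ∧ IndepIn (freeGroupSchreierAdj n) (I i) := by
    intro i
    refine ⟨free_meas_s4.inter (hZ _ (dep_meas hD)), Set.inter_subset_left, ?_⟩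
    rintro x ⟨_, hx⟩ y ⟨_, hy⟩ ⟨_, _, _, j, h | h⟩
    · have h' : y = sh (el (j, true)) x := h
      rw [h', Set.mem_ofPred_eq, hZs] at hy
      exact Ev_indep _ _ ⟨hx, hy⟩
    · have h' : y = sh (el (j, false)) x := by
        have : el (j, false) = (FreeGroup.of j)⁻¹ := el_iv (j, true)
        rw [this]; exact h
      rw [h', Set.mem_ofPred_eq, hZs] at hy
      exact Ev_indep _ _ ⟨hx, hy⟩
  have hl : 0 < Fintype.card (Fin q → Fin M) := by
    simp; positivity
  have hl2 : (Fintype.card (Fin q → Fin M) : ℝ) = M^q := by simp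
  -- integrality of k: count using any injection
  by_cases hne : (freePart (FG n)).Nonempty
  · obtain ⟨x0, hx0⟩ := hne
    refine ⟨Nat.card {i // x0 ∈ I i}, _, I, hl, ?_, hI, fun x hx => ?_⟩
    · rw [hcard x0 hx0, hl2]
    · have := (hcard x0 hx0).trans (hcard x hx).symm
      exact_mod_cast this.le
  · refine ⟨Nat.card {c : D → Fin M // Ev (extd ⟨0, hM⟩ c)}, M^D.card, fun _ => ∅, by positivity, ?_, ?_, ?_⟩
    · rw [← Ev_count hM hD]; push_cast; ring
    · intro i; exact ⟨MeasurableSet.empty, Set.empty_subset _, fun x hx => hx.elim⟩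
    · intro x hx; exact (hne ⟨x, hx⟩).elim

theorem main_aux : Filter.Tendsto (fun n : ℕ => sInf {r : ℝ | ∃ (k ℓ : ℕ) (I : Fin ℓ → Set (FreeGroup (Fin n) → Bool)),
      1 ≤ k ∧ r = (ℓ : ℝ) / k ∧ (∀ i, MeasurableSet (I i) ∧ I i ⊆ freePart (FreeGroup (Fin n)) ∧
        IndepIn (freeGroupSchreierAdj n) (I i)) ∧
      ∀ x ∈ freePart (FreeGroup (Fin n)), k ≤ Nat.card {i // x ∈ I i}} * Real.log n / n)
    Filter.atTop (nhds 2) := by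
  rw [Metric.tendsto_atTop]
  intro ε hε
  set η := min (1/2) (ε/8) with hη
  have h0 : 0 < η := lt_min (by norm_num) (by linarith)
  have h1 : η ≤ 1/2 := min_le_left _ _
  have h2 : η ≤ ε/8 := min_le_right _ _
  obtain ⟨N1, hN1⟩ := lower_part h0 (by linarith)
  obtain ⟨N2, hN2⟩ := upper_local h0
  refine ⟨max (max N1 N2) 2, fun n hn => ?_⟩
  simp only [ge_iff_le, max_le_iff] at hn
  have hn1 : (2:ℝ) ≤ n := by exact_mod_cast hn.2
  set A := {r : ℝ | ∃ (k ℓ : ℕ) (I : Fin ℓ → Set (FreeGroup (Fin n) → Bool)),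
      1 ≤ k ∧ r = (ℓ : ℝ) / k ∧ (∀ i, MeasurableSet (I i) ∧ I i ⊆ freePart (FreeGroup (Fin n)) ∧
        IndepIn (freeGroupSchreierAdj n) (I i)) ∧
      ∀ x ∈ freePart (FreeGroup (Fin n)), k ≤ Nat.card {i // x ∈ I i}} with hA
  set t := Real.log n / n with ht
  have ht0 : 0 < t := div_pos (Real.log_pos (by linarith)) (by linarith)
  have hlow : ∀ r ∈ A, 2 / ((1+η) * t) ≤ r := by
    rintro r ⟨k, ℓ, I, hk, rfl, hI, hc⟩
    have := hN1 n hn.1.1 k ℓ I hk hI hc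
    have hk' : (0:ℝ) < k := by exact_mod_cast hk
    rw [div_le_div_iff₀ (by positivity) hk']
    linarith
  have hup : ∃ r ∈ A, r ≤ 2 / ((1-η) * t) := by
    obtain ⟨M, hM, hθ⟩ := hN2 n hn.1.2
    obtain ⟨k, ℓ, I, hl, hkl, hI, hc⟩ := upper_part (n := n) hM
    have hη1 : 0 < 1 - η := by linarith
    have hl' : (0:ℝ) < ℓ := by exact_mod_cast hl
    have hθ0 : 0 < (1-η)/2 * t := by positivity
    have hk : (0:ℝ) < k := by rw [hkl]; exact mul_pos hl' (lt_of_lt_of_le hθ0 hθ)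
    refine ⟨ℓ/k, ⟨k, ℓ, I, by exact_mod_cast hk, rfl, hI, hc⟩, ?_⟩
    rw [div_le_div_iff₀ hk (by positivity), hkl]
    nlinarith [mul_le_mul_of_nonneg_left hθ hl'.le]
  obtain ⟨r, hr, hr2⟩ := hup
  have b1 : 2 / ((1+η)*t) ≤ sInf A := le_csInf ⟨r, hr⟩ hlow
  have b2 : sInf A ≤ 2 / ((1-η)*t) := (csInf_le ⟨_, hlow⟩ hr).trans hr2
  have e : sInf A * Real.log n / n = sInf A * t := by rw [ht]; ring
  rw [e, Real.dist_eq, abs_lt]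
  have hη1 : 0 < 1 - η := by linarith
  rw [div_le_iff₀ (by positivity)] at b1
  rw [le_div_iff₀ (by positivity)] at b2
  set z := sInf A * t with hz
  have b1' : 2 ≤ z * (1+η) := by rw [hz]; linarith
  have b2' : z * (1-η) ≤ 2 := by rw [hz]; linarith
  have hz4 : z ≤ 4 := by nlinarith
  constructor <;> nlinarith
end fin
end BFC
end

/-- The Borel fractional chromatic number of `G_n` is
`(2 + o(1)) n / log n`. -/
theorem borel_fractional_chromatic_free_group_asymptotics
    (β : ∀ n : ℕ, Measure (FreeGroup (Fin n) → Bool))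
    (hprob : ∀ n, IsProbabilityMeasure (β n))
    (hβ : ∀ n, IsBernoulliMeasure (β n)) :
    Filter.Tendsto (fun n : ℕ =>
        sInf { r : ℝ | ∃ (k ℓ : ℕ) (I : Fin ℓ → Set (FreeGroup (Fin n) → Bool)),
            1 ≤ k ∧ r = (ℓ : ℝ) / (k : ℝ) ∧
            (∀ i, MeasurableSet (I i) ∧ I i ⊆ freePart (FreeGroup (Fin n)) ∧
              IndepIn (freeGroupSchreierAdj n) (I i)) ∧
            (∀ x ∈ freePart (FreeGroup (Fin n)), k ≤ Nat.card {i : Fin ℓ // x ∈ I i}) }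
          * Real.log n / n)
      Filter.atTop (nhds 2) := by
  exact BFC.main_aux
end
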